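/- Let Γ ⊆ ℝ³ be a lattice in SOL, i.e. a subgroup of ℝ³ under SOL multiplication that is discrete as a subset of ℝ³ and cocompact (there is a compact set C ⊆ ℝ³ with Γ*C = ℝ³); such a Γ is finitely generated. Then there exists a subset D ⊆ Γ such that for every finite generating set S of Γ, D is a Delone set in (Γ, d_S) and D is non-rectifiable: there is no K ≥ 1 and no bijection f : D → Γ with K⁻¹·d_S(x,y) ≤ d_S(f(x),f(y)) ≤ K·d_S(x,y) for all x,y ∈ D. -/

import Mathlib

/-!
STATEMENT 0: Any lattice in SOL contains a non-rectifiable Delone subset.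

SOL is modelled as ℝ³ with multiplication
(x₁,y₁,t₁)*(x₂,y₂,t₂) = (x₁ + e^{t₁}x₂, y₁ + e^{−t₁}y₂, t₁ + t₂).
-/

/-- The group SOL: underlying set ℝ³. -/
@[ext]
structure SOL where
  x : ℝ
  y : ℝ
  t : ℝ

namespace SOL

/-- SOL multiplication. -/
noncomputable def mul' (g h : SOL) : SOL :=
  ⟨g.x + Real.exp g.t * h.x, g.y + Real.exp (-g.t) * h.y, g.t + h.t⟩

/-- SOL inverse: (x,y,t)⁻¹ = (−e^{−t}x, −e^{t}y, −t). -/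
noncomputable def inv' (g : SOL) : SOL :=
  ⟨-(Real.exp (-g.t) * g.x), -(Real.exp g.t * g.y), -g.t⟩

noncomputable instance : Group SOL where
  mul := mul'
  one := ⟨0, 0, 0⟩
  inv := inv'
  mul_assoc a b c := by
    show mul' (mul' a b) c = mul' a (mul' b c)
    simp only [mul']
    ext <;> simp [Real.exp_add, neg_add] <;> ring
  one_mul a := by
    show mul' ⟨0, 0, 0⟩ a = a
    simp only [mul']
    ext <;> simp
  mul_one a := by
    show mul' a ⟨0, 0, 0⟩ = a
    simp only [mul']
    ext <;> simp
  inv_mul_cancel a := by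
    show mul' (inv' a) a = ⟨0, 0, 0⟩
    simp only [mul', inv']
    ext <;> simp

/-- The topology of ℝ³, transported to SOL. -/
instance : TopologicalSpace SOL :=
  TopologicalSpace.induced (fun g => (g.x, g.y, g.t)) inferInstance

end SOL

/-- The word metric associated to a generating set `S`: `wordDist S g h` is the least `n`
such that `g⁻¹ * h` is a product of `n` elements of `S ∪ S⁻¹`. -/
noncomputable def wordDist {G : Type*} [Group G] (S : Set G) (g h : G) : ℕ :=
  sInf {n : ℕ | ∃ l : List G, l.length = n ∧ (∀ w ∈ l, w ∈ S ∨ w⁻¹ ∈ S) ∧ g⁻¹ * h = l.prod}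


section
open MeasureTheory Set Filter Topology
namespace SolPf

/-- points of `ℝ² ⋊ ℤ`. -/
abbrev P := ℝ × ℝ × ℤ

/-- vertical flow -/
def fl (r : ℤ) (p : P) : P := (p.1, p.2.1, p.2.2 + r)

/-- horizontal translation in the `y` direction -/
noncomputable def yy (b : ℝ) (s : ℝ) (p : P) : P := (p.1, p.2.1 + b ^ (-p.2.2) * s, p.2.2)

/-- coarse neighbourhood relation -/
def near (b : ℝ) (ρ : ℝ) (p q : P) : Prop :=
  |q.1 - p.1| ≤ ρ * b ^ p.2.2 ∧ |q.2.1 - p.2.1| ≤ ρ * b ^ (-p.2.2) ∧ |(q.2.2 : ℝ) - p.2.2| ≤ ρ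

/-- Haar measure -/
noncomputable def vol : Measure P := (volume : Measure ℝ).prod ((volume : Measure ℝ).prod Measure.count)

/-- bounded measurable functions -/
def BM (f : P → ℝ) : Prop := Measurable f ∧ ∃ C, ∀ p, |f p| ≤ C

structure IsMean (b : ℝ) (M : (P → ℝ) → ℝ) : Prop where
  add : ∀ {f g}, BM f → BM g → M (fun p => f p + g p) = M f + M g
  smul : ∀ {f} (c : ℝ), BM f → M (fun p => c * f p) = c * M f
  mono : ∀ {f g}, BM f → BM g → (∀ p, f p ≤ g p) → M f ≤ M g
  one_le : M (fun _ => 1) ≤ 1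
  inv_fl : ∀ {f} (r : ℤ), BM f → M (fun p => f (fl r p)) = M f
  inv_yy : ∀ {f} (s : ℝ), BM f → M (fun p => f (yy b s p)) = M f
  tile : ∀ (ρ : ℝ) (idx : P → ℤ × ℤ × ℤ), Measurable idx →
    (∀ p q, idx p = idx q → near b ρ p q) → ∀ {f g}, BM f → BM g →
    (∀ i, ∫ p in idx ⁻¹' {i}, f p ∂vol ≤ ∫ p in idx ⁻¹' {i}, g p ∂vol) → M f ≤ M g

theorem fl_meas (r : ℤ) : Measurable (fl r) := by
  unfold fl
  fun_prop

theorem zpow_meas (b : ℝ) : Measurable (fun p : P => b ^ (-p.2.2)) := by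
  have : Measurable (fun k : ℤ => b ^ (-k)) := measurable_of_countable _
  exact this.comp (by fun_prop)

theorem zpow_meas' (b : ℝ) : Measurable (fun p : P => b ^ (p.2.2)) := by
  have : Measurable (fun k : ℤ => b ^ (k)) := measurable_of_countable _
  exact this.comp (by fun_prop)

theorem yy_meas (b s : ℝ) : Measurable (yy b s) := by
  unfold yy
  have := zpow_meas b
  fun_prop

theorem fl_fl (r s : ℤ) (p : P) : fl r (fl s p) = fl (s + r) p := by
  simp [fl, add_assoc]

theorem fl_zero (p : P) : fl 0 p = p := by simp [fl]

namespace BM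
variable {f g : P → ℝ}

theorem add (hf : BM f) (hg : BM g) : BM (fun p => f p + g p) := by
  obtain ⟨h1, C, h2⟩ := hf
  obtain ⟨h3, D, h4⟩ := hg
  exact ⟨h1.add h3, C + D, fun p => (abs_add_le _ _).trans (add_le_add (h2 p) (h4 p))⟩

theorem mul (hf : BM f) (hg : BM g) : BM (fun p => f p * g p) := by
  obtain ⟨h1, C, h2⟩ := hf
  obtain ⟨h3, D, h4⟩ := hg
  exact ⟨h1.mul h3, C * D, fun p => by
    rw [abs_mul]; exact mul_le_mul (h2 p) (h4 p) (abs_nonneg _) ((abs_nonneg _).trans (h2 p))⟩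

theorem const (c : ℝ) : BM (fun _ => c) := ⟨measurable_const, |c|, fun _ => le_rfl⟩

theorem smul (c : ℝ) (hf : BM f) : BM (fun p => c * f p) := (const c).mul hf

theorem sub (hf : BM f) (hg : BM g) : BM (fun p => f p - g p) := by
  have := hf.add (hg.smul (-1))
  simpa [sub_eq_add_neg] using this

theorem comp {T : P → P} (hf : BM f) (hT : Measurable T) : BM (fun p => f (T p)) :=
  ⟨hf.1.comp hT, hf.2.imp fun _ h p => h (T p)⟩

theorem sum {ι : Type*} (s : Finset ι) (F : ι → P → ℝ) (h : ∀ i ∈ s, BM (F i)) :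
    BM (fun p => ∑ i ∈ s, F i p) := by
  classical
  induction s using Finset.induction_on with
  | empty => simpa using const 0
  | insert a s ha ih =>
    simp only [Finset.sum_insert ha]
    exact (h a (by simp)).add (ih fun i hi => h i (by simp [hi]))

theorem ind {S : Set P} (hS : MeasurableSet S) : BM (S.indicator fun _ => (1 : ℝ)) := by
  refine ⟨measurable_const.indicator hS, 1, fun p => ?_⟩
  by_cases h : p ∈ S <;> simp [h]

end BM

/-- mass of a set -/
noncomputable def mu (M : (P → ℝ) → ℝ) (S : Set P) : ℝ := M (S.indicator fun _ => 1)

namespace IsMean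
variable {b : ℝ} {M : (P → ℝ) → ℝ} (hM : IsMean b M)
include hM

theorem const (c : ℝ) : M (fun _ => c) = c * M (fun _ => 1) := by
  have := hM.smul c (BM.const 1)
  simpa using this

theorem zero : M (fun _ => 0) = 0 := by rw [hM.const, zero_mul]

theorem nonneg {f} (hf : BM f) (h : ∀ p, 0 ≤ f p) : 0 ≤ M f := by
  rw [← hM.zero]; exact hM.mono (BM.const 0) hf h

theorem one_nonneg : 0 ≤ M (fun _ => 1) := hM.nonneg (BM.const 1) (by simp)

theorem le_const {f} (hf : BM f) {c : ℝ} (hc : 0 ≤ c) (h : ∀ p, f p ≤ c) : M f ≤ c := by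
  refine (hM.mono hf (BM.const c) h).trans ?_
  rw [hM.const]
  have := hM.one_le
  nlinarith

theorem sum {ι : Type*} (s : Finset ι) (F : ι → P → ℝ) (h : ∀ i ∈ s, BM (F i)) :
    M (fun p => ∑ i ∈ s, F i p) = ∑ i ∈ s, M (F i) := by
  classical
  induction s using Finset.induction_on with
  | empty => simpa using hM.zero
  | insert a s ha ih =>
    simp only [Finset.sum_insert ha]
    rw [hM.add (h a (by simp)) (BM.sum s F fun i hi => h i (by simp [hi])),
      ih fun i hi => h i (by simp [hi])]

theorem sub {f g} (hf : BM f) (hg : BM g) : M (fun p => f p - g p) = M f - M g := by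
  have := hM.add hf (hg.smul (-1))
  rw [hM.smul (-1) hg] at this
  simpa [sub_eq_add_neg] using this

theorem mu_nonneg {S : Set P} (hS : MeasurableSet S) : 0 ≤ mu M S :=
  hM.nonneg (BM.ind hS) fun p => indicator_nonneg (by simp) p

theorem mu_mono {S T : Set P} (hS : MeasurableSet S) (hT : MeasurableSet T) (h : S ⊆ T) :
    mu M S ≤ mu M T :=
  hM.mono (BM.ind hS) (BM.ind hT) fun p => indicator_le_indicator_of_subset h (fun _ => zero_le_one) p

theorem mu_union {S T : Set P} (hS : MeasurableSet S) (hT : MeasurableSet T) :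
    mu M (S ∪ T) ≤ mu M S + mu M T := by
  unfold mu
  rw [← hM.add (BM.ind hS) (BM.ind hT)]
  refine hM.mono (BM.ind (hS.union hT)) ((BM.ind hS).add (BM.ind hT)) fun p => ?_
  by_cases h1 : p ∈ S <;> by_cases h2 : p ∈ T <;> simp [h1, h2]

theorem mu_disj {S T : Set P} (hS : MeasurableSet S) (hT : MeasurableSet T) (h : Disjoint S T) :
    mu M (S ∪ T) = mu M S + mu M T := by
  unfold mu
  rw [← hM.add (BM.ind hS) (BM.ind hT)]
  congr 1
  ext p
  rw [Set.indicator_union_of_disjoint h]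

theorem mu_le_two {S T U : Set P} (hS : MeasurableSet S) (hT : MeasurableSet T)
    (hU : MeasurableSet U) (h : S ⊆ T ∪ U) : mu M S ≤ mu M T + mu M U :=
  (hM.mu_mono hS (hT.union hU) h).trans (hM.mu_union hT hU)

theorem mu_biUnion {ι : Type*} (s : Finset ι) (F : ι → Set P) (h : ∀ i ∈ s, MeasurableSet (F i)) :
    mu M (⋃ i ∈ s, F i) ≤ ∑ i ∈ s, mu M (F i) := by
  classical
  induction s using Finset.induction_on with
  | empty => simpa [mu] using hM.zero.le
  | insert a s ha ih =>
    rw [Finset.sum_insert ha, Finset.set_biUnion_insert]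
    exact (hM.mu_union (h a (by simp)) (Finset.measurableSet_biUnion _ fun i hi => h i (by simp [hi]))).trans
      (add_le_add le_rfl (ih fun i hi => h i (by simp [hi])))

theorem mu_univ_le : mu M univ ≤ 1 := by
  have := hM.one_le
  simpa [mu] using this

theorem mu_fl {S : Set P} (hS : MeasurableSet S) (r : ℤ) : mu M (fl r ⁻¹' S) = mu M S :=
  hM.inv_fl r (BM.ind hS)

theorem mu_yy {S : Set P} (hS : MeasurableSet S) (s : ℝ) : mu M (yy b s ⁻¹' S) = mu M S :=
  hM.inv_yy s (BM.ind hS)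

theorem markov {f} (hf : BM f) (h : ∀ p, 0 ≤ f p) {c : ℝ} (hc : 0 < c) :
    mu M {p | c < f p} ≤ M f / c := by
  rw [le_div_iff₀ hc, mul_comm]
  have hS : MeasurableSet {p | c < f p} := measurableSet_lt measurable_const hf.1
  unfold mu
  rw [← hM.smul c (BM.ind hS)]
  refine hM.mono ((BM.ind hS).smul c) hf fun p => ?_
  by_cases h1 : c < f p
  · simp [h1, h1.le]
  · simp [h1, h p]

end IsMean
end SolPf
end

section
open MeasureTheory Set Filter Topology
namespace SolPf

theorem card_floor_Icc (A : ℝ) (hA : 1 ≤ A) (C : ℝ) (hC : 0 ≤ C) :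
    ((Finset.Icc ⌊-(C * A)⌋ ⌊C * A⌋).card : ℝ) ≤ (2 * C + 2) * A := by
  rw [Int.card_Icc]
  have h1 : (0 : ℤ) ≤ ⌊C * A⌋ + 1 - ⌊-(C * A)⌋ := by
    have : ⌊-(C * A)⌋ ≤ ⌊C * A⌋ := Int.floor_le_floor (by nlinarith)
    omega
  have h2 : (((⌊C * A⌋ + 1 - ⌊-(C * A)⌋).toNat : ℕ) : ℝ) = ((⌊C * A⌋ + 1 - ⌊-(C * A)⌋ : ℤ) : ℝ) := by
    exact_mod_cast congrArg (Int.cast : ℤ → ℝ) (Int.toNat_of_nonneg h1)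
  rw [h2]
  push_cast
  have := Int.floor_le (C * A)
  have := Int.lt_floor_add_one (-(C * A))
  nlinarith

/-- counting in a box with bounded fibres -/
theorem count_codes (q B : ℕ) (C b : ℝ) (hb : 1 < b) (hC : 0 ≤ C) (T : Finset ℕ)
    (code : ℕ → (ℕ × ℤ) × (ℤ × ℤ))
    (h1 : ∀ k ∈ T, (code k).1.1 ≤ q)
    (h2 : ∀ k ∈ T, (code k).1.2 ∈ Finset.Icc (-(q : ℤ) - B) B)
    (h3 : ∀ k ∈ T, (code k).2.1 ∈ Finset.Icc ⌊-(C * b ^ (q - (code k).1.1))⌋ ⌊C * b ^ (q - (code k).1.1)⌋)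
    (h4 : ∀ k ∈ T, (code k).2.2 ∈ Finset.Icc ⌊-(C * b ^ ((code k).1.1))⌋ ⌊C * b ^ ((code k).1.1)⌋)
    (h5 : ∀ k ∈ T, ∀ k' ∈ T, code k = code k' → |(k : ℤ) - k'| ≤ B) :
    (T.card : ℝ) ≤ (2 * B + 1) * ((q + 1) * (q + 2 * B + 1) * ((2 * C + 2) ^ 2 * b ^ q)) := by
  classical
  have e1 : T.card ≤ (2 * B + 1) * (T.image code).card := by
    apply Finset.card_le_mul_card_image
    intro a ha
    obtain ⟨k, hk, rfl⟩ := Finset.mem_image.1 ha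
    have : (Finset.filter (fun x => code x = code k) T).card ≤ (Finset.Icc ((k : ℤ) - B) (k + B)).card := by
      apply Finset.card_le_card_of_injOn (fun x : ℕ => (x : ℤ))
      · intro x hx
        simp only [Finset.coe_filter, mem_ofPred_eq] at hx
        have := abs_le.1 (h5 x hx.1 k hk hx.2)
        simp only [Finset.coe_Icc, mem_Icc]
        omega
      · intro x _ y _ h
        simpa using h
    refine this.trans ?_
    rw [Int.card_Icc]
    omega
  have e2 : T.image code ⊆ ((Finset.range (q + 1)) ×ˢ (Finset.Icc (-(q : ℤ) - B) B)).biUnion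
      (fun a => {a} ×ˢ ((Finset.Icc ⌊-(C * b ^ (q - a.1))⌋ ⌊C * b ^ (q - a.1)⌋) ×ˢ
        (Finset.Icc ⌊-(C * b ^ (a.1))⌋ ⌊C * b ^ (a.1)⌋))) := by
    intro z hz
    obtain ⟨k, hk, rfl⟩ := Finset.mem_image.1 hz
    rw [Finset.mem_biUnion]
    refine ⟨(code k).1, ?_, ?_⟩
    · rw [Finset.mem_product, Finset.mem_range]
      exact ⟨Nat.lt_succ_of_le (h1 k hk), h2 k hk⟩
    · rw [Finset.mem_product, Finset.mem_product]
      exact ⟨by simp, h3 k hk, h4 k hk⟩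
  have e3 : ((T.image code).card : ℝ) ≤ (q + 1) * (q + 2 * B + 1) * ((2 * C + 2) ^ 2 * b ^ q) := by
    have := Finset.card_le_card e2
    have h6 := this.trans Finset.card_biUnion_le
    have h7 : ((T.image code).card : ℝ) ≤ ∑ a ∈ ((Finset.range (q + 1)) ×ˢ (Finset.Icc (-(q : ℤ) - B) B)),
      (((2 * C + 2) ^ 2 * b ^ q)) := by
      refine (Nat.cast_le (α := ℝ).2 h6).trans ?_
      push_cast
      apply Finset.sum_le_sum
      intro a ha
      rw [Finset.mem_product, Finset.mem_range] at ha
      rw [Finset.card_product, Finset.card_product]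
      have g1 := card_floor_Icc (b ^ (q - a.1)) (one_le_pow₀ hb.le) C hC
      have g2 := card_floor_Icc (b ^ (a.1)) (one_le_pow₀ hb.le) C hC
      have g3 : b ^ q = b ^ (q - a.1) * b ^ a.1 := by
        rw [← pow_add]; congr 1; omega
      simp only [Finset.card_singleton, one_mul]
      push_cast
      calc _ ≤ ((2 * C + 2) * b ^ (q - a.1)) * ((2 * C + 2) * b ^ a.1) :=
            mul_le_mul g1 g2 (by positivity) (by positivity)
        _ = _ := by rw [g3]; ring
    rw [Finset.sum_const, Finset.card_product, Finset.card_range, Int.card_Icc, nsmul_eq_mul] at h7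
    have h8 : ((B : ℤ) + 1 - (-(q : ℤ) - B)).toNat = q + 2 * B + 1 := by omega
    rw [h8] at h7
    push_cast at h7
    exact h7
  calc (T.card : ℝ) ≤ (2 * B + 1) * ((T.image code).card : ℝ) := by exact_mod_cast e1
    _ ≤ _ := by gcongr

/-- a path with steps bounded by `near B` and heights in `[lo, lo+q]`. -/
theorem path_x (b : ℝ) (hb : 1 < b) (B : ℝ) (hB : 0 ≤ B) (c : ℕ → P) (hi : ℤ) (m : ℕ)
    (hc : ∀ i < m, near b B (c i) (c (i + 1))) (hh : ∀ i ≤ m, (c i).2.2 ≤ hi) :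
    |(c m).1 - (c 0).1| ≤ m * (B * b ^ hi) := by
  induction m with
  | zero => simp
  | succ m ih =>
    have h1 := ih (fun i hi' => hc i (by omega)) (fun i hi' => hh i (by omega))
    have h2 := (hc m (by omega)).1
    have h3 : b ^ (c m).2.2 ≤ b ^ hi := zpow_le_zpow_right₀ hb.le (hh m (by omega))
    have h4 : B * b ^ (c m).2.2 ≤ B * b ^ hi := by gcongr
    push_cast
    have := abs_sub_le (c (m + 1)).1 (c m).1 (c 0).1
    linarith

theorem path_y (b : ℝ) (hb : 1 < b) (B : ℝ) (hB : 0 ≤ B) (c : ℕ → P) (lo : ℤ) (m : ℕ)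
    (hc : ∀ i < m, near b B (c i) (c (i + 1))) (hh : ∀ i ≤ m, lo ≤ (c i).2.2) :
    |(c m).2.1 - (c 0).2.1| ≤ m * (B * b ^ (-lo)) := by
  induction m with
  | zero => simp
  | succ m ih =>
    have h1 := ih (fun i hi' => hc i (by omega)) (fun i hi' => hh i (by omega))
    have h2 := (hc m (by omega)).2.1
    have h3 : b ^ (-(c m).2.2) ≤ b ^ (-lo) :=
      zpow_le_zpow_right₀ hb.le (by have := hh m (by omega); omega)
    have h4 : B * b ^ (-(c m).2.2) ≤ B * b ^ (-lo) := by gcongr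
    push_cast
    have := abs_sub_le (c (m + 1)).2.1 (c m).2.1 (c 0).2.1
    linarith

theorem near_fl_one (b : ℝ) (hb : 1 < b) (p : P) (i : ℤ) : near b 1 (fl i p) (fl (i + 1) p) := by
  have : 0 < b := by linarith
  refine ⟨?_, ?_, ?_⟩ <;> simp [fl] <;> positivity

/-- the endpoint of a bad path -/
theorem bad_code (b : ℝ) (hb : 1 < b) (B : ℕ) (m q : ℕ) (o : P) (c : ℕ → P)
    (ho : near b B o (c 0)) (hc : ∀ i < m, near b B (c i) (c (i + 1)))
    (hq : ∀ i ≤ m, ∀ j ≤ m, (c i).2.2 - (c j).2.2 ≤ q) :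
    ∃ (s : ℕ) (lo : ℤ), s ≤ q ∧ lo ∈ Finset.Icc (-(q : ℤ) - B) B ∧ (c m).2.2 = o.2.2 + lo + s ∧
      |((c m).1 - o.1) * b ^ (-(c m).2.2)| ≤ ((m + 1) * B * b ^ B) * b ^ (q - s) ∧
      |((c m).2.1 - o.2.1) * b ^ ((c m).2.2)| ≤ ((m + 1) * B * b ^ B) * b ^ s := by
  have hb0 : 0 < b := by linarith
  obtain ⟨i0, hi0, hmin⟩ := Finset.exists_min_image (Finset.range (m + 1)) (fun i => (c i).2.2)
    ⟨0, by simp⟩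
  have hmin' : ∀ i ≤ m, (c i0).2.2 ≤ (c i).2.2 := fun i hi => hmin i (by simp; omega)
  have hi0' : i0 ≤ m := by simp at hi0; omega
  set l := (c i0).2.2 with hl
  have hB1 : |(c 0).2.2 - o.2.2| ≤ (B : ℤ) := by
    have := ho.2.2
    exact_mod_cast this
  have hB2 := abs_le.1 hB1
  have f1 := hmin' 0 (by omega)
  have f2 := hmin' m le_rfl
  have f3 := hq m le_rfl i0 hi0'
  have f4 := hq 0 (by omega) i0 hi0'
  rw [← hl] at f3 f4
  refine ⟨((c m).2.2 - l).toNat, l - o.2.2, by omega, ?_, by omega, ?_, ?_⟩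
  · rw [Finset.mem_Icc]; constructor <;> omega
  · have g1 := path_x b hb B (by positivity) c (l + q) m hc (fun i hi => by
      have := hq i hi i0 hi0'; rw [← hl] at this; omega)
    have g2 := ho.1
    have g3 : b ^ o.2.2 ≤ b ^ (l + q + B) := zpow_le_zpow_right₀ hb.le (by omega)
    have g4 : b ^ (l + q) ≤ b ^ (l + q + B) := zpow_le_zpow_right₀ hb.le (by omega)
    have g5 := abs_sub_le (c m).1 (c 0).1 o.1
    have g6 : |(c m).1 - o.1| ≤ ((m + 1) * B) * b ^ (l + q + B) := by
      have e1 : (B : ℝ) * b ^ o.2.2 ≤ B * b ^ (l + q + B) := by gcongr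
      have e2 : (m : ℝ) * (B * b ^ (l + q)) ≤ m * (B * b ^ (l + q + B)) := by gcongr
      linarith
    rw [abs_mul, abs_of_pos (zpow_pos hb0 (-(c m).2.2))]
    calc _ ≤ ((m + 1) * B) * b ^ (l + q + B) * b ^ (-(c m).2.2) := by gcongr
      _ = ((m + 1) * B) * (b ^ ((B : ℤ)) * b ^ (((q - ((c m).2.2 - l).toNat : ℕ)) : ℤ)) := by
        rw [mul_assoc, ← zpow_add₀ hb0.ne', ← zpow_add₀ hb0.ne']
        congr 2
        omega
      _ = _ := by rw [zpow_natCast, zpow_natCast]; ring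
  · have g1 := path_y b hb B (by positivity) c l m hc hmin'
    have g2 := ho.2.1
    have g3 : b ^ (-o.2.2) ≤ b ^ (-l + B) := zpow_le_zpow_right₀ hb.le (by omega)
    have g4 : b ^ (-l) ≤ b ^ (-l + B) := zpow_le_zpow_right₀ hb.le (by omega)
    have g5 := abs_sub_le (c m).2.1 (c 0).2.1 o.2.1
    have g6 : |(c m).2.1 - o.2.1| ≤ ((m + 1) * B) * b ^ (-l + B) := by
      have e1 : (B : ℝ) * b ^ (-o.2.2) ≤ B * b ^ (-l + B) := by gcongr
      have e2 : (m : ℝ) * (B * b ^ (-l)) ≤ m * (B * b ^ (-l + B)) := by gcongr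
      linarith
    rw [abs_mul, abs_of_pos (zpow_pos hb0 ((c m).2.2))]
    calc _ ≤ ((m + 1) * B) * b ^ (-l + B) * b ^ ((c m).2.2) := by gcongr
      _ = ((m + 1) * B) * (b ^ ((B : ℤ)) * b ^ (((((c m).2.2 - l).toNat : ℕ)) : ℤ)) := by
        rw [mul_assoc, ← zpow_add₀ hb0.ne', ← zpow_add₀ hb0.ne']
        congr 2
        omega
      _ = _ := by rw [zpow_natCast, zpow_natCast]; ring

theorem abs_sub_of_floor_eq {x y : ℝ} (h : ⌊x⌋ = ⌊y⌋) : |x - y| ≤ 1 :=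
  (Int.abs_sub_lt_one_of_floor_eq_floor h).le

/-- pointwise tree count -/
theorem tree_pointwise (b : ℝ) (hb : 1 < b) (B : ℕ) (m q : ℕ) (ψ : P → P)
    (h1 : ∀ p q, near b 1 p q → near b B (ψ p) (ψ q))
    (h2 : ∀ p q, near b 1 (ψ p) (ψ q) → near b B p q) (r : P) (T : Finset ℕ)
    (hT : ∀ k ∈ T, (k : ℝ) ≤ b ^ m)
    (hbad : ∀ k ∈ T, ∀ i ≤ m, ∀ j ≤ m, (ψ (fl (i : ℕ) (yy b (k * b ^ (-(m : ℤ))) r))).2.2 -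
      (ψ (fl (j : ℕ) (yy b (k * b ^ (-(m : ℤ))) r))).2.2 ≤ (q : ℤ)) :
    (T.card : ℝ) ≤ (2 * B + 1) * ((q + 1) * (q + 2 * B + 1) *
      ((2 * ((m + 1) * B * b ^ B) + 2) ^ 2 * b ^ q)) := by
  classical
  have hb0 : 0 < b := by linarith
  set c : ℕ → ℕ → P := fun k i => ψ (fl (i : ℕ) (yy b (k * b ^ (-(m : ℤ))) r)) with hcdef
  have key : ∀ k : ℕ, ∃ (s : ℕ) (lo : ℤ), k ∈ T → (s ≤ q ∧ lo ∈ Finset.Icc (-(q : ℤ) - B) B ∧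
      (c k m).2.2 = (ψ r).2.2 + lo + s ∧
      |((c k m).1 - (ψ r).1) * b ^ (-(c k m).2.2)| ≤ ((m + 1) * B * b ^ B) * b ^ (q - s) ∧
      |((c k m).2.1 - (ψ r).2.1) * b ^ ((c k m).2.2)| ≤ ((m + 1) * B * b ^ B) * b ^ s) := by
    intro k
    by_cases hk : k ∈ T
    · have g1 : near b 1 r (fl (0 : ℕ) (yy b (k * b ^ (-(m : ℤ))) r)) := by
        have : (k : ℝ) * b ^ (-(m : ℤ)) ≤ 1 := by
          have := hT k hk
          rw [zpow_neg, zpow_natCast, ← div_eq_mul_inv, div_le_one (by positivity)]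
          exact this
        refine ⟨?_, ?_, ?_⟩
        · simp [fl, yy]; positivity
        · simp only [fl, yy, add_sub_cancel_left]
          rw [abs_of_nonneg (by positivity), mul_comm]
          gcongr
        · simp [fl, yy]
      have g2 : ∀ i : ℕ, near b 1 (fl (i : ℕ) (yy b (k * b ^ (-(m : ℤ))) r))
          (fl ((i + 1 : ℕ) : ℤ) (yy b (k * b ^ (-(m : ℤ))) r)) := by
        intro i
        have := near_fl_one b hb (yy b (k * b ^ (-(m : ℤ))) r) i
        exact_mod_cast this
      obtain ⟨s, lo, h⟩ := bad_code b hb B m q (ψ r) (c k) (h1 _ _ g1) (fun i hi => h1 _ _ (g2 i)) (hbad k hk)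
      exact ⟨s, lo, fun _ => h⟩
    · exact ⟨0, 0, fun h => absurd h hk⟩
  choose s lo hs using key
  apply count_codes q B _ b hb (by positivity) T
    (fun k => ((s k, lo k), (⌊((c k m).1 - (ψ r).1) * b ^ (-(c k m).2.2)⌋,
      ⌊((c k m).2.1 - (ψ r).2.1) * b ^ ((c k m).2.2)⌋)))
  · exact fun k hk => (hs k hk).1
  · exact fun k hk => (hs k hk).2.1
  · intro k hk
    have := abs_le.1 (hs k hk).2.2.2.1
    rw [Finset.mem_Icc]
    exact ⟨Int.floor_le_floor this.1, Int.floor_le_floor this.2⟩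
  · intro k hk
    have := abs_le.1 (hs k hk).2.2.2.2
    rw [Finset.mem_Icc]
    exact ⟨Int.floor_le_floor this.1, Int.floor_le_floor this.2⟩
  · intro k hk k' hk' h
    simp only [Prod.mk.injEq] at h
    obtain ⟨⟨e1, e2⟩, e3, e4⟩ := h
    have e5 : (c k' m).2.2 = (c k m).2.2 := by
      rw [(hs k hk).2.2.1, (hs k' hk').2.2.1, e1, e2]
    rw [e5] at e3 e4
    have z1 := abs_sub_of_floor_eq e3.symm
    have z2 := abs_sub_of_floor_eq e4.symm
    have p1 := zpow_pos hb0 (-(c k m).2.2)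
    have p2 := zpow_pos hb0 ((c k m).2.2)
    have n1 : near b 1 (c k m) (c k' m) := by
      refine ⟨?_, ?_, ?_⟩
      · rw [← sub_mul, abs_mul, abs_of_pos p1] at z1
        rw [one_mul, ← div_le_one p2, div_eq_mul_inv, ← zpow_neg]
        rwa [sub_sub_sub_cancel_right] at z1
      · rw [← sub_mul, abs_mul, abs_of_pos p2] at z2
        rw [one_mul, zpow_neg, ← one_div, le_div_iff₀ p2]
        rwa [sub_sub_sub_cancel_right] at z2
      · rw [e5]; simp
    have n2 := (h2 _ _ n1).2.1
    simp only [fl, yy] at n2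
    have n3 : |((k' : ℝ) - k)| ≤ B := by
      have e : r.2.1 + b ^ (-r.2.2) * (↑k' * b ^ (-(m : ℤ))) - (r.2.1 + b ^ (-r.2.2) * (↑k * b ^ (-(m : ℤ))))
        = ((k' : ℝ) - k) * b ^ (-(r.2.2 + (m : ℤ))) := by
        rw [neg_add, zpow_add₀ hb0.ne']; ring
      rw [e, abs_mul, abs_of_pos (zpow_pos hb0 _)] at n2
      exact le_of_mul_le_mul_right n2 (zpow_pos hb0 _)
    rw [abs_sub_comm] at n3
    exact_mod_cast n3

end SolPf
end

section
open MeasureTheory Set Filter Topology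
namespace SolPf

theorem tree_asymp (b : ℝ) (hb : 1 < b) (B : ℕ) (κ : ℝ) (hκ0 : 0 ≤ κ) (hκ : κ < 1) (δ : ℝ) (hδ : 0 < δ) :
    ∃ m0 : ℕ, ∀ m : ℕ, m0 ≤ m → (2 * B + 1) * (((⌊κ * m⌋₊ : ℕ) + 1) * ((⌊κ * m⌋₊ : ℕ) + 2 * B + 1) *
      ((2 * ((m + 1) * B * b ^ B) + 2) ^ 2 * b ^ ⌊κ * m⌋₊)) ≤ δ * b ^ m := by
  have hb0 : 0 < b := by linarith
  set r : ℝ := b ^ (κ - 1) with hr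
  have hr0 : 0 ≤ r := by positivity
  have hr1 : r < 1 := Real.rpow_lt_one_of_one_lt_of_neg hb (by linarith)
  set C0 : ℝ := (2 * B + 1) * ((2 * B + 1) * (2 * B * b ^ B + 2) ^ 2) with hC0
  have hC0p : 0 < C0 := by positivity
  have ht := tendsto_pow_const_mul_const_pow_of_lt_one 4 hr0 hr1
  have hev := ht.eventually (gt_mem_nhds (show (0 : ℝ) < δ / (16 * C0) by positivity))
  obtain ⟨m0, hm0⟩ := eventually_atTop.1 hev
  refine ⟨max m0 1, fun m hm => ?_⟩
  have h1 := hm0 m (le_of_max_le_left hm)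
  have hm1 : (1 : ℝ) ≤ m := by exact_mod_cast le_of_max_le_right hm
  have hq : ((⌊κ * m⌋₊ : ℕ) : ℝ) ≤ κ * m := Nat.floor_le (by positivity)
  have hq2 : ((⌊κ * m⌋₊ : ℕ) : ℝ) ≤ m := hq.trans (by nlinarith)
  have hbq : b ^ ⌊κ * m⌋₊ ≤ r ^ m * b ^ m := by
    rw [← Real.rpow_natCast b ⌊κ * m⌋₊, hr, ← Real.rpow_natCast, ← Real.rpow_mul hb0.le, ← Real.rpow_natCast b m,
      ← Real.rpow_add hb0]
    apply Real.rpow_le_rpow_of_exponent_le hb.le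
    linarith
  have hBn : (0 : ℝ) ≤ B := by positivity
  have e1 : ((⌊κ * m⌋₊ : ℕ) : ℝ) + 1 ≤ m + 1 := by linarith
  have e2 : ((⌊κ * m⌋₊ : ℕ) : ℝ) + 2 * B + 1 ≤ (2 * B + 1) * (m + 1) := by nlinarith
  have e3 : (2 * (((m : ℝ) + 1) * B * b ^ B) + 2) ≤ (2 * B * b ^ B + 2) * (m + 1) := by
    have : 0 ≤ (B : ℝ) * b ^ B := by positivity
    nlinarith
  calc (2 * (B : ℝ) + 1) * (((⌊κ * m⌋₊ : ℕ) + 1) * ((⌊κ * m⌋₊ : ℕ) + 2 * B + 1) *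
      ((2 * ((m + 1) * B * b ^ B) + 2) ^ 2 * b ^ ⌊κ * m⌋₊))
      ≤ (2 * (B : ℝ) + 1) * ((m + 1) * ((2 * B + 1) * (m + 1)) *
      (((2 * B * b ^ B + 2) * (m + 1)) ^ 2 * (r ^ m * b ^ m))) := by gcongr
    _ = C0 * (m + 1) ^ 4 * r ^ m * b ^ m := by rw [hC0]; ring
    _ ≤ C0 * (2 * m) ^ 4 * r ^ m * b ^ m := by gcongr; linarith
    _ = (16 * C0) * (m ^ 4 * r ^ m) * b ^ m := by ring
    _ ≤ (16 * C0) * (δ / (16 * C0)) * b ^ m := by gcongr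
    _ = δ * b ^ m := by field_simp

/-- paths whose height does not spread -/
def Bad (ψ : P → P) (κ : ℝ) (m : ℕ) : Set P :=
  {p | ∀ i ≤ m, ∀ j ≤ m, (((ψ (fl (i : ℕ) p)).2.2 : ℝ) - (ψ (fl (j : ℕ) p)).2.2) ≤ κ * m}

theorem Bad_meas (ψ : P → P) (hψ : Measurable fun p => (ψ p).2.2) (κ : ℝ) (m : ℕ) :
    MeasurableSet (Bad ψ κ m) := by
  have h : ∀ i : ℕ, Measurable fun p => ((ψ (fl (i : ℕ) p)).2.2 : ℝ) := fun i =>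
    (measurable_of_countable (fun k : ℤ => (k : ℝ))).comp (hψ.comp (fl_meas i))
  have : Bad ψ κ m = ⋂ i : ℕ, ⋂ _ : i ≤ m, ⋂ j : ℕ, ⋂ _ : j ≤ m,
      {p | (((ψ (fl (i : ℕ) p)).2.2 : ℝ) - (ψ (fl (j : ℕ) p)).2.2) ≤ κ * m} := by
    ext p; simp [Bad]
  rw [this]
  refine MeasurableSet.iInter fun i => MeasurableSet.iInter fun _ => MeasurableSet.iInter fun j =>
    MeasurableSet.iInter fun _ => measurableSet_le ((h i).sub (h j)) measurable_const

theorem tree_count (b : ℝ) (hb : 1 < b) (B : ℕ) (κ : ℝ) (hκ0 : 0 ≤ κ) (hκ : κ < 1) (δ : ℝ) (hδ : 0 < δ) :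
    ∃ m0 : ℕ, ∀ m : ℕ, m0 ≤ m → ∀ ψ : P → P, Measurable (fun p => (ψ p).2.2) →
    (∀ p q, near b 1 p q → near b B (ψ p) (ψ q)) →
    (∀ p q, near b 1 (ψ p) (ψ q) → near b B p q) → ∀ M, IsMean b M → mu M (Bad ψ κ m) ≤ δ := by
  classical
  obtain ⟨m0, hm0⟩ := tree_asymp b hb B κ hκ0 hκ δ hδ
  refine ⟨m0, fun m hm ψ hψ h1 h2 M hM => ?_⟩
  have hb0 : 0 < b := by linarith
  have hN := hm0 m hm
  set N := (2 * (B : ℝ) + 1) * (((⌊κ * m⌋₊ : ℕ) + 1) * ((⌊κ * m⌋₊ : ℕ) + 2 * B + 1) *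
      ((2 * ((m + 1) * B * b ^ B) + 2) ^ 2 * b ^ ⌊κ * m⌋₊)) with hNdef
  have hmeas := Bad_meas ψ hψ κ m
  set n := ⌊b ^ m⌋₊ + 1 with hn
  have hn1 : b ^ m ≤ n := by rw [hn]; push_cast; exact (Nat.lt_floor_add_one _).le
  set F : ℕ → P → ℝ := fun k p => (Bad ψ κ m).indicator (fun _ => (1 : ℝ)) (yy b (k * b ^ (-(m : ℤ))) p) with hF
  have hFB : ∀ k, BM (F k) := fun k => (BM.ind hmeas).comp (yy_meas _ _)
  have e1 : M (fun p => ∑ k ∈ Finset.range n, F k p) = n * mu M (Bad ψ κ m) := by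
    rw [hM.sum _ _ (fun k _ => hFB k)]
    have : ∀ k ∈ Finset.range n, M (F k) = mu M (Bad ψ κ m) := fun k _ => hM.inv_yy _ (BM.ind hmeas)
    rw [Finset.sum_congr rfl this]
    simp
  have e2 : M (fun p => ∑ k ∈ Finset.range n, F k p) ≤ N := by
    apply hM.le_const (BM.sum _ _ fun k _ => hFB k) (by positivity)
    intro r
    have : ∑ k ∈ Finset.range n, F k r =
        (((Finset.range n).filter fun k : ℕ => yy b (k * b ^ (-(m : ℤ))) r ∈ Bad ψ κ m).card : ℝ) := by
      rw [Finset.card_filter]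
      push_cast
      apply Finset.sum_congr rfl
      intro k _
      simp [hF, indicator_apply]
    rw [this]
    apply tree_pointwise b hb B m ⌊κ * m⌋₊ ψ h1 h2 r
    · intro k hk
      rw [Finset.mem_filter, Finset.mem_range] at hk
      exact (Nat.le_floor_iff (by positivity)).1 (by omega)
    · intro k hk i hi j hj
      rw [Finset.mem_filter] at hk
      have h := hk.2 i hi j hj
      rw [Int.natCast_floor_eq_floor (by positivity)]
      apply Int.le_floor.2
      push_cast
      exact h
  rw [e1] at e2
  have h3 : 0 < b ^ m := by positivity
  have h4 := hM.mu_nonneg hmeas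
  have h5 : b ^ m * mu M (Bad ψ κ m) ≤ b ^ m * δ := by
    calc _ ≤ n * mu M (Bad ψ κ m) := by gcongr
      _ ≤ _ := by linarith
  exact le_of_mul_le_mul_left h5 h3

end SolPf
end

section
open MeasureTheory Set Filter Topology
namespace SolPf

theorem lip_seq (a : ℤ → ℝ) (B : ℝ) (h : ∀ i, |a (i + 1) - a i| ≤ B) (i : ℤ) (n : ℕ) :
    |a (i + n) - a i| ≤ B * n := by
  induction n with
  | zero => simp
  | succ n ih =>
    have h1 := h (i + n)
    have h2 := abs_sub_le (a (i + n + 1)) (a (i + n)) (a i)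
    push_cast
    rw [← add_assoc]
    linarith

theorem lip_seq' (a : ℤ → ℝ) (B : ℝ) (h : ∀ i, |a (i + 1) - a i| ≤ B) (i j : ℤ) :
    |a i - a j| ≤ B * |(i : ℝ) - j| := by
  rcases le_total j i with hij | hij
  · obtain ⟨n, rfl⟩ := Int.le.dest hij
    have := lip_seq a B h j n
    simpa using this
  · obtain ⟨n, rfl⟩ := Int.le.dest hij
    have := lip_seq a B h i n
    rw [abs_sub_comm]
    simpa using this

theorem line_of_var (a : ℤ → ℝ) (B : ℝ) (h : ∀ i, |a (i + 1) - a i| ≤ B) (s N : ℕ) (hs : 1 ≤ s) (hN : 1 ≤ N)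
    (ε : ℝ) (hε : 0 ≤ ε)
    (hv : ∑ i ∈ Finset.range N, (a (((i + 1) * s : ℕ) : ℤ) - a ((i * s : ℕ) : ℤ) - (a ((N * s : ℕ) : ℤ) - a 0) / N) ^ 2
      ≤ N * s ^ 2 * ε ^ 2) (r : ℕ) (hr : r ≤ N * s) :
    |a r - a 0 - (a ((N * s : ℕ) : ℤ) - a 0) / N / s * r| ≤ ε * (N * s) + 2 * B * s := by
  set avg := (a ((N * s : ℕ) : ℤ) - a 0) / N with havg
  have hB : 0 ≤ B := (abs_nonneg _).trans (h 0)
  have hs0 : (0 : ℝ) < s := by exact_mod_cast hs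
  have hN0 : (0 : ℝ) < N := by exact_mod_cast hN
  set j := r / s with hj
  set t := r % s with ht
  have hrjt : r = j * s + t := by rw [hj, ht, mul_comm]; exact (Nat.div_add_mod r s).symm
  have htlt : t < s := Nat.mod_lt _ (by omega)
  have hjN : j ≤ N := by
    rw [hj]; exact Nat.div_le_of_le_mul (by rw [mul_comm]; exact hr)
  set D : ℕ → ℝ := fun i => a (((i + 1) * s : ℕ) : ℤ) - a ((i * s : ℕ) : ℤ) - avg with hD
  have e1 : a ((j * s : ℕ) : ℤ) - a 0 - j * avg = ∑ i ∈ Finset.range j, D i := by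
    rw [hD, Finset.sum_sub_distrib, Finset.sum_range_sub (fun i : ℕ => a ((i * s : ℕ) : ℤ))]
    simp
  have e2 : |∑ i ∈ Finset.range j, D i| ≤ ∑ i ∈ Finset.range N, |D i| := by
    refine (Finset.abs_sum_le_sum_abs _ _).trans ?_
    apply Finset.sum_le_sum_of_subset_of_nonneg
    · exact Finset.range_mono hjN
    · intros; positivity
  have e3 : ∑ i ∈ Finset.range N, |D i| ≤ ε * (N * s) := by
    apply le_of_sq_le_sq _ (by positivity)
    have := sq_sum_le_card_mul_sum_sq (s := Finset.range N) (f := fun i => |D i|)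
    refine this.trans ?_
    simp only [sq_abs, Finset.card_range]
    calc (N : ℝ) * ∑ i ∈ Finset.range N, D i ^ 2 ≤ N * (N * s ^ 2 * ε ^ 2) := by gcongr
      _ = _ := by ring
  have e4 : |a r - a ((j * s : ℕ) : ℤ)| ≤ B * s := by
    have := lip_seq a B h ((j * s : ℕ) : ℤ) t
    have e : ((r : ℕ) : ℤ) = ((j * s : ℕ) : ℤ) + (t : ℤ) := by exact_mod_cast hrjt
    rw [e]
    refine this.trans ?_
    gcongr
  have e5 : |avg| ≤ B * s := by
    rw [havg, abs_div, abs_of_pos hN0, div_le_iff₀ hN0]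
    have := lip_seq a B h 0 (N * s)
    rw [zero_add] at this
    refine this.trans (le_of_eq ?_)
    push_cast; ring
  have e6 : |avg * (t / s)| ≤ B * s := by
    rw [abs_mul]
    have : |(t : ℝ) / s| ≤ 1 := by
      rw [abs_of_nonneg (by positivity), div_le_one hs0]
      exact_mod_cast htlt.le
    calc _ ≤ |avg| * 1 := by gcongr
      _ ≤ _ := by linarith
  have e7 : a r - a 0 - avg / s * r = (a r - a ((j * s : ℕ) : ℤ)) + (a ((j * s : ℕ) : ℤ) - a 0 - j * avg) - avg * (t / s) := by
    have : (r : ℝ) = j * s + t := by exact_mod_cast hrjt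
    rw [this]
    field_simp
    ring
  rw [e7, e1]
  refine (abs_sub _ _).trans ?_
  have := abs_add_le (a r - a ((j * s : ℕ) : ℤ)) (∑ i ∈ Finset.range j, D i)
  linarith

theorem exists_small_drop (E : ℕ → ℝ) (J : ℕ) (η C : ℝ) (h0 : E 0 ≤ C) (hJ : C < J * η) (hE : 0 ≤ E J) :
    ∃ j < J, E j - E (j + 1) ≤ η := by
  by_contra hcon
  push Not at hcon
  have : ∀ n ≤ J, n * η ≤ E 0 - E n := by
    intro n
    induction n with
    | zero => simp
    | succ n ih =>
      intro hn
      have h1 := ih (by omega)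
      have h2 := hcon n (by omega)
      push_cast
      linarith
  have := this J le_rfl
  linarith

theorem var_identity (N : ℕ) (hN : 1 ≤ N) (D : ℕ → ℝ) (T : ℝ) (hT : ∑ i ∈ Finset.range N, D i = T) :
    ∑ i ∈ Finset.range N, (D i - T / N) ^ 2 = ∑ i ∈ Finset.range N, D i ^ 2 - T ^ 2 / N := by
  have hN0 : (N : ℝ) ≠ 0 := by positivity
  have : ∀ i ∈ Finset.range N, (D i - T / N) ^ 2 = D i ^ 2 - 2 * (T / N) * D i + (T / N) ^ 2 := by
    intros; ring
  rw [Finset.sum_congr rfl this, Finset.sum_add_distrib, Finset.sum_sub_distrib, ← Finset.mul_sum, hT]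
  simp only [Finset.sum_const, Finset.card_range, nsmul_eq_mul]
  field_simp
  ring

section
variable {b : ℝ} {M : (P → ℝ) → ℝ} {v : P → ℝ} {B : ℕ}

theorem lip_line (hv : ∀ p, |v (fl 1 p) - v p| ≤ B) (p : P) : ∀ i : ℤ, |v (fl (i + 1) p) - v (fl i p)| ≤ B := by
  intro i
  have := hv (fl i p)
  rwa [fl_fl] at this

theorem BM_diff (hvm : Measurable v) (hv : ∀ p, |v (fl 1 p) - v p| ≤ B) (r s : ℤ) :
    BM (fun p => v (fl r p) - v (fl s p)) := by
  refine ⟨(hvm.comp (fl_meas r)).sub (hvm.comp (fl_meas s)), B * |(r : ℝ) - s|, fun p => ?_⟩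
  exact lip_seq' (fun i => v (fl i p)) B (lip_line hv p) r s

/-- energy at scale `s` -/
noncomputable def En (M : (P → ℝ) → ℝ) (v : P → ℝ) (s : ℕ) : ℝ :=
  M (fun p => (v (fl s p) - v (fl 0 p)) ^ 2) / s ^ 2

theorem drop_eq (hM : IsMean b M) (hvm : Measurable v) (hv : ∀ p, |v (fl 1 p) - v p| ≤ B) (s N : ℕ) (hs : 1 ≤ s)
    (hN : 1 ≤ N) :
    M (fun p => ∑ i ∈ Finset.range N, (v (fl (((i + 1) * s : ℕ) : ℤ) p) - v (fl ((i * s : ℕ) : ℤ) p)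
      - (v (fl ((N * s : ℕ) : ℤ) p) - v (fl 0 p)) / N) ^ 2) = N * s ^ 2 * (En M v s - En M v (N * s)) := by
  have hs0 : (s : ℝ) ≠ 0 := by positivity
  have hN0 : (N : ℝ) ≠ 0 := by positivity
  have hsq : ∀ r s : ℤ, BM (fun p => (v (fl r p) - v (fl s p)) ^ 2) := fun r s => by
    simpa [pow_two] using (BM_diff hvm hv r s).mul (BM_diff hvm hv r s)
  have e1 : ∀ p, ∑ i ∈ Finset.range N, (v (fl (((i + 1) * s : ℕ) : ℤ) p) - v (fl ((i * s : ℕ) : ℤ) p)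
      - (v (fl ((N * s : ℕ) : ℤ) p) - v (fl 0 p)) / N) ^ 2 =
      (∑ i ∈ Finset.range N, (v (fl (((i + 1) * s : ℕ) : ℤ) p) - v (fl ((i * s : ℕ) : ℤ) p)) ^ 2)
       - (1 / N) * (v (fl ((N * s : ℕ) : ℤ) p) - v (fl 0 p)) ^ 2 := by
    intro p
    rw [var_identity N hN]
    · ring
    · rw [Finset.sum_range_sub (fun i : ℕ => v (fl ((i * s : ℕ) : ℤ) p))]
      simp
  simp_rw [e1]
  rw [hM.sub (BM.sum _ _ fun i _ => hsq _ _) ((hsq _ _).smul _), hM.sum _ _ (fun i _ => hsq _ _), hM.smul _ (hsq _ _)]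
  have e2 : ∀ i ∈ Finset.range N, M (fun p => (v (fl (((i + 1) * s : ℕ) : ℤ) p) - v (fl ((i * s : ℕ) : ℤ) p)) ^ 2)
      = M (fun p => (v (fl s p) - v (fl 0 p)) ^ 2) := by
    intro i _
    rw [← hM.inv_fl ((i * s : ℕ) : ℤ) (hsq s 0)]
    congr 1
    ext p
    rw [fl_fl, fl_fl]
    push_cast
    ring_nf
  rw [Finset.sum_congr rfl e2]
  simp only [Finset.sum_const, Finset.card_range, nsmul_eq_mul, En]
  push_cast
  field_simp

theorem En_nonneg (hM : IsMean b M) (hvm : Measurable v) (hv : ∀ p, |v (fl 1 p) - v p| ≤ B) (s : ℕ) : 0 ≤ En M v s := by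
  unfold En
  have : BM (fun p => (v (fl s p) - v (fl 0 p)) ^ 2) := by
    simpa [pow_two] using (BM_diff hvm hv s 0).mul (BM_diff hvm hv s 0)
  have := hM.nonneg this (fun p => sq_nonneg _)
  positivity

theorem En_le (hM : IsMean b M) (hvm : Measurable v) (hv : ∀ p, |v (fl 1 p) - v p| ≤ B) (s : ℕ) (hs : 1 ≤ s) :
    En M v s ≤ B ^ 2 := by
  unfold En
  have h1 : BM (fun p => (v (fl s p) - v (fl 0 p)) ^ 2) := by
    simpa [pow_two] using (BM_diff hvm hv s 0).mul (BM_diff hvm hv s 0)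
  have hs0 : (0 : ℝ) < s := by exact_mod_cast hs
  rw [div_le_iff₀ (by positivity)]
  apply hM.le_const h1 (by positivity)
  intro p
  have := lip_seq' (fun i => v (fl i p)) B (lip_line hv p) s 0
  simp only [Int.cast_natCast, Int.cast_zero, sub_zero] at this
  rw [abs_of_pos hs0] at this
  rw [← mul_pow]
  exact sq_le_sq' (by linarith [neg_abs_le (v (fl s p) - v (fl 0 p))]) ((le_abs_self _).trans this)

end

/-- S1: at some bounded scale `v` is affine along most vertical segments -/
theorem diff_scale (b : ℝ) (B : ℕ) (ε δ : ℝ) (hε : 0 < ε) (hδ : 0 < δ) (h0 : ℕ) (hh0 : 1 ≤ h0) :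
    ∃ hmax : ℕ, ∀ M, IsMean b M → ∀ v : P → ℝ, Measurable v → (∀ p, |v (fl 1 p) - v p| ≤ B) →
    ∃ h : ℕ, h0 ≤ h ∧ h ≤ hmax ∧ ∃ A : Set P, MeasurableSet A ∧ mu M A ≤ δ ∧
      ∀ p ∉ A, ∃ l : ℝ, ∀ r : ℤ, |r| ≤ 4 * h → |v (fl r p) - v p - l * r| ≤ ε * h := by
  obtain ⟨N, hN⟩ := exists_nat_gt (64 * (B + 1) / ε)
  have hN0 : (0 : ℝ) < N := lt_trans (by positivity) hN
  have hN1 : 1 ≤ N := by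
    have : 0 < N := by exact_mod_cast hN0
    omega
  set ε' := ε / 32 with hε'
  have hε'0 : 0 < ε' := by positivity
  obtain ⟨J, hJ⟩ := exists_nat_gt ((B : ℝ) ^ 2 / (ε' ^ 2 * δ))
  have hJ' : (B : ℝ) ^ 2 < J * (ε' ^ 2 * δ) := by rwa [div_lt_iff₀ (by positivity)] at hJ
  refine ⟨N ^ J * h0, fun M hM v hvm hv => ?_⟩
  set s : ℕ → ℕ := fun j => N ^ j * (8 * h0) with hs
  have hs1 : ∀ j, 1 ≤ s j := fun j => by
    have : 0 < N ^ j := by positivity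
    simp only [hs]; nlinarith
  obtain ⟨j, hjJ, hdrop⟩ := exists_small_drop (fun j => En M v (s j)) J (ε' ^ 2 * δ) (B ^ 2)
    (En_le hM hvm hv _ (hs1 0)) hJ' (En_nonneg hM hvm hv _)
  set G : P → ℝ := (fun p => ∑ i ∈ Finset.range N, (v (fl (((i + 1) * s j : ℕ) : ℤ) p) - v (fl ((i * s j : ℕ) : ℤ) p)
      - (v (fl ((N * s j : ℕ) : ℤ) p) - v (fl 0 p)) / N) ^ 2) with hG
  have hGM := drop_eq hM hvm hv (s j) N (hs1 j) hN1
  have hGB : BM G := by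
    apply BM.sum
    intro i _
    have : BM (fun p => v (fl (((i + 1) * s j : ℕ) : ℤ) p) - v (fl ((i * s j : ℕ) : ℤ) p)
      - (v (fl ((N * s j : ℕ) : ℤ) p) - v (fl 0 p)) / N) := by
      have := (BM_diff hvm hv (((i + 1) * s j : ℕ) : ℤ) ((i * s j : ℕ) : ℤ)).sub
        ((BM_diff hvm hv ((N * s j : ℕ) : ℤ) 0).smul (1 / N))
      simpa [div_eq_inv_mul] using this
    simpa [pow_two] using this.mul this
  set c : ℝ := N * (s j) ^ 2 * ε' ^ 2 with hc
  have hsj0 : (0 : ℝ) < s j := by exact_mod_cast hs1 j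
  have hc0 : 0 < c := by positivity
  have hNs : N * s j = s (j + 1) := by simp only [hs]; ring
  set h := N ^ (j + 1) * h0 with hh
  have h8 : N * s j = 8 * h := by simp only [hs, hh]; ring
  have hAm : MeasurableSet {p | c < G p} := measurableSet_lt measurable_const hGB.1
  refine ⟨h, ?_, ?_, fl (-(4 * h : ℕ)) ⁻¹' {p | c < G p}, fl_meas _ hAm, ?_, ?_⟩
  · rw [hh]; exact Nat.le_mul_of_pos_left _ (by positivity)
  · exact Nat.mul_le_mul_right _ (Nat.pow_le_pow_right hN1 hjJ)
  · rw [hM.mu_fl hAm]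
    refine (hM.markov hGB (fun p => Finset.sum_nonneg fun i _ => sq_nonneg _) hc0).trans ?_
    rw [hG, hGM, div_le_iff₀ hc0, hNs]
    have : En M v (s j) - En M v (s (j + 1)) ≤ ε' ^ 2 * δ := hdrop
    calc _ ≤ N * (s j) ^ 2 * (ε' ^ 2 * δ) := by gcongr
      _ = _ := by rw [hc]; ring
  · intro p hp
    simp only [mem_preimage, mem_ofPred_eq, not_lt] at hp
    set p' := fl (-(4 * h : ℕ)) p with hp'
    have key := line_of_var (fun i => v (fl i p')) B (lip_line hv p') (s j) N (hs1 j) hN1 ε' hε'0.le hp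
    set l := (v (fl ((N * s j : ℕ) : ℤ) p') - v (fl 0 p')) / N / s j with hl
    refine ⟨l, fun r hr => ?_⟩
    have hr' := abs_le.1 hr
    have k1 := key (4 * h + r).toNat (by omega)
    have k2 := key (4 * h) (by omega)
    have e1 : (((4 * h + r).toNat : ℕ) : ℤ) = 4 * h + r := by omega
    have e1' : (((4 * h + r).toNat : ℕ) : ℝ) = 4 * h + r := by exact_mod_cast e1
    have e2 : fl (4 * (h : ℤ) + r) p' = fl r p := by
      rw [hp', fl_fl]; congr 1; push_cast; ring
    have e3 : fl (((4 * h : ℕ) : ℤ)) p' = p := by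
      rw [hp', fl_fl, neg_add_cancel, fl_zero]
    simp only [e1, e1', e2] at k1
    simp only [e3] at k2
    have e4 : (N : ℝ) * s j = 8 * h := by exact_mod_cast h8
    rw [e4] at k1 k2
    have e5 : (B : ℝ) * s j ≤ ε * h / 8 := by
      have a1 : 64 * ((B : ℝ) + 1) < N * ε := by rwa [div_lt_iff₀ hε] at hN
      have a2 : 64 * (B : ℝ) * s j ≤ N * ε * s j := by
        apply mul_le_mul_of_nonneg_right _ hsj0.le
        linarith
      have a3 : (N : ℝ) * ε * s j = 8 * ε * h := by
        calc _ = ε * (N * s j) := by ring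
          _ = _ := by rw [e4]; ring
      linarith
    have e6 : ε' * (8 * h) = ε * h / 4 := by rw [hε']; ring
    rw [e6] at k1 k2
    have e7 : v (fl r p) - v p - l * r = (v (fl r p) - v (fl 0 p') - l * (4 * h + r)) - (v p - v (fl 0 p') - l * ((4 * h : ℕ) : ℝ)) := by
      push_cast; ring
    rw [e7]
    refine (abs_sub _ _).trans ?_
    linarith

end SolPf
end

section
open MeasureTheory Set Filter Topology
namespace SolPf

theorem vol_apply (S : Set P) (hS : MeasurableSet S) :
    vol S = ∑' k : ℤ, volume {z : ℝ × ℝ | (z.1, z.2, k) ∈ S} := by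
  have h1 : vol = ((volume : Measure (ℝ × ℝ)).prod (Measure.count : Measure ℤ)).map MeasurableEquiv.prodAssoc := by
    rw [Measure.volume_eq_prod, Measure.prodAssoc_prod]; rfl
  rw [h1, MeasurableEquiv.map_apply, Measure.prod_apply_symm (MeasurableEquiv.prodAssoc.measurable hS), lintegral_count]
  rfl

theorem vol_box (S T : Set ℝ) (U : Set ℤ) : vol (S ×ˢ T ×ˢ U) = volume S * (volume T * Measure.count U) := by
  unfold vol
  rw [Measure.prod_prod, Measure.prod_prod]

theorem near_finite (b ρ : ℝ) (p : P) : vol {q | near b ρ p q} < ⊤ := by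
  have : {q | near b ρ p q} ⊆ (Icc (p.1 - ρ * b ^ p.2.2) (p.1 + ρ * b ^ p.2.2)) ×ˢ
      (Icc (p.2.1 - ρ * b ^ (-p.2.2)) (p.2.1 + ρ * b ^ (-p.2.2))) ×ˢ (Icc (p.2.2 - ⌈ρ⌉) (p.2.2 + ⌈ρ⌉)) := by
    rintro q ⟨h1, h2, h3⟩
    have h1 := abs_le.1 h1
    have h2 := abs_le.1 h2
    have h4 := abs_le.1 (h3.trans (Int.le_ceil ρ))
    refine ⟨⟨by linarith, by linarith⟩, ⟨by linarith, by linarith⟩, ?_⟩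
    have h5 : -⌈ρ⌉ ≤ q.2.2 - p.2.2 ∧ q.2.2 - p.2.2 ≤ ⌈ρ⌉ := by exact_mod_cast h4
    exact ⟨by omega, by omega⟩
  refine (measure_mono this).trans_lt ?_
  rw [vol_box, Real.volume_Icc, Real.volume_Icc]
  refine ENNReal.mul_lt_top ENNReal.ofReal_lt_top (ENNReal.mul_lt_top ENNReal.ofReal_lt_top ?_)
  exact Measure.count_apply_lt_top.2 (finite_Icc _ _)

theorem IsMean.tile_mu {b : ℝ} {M : (P → ℝ) → ℝ} (hM : IsMean b M) (ρ : ℝ) (idx : P → ℤ × ℤ × ℤ)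
    (hidx : Measurable idx) (hn : ∀ p q, idx p = idx q → near b ρ p q) (Z A : Set P) (hZ : MeasurableSet Z)
    (hA : MeasurableSet A) (c : ℝ) (hc : 0 ≤ c)
    (h : ∀ i, vol (Z ∩ idx ⁻¹' {i}) ≤ ENNReal.ofReal c * vol (A ∩ idx ⁻¹' {i})) :
    mu M Z ≤ c * mu M A := by
  have hfin : ∀ i, vol (idx ⁻¹' {i}) < ⊤ := by
    intro i
    by_cases he : (idx ⁻¹' {i}).Nonempty
    · obtain ⟨p, hp⟩ := he
      refine (measure_mono ?_).trans_lt (near_finite b ρ p)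
      intro q hq
      exact hn p q (by rw [show idx p = i from hp, show idx q = i from hq])
    · rw [not_nonempty_iff_eq_empty.1 he]; simp
  unfold mu
  rw [← hM.smul c (BM.ind hA)]
  refine hM.tile ρ idx hidx hn (BM.ind hZ) ((BM.ind hA).smul c) fun i => ?_
  rw [integral_const_mul, setIntegral_indicator hZ, setIntegral_indicator hA]
  simp only [integral_const, MeasurableSet.univ, measureReal_restrict_apply, univ_inter, smul_eq_mul, mul_one]
  rw [inter_comm, inter_comm _ A]
  have hf : vol (A ∩ idx ⁻¹' {i}) ≠ ⊤ := ((measure_mono inter_subset_right).trans_lt (hfin i)).ne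
  have := ENNReal.toReal_mono (ENNReal.mul_ne_top ENNReal.ofReal_ne_top hf) (h i)
  rw [ENNReal.toReal_mul, ENNReal.toReal_ofReal hc] at this
  exact this

/-- widths of tiles -/
noncomputable def Wx (b : ℝ) (h : ℕ) (K : ℤ) : ℝ := b ^ (2 * h * K + 3 * h)
noncomputable def Wy (b : ℝ) (h : ℕ) (K : ℤ) : ℝ := b ^ (-(2 * h * K) + h)

/-- tile index -/
noncomputable def tidx (b : ℝ) (h : ℕ) (p : P) : ℤ × ℤ × ℤ :=
  (p.2.2 / (2 * h), ⌊p.1 / Wx b h (p.2.2 / (2 * h))⌋, ⌊p.2.1 / Wy b h (p.2.2 / (2 * h))⌋)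

theorem int_meas {α : Type*} [MeasurableSpace α] (f : ℤ → α) : Measurable (fun p : P => f p.2.2) :=
  (measurable_of_countable f).comp (by fun_prop)

theorem tidx_meas (b : ℝ) (h : ℕ) : Measurable (tidx b h) := by
  unfold tidx
  have h1 : Measurable (fun p : P => p.2.2 / (2 * (h : ℤ))) := int_meas (fun k => k / (2 * (h : ℤ)))
  have h2 : Measurable (fun p : P => Wx b h (p.2.2 / (2 * h))) := int_meas (fun k => Wx b h (k / (2 * h)))
  have h3 : Measurable (fun p : P => Wy b h (p.2.2 / (2 * h))) := int_meas (fun k => Wy b h (k / (2 * h)))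
  have h4 : Measurable (fun p : P => p.1 / Wx b h (p.2.2 / (2 * h))) := by fun_prop
  have h5 : Measurable (fun p : P => p.2.1 / Wy b h (p.2.2 / (2 * h))) := by fun_prop
  exact h1.prodMk (h4.floor.prodMk h5.floor)

section
variable {b : ℝ} (hb : 1 < b) {h : ℕ} (hh : 1 ≤ h)
include hb

theorem Wx_pos (K : ℤ) : 0 < Wx b h K := zpow_pos (by linarith) _
theorem Wy_pos (K : ℤ) : 0 < Wy b h K := zpow_pos (by linarith) _

include hh

/-- the tile as a box -/
theorem tile_eq (i : ℤ × ℤ × ℤ) : tidx b h ⁻¹' {i} =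
    (Ico (i.2.1 * Wx b h i.1) ((i.2.1 + 1) * Wx b h i.1)) ×ˢ
    (Ico (i.2.2 * Wy b h i.1) ((i.2.2 + 1) * Wy b h i.1)) ×ˢ (Ico (2 * h * i.1) (2 * h * i.1 + 2 * h)) := by
  ext p
  obtain ⟨K, a, c⟩ := i
  have hx := Wx_pos hb (h := h) K
  have hy := Wy_pos hb (h := h) K
  have hk : p.2.2 / (2 * (h : ℤ)) = K ↔ (2 * h * K ≤ p.2.2 ∧ p.2.2 < 2 * h * K + 2 * h) := by
    rw [Int.ediv_eq_iff_of_pos (by omega)]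
    constructor
    · rintro ⟨h1, h2⟩; constructor <;> nlinarith
    · rintro ⟨h1, h2⟩; constructor <;> nlinarith
  simp only [mem_preimage, mem_singleton_iff, tidx, Prod.mk.injEq, mem_prod, mem_Ico]
  constructor
  · rintro ⟨h1, h2, h3⟩
    rw [h1] at h2 h3
    rw [Int.floor_eq_iff, le_div_iff₀ hx, div_lt_iff₀ hx] at h2
    rw [Int.floor_eq_iff, le_div_iff₀ hy, div_lt_iff₀ hy] at h3
    exact ⟨h2, h3, hk.1 h1⟩
  · rintro ⟨h2, h3, h1⟩
    have h1 := hk.2 h1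
    rw [h1]
    rw [Int.floor_eq_iff, le_div_iff₀ hx, div_lt_iff₀ hx]
    rw [Int.floor_eq_iff, le_div_iff₀ hy, div_lt_iff₀ hy]
    exact ⟨rfl, h2, h3⟩

theorem tidx_near (p q : P) (hpq : tidx b h p = tidx b h q) : near b (b ^ (3 * h) + 2 * h) p q := by
  have hb0 : 0 < b := by linarith
  have h1 : p ∈ tidx b h ⁻¹' {tidx b h p} := rfl
  have h2 : q ∈ tidx b h ⁻¹' {tidx b h p} := hpq.symm
  rw [tile_eq hb hh] at h1 h2
  obtain ⟨⟨a1, a2⟩, ⟨a3, a4⟩, a5, a6⟩ := h1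
  obtain ⟨⟨c1, c2⟩, ⟨c3, c4⟩, c5, c6⟩ := h2
  set K := (tidx b h p).1
  have p1 := zpow_pos hb0 p.2.2
  have p2 := zpow_pos hb0 (-p.2.2)
  have hh0 : (0 : ℝ) ≤ 2 * h := by positivity
  refine ⟨?_, ?_, ?_⟩
  · have e : Wx b h K ≤ b ^ (3 * h) * b ^ p.2.2 := by
      unfold Wx
      rw [← zpow_natCast, ← zpow_add₀ hb0.ne']
      apply zpow_le_zpow_right₀ hb.le
      push_cast; omega
    rw [abs_le]
    constructor <;> nlinarith
  · have e : Wy b h K ≤ b ^ (3 * h) * b ^ (-p.2.2) := by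
      unfold Wy
      rw [← zpow_natCast, ← zpow_add₀ hb0.ne']
      apply zpow_le_zpow_right₀ hb.le
      push_cast; omega
    rw [abs_le]
    constructor <;> nlinarith
  · have e : |q.2.2 - p.2.2| ≤ 2 * (h : ℤ) := by rw [abs_le]; constructor <;> omega
    have e' : |(q.2.2 : ℝ) - p.2.2| ≤ 2 * h := by exact_mod_cast e
    have : 0 < b ^ (3 * h) := by positivity
    linarith

theorem IsMean.tidx_mu {M : (P → ℝ) → ℝ} (hM : IsMean b M) (Z A : Set P) (hZ : MeasurableSet Z)
    (hA : MeasurableSet A) (c : ℝ) (hc : 0 ≤ c)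
    (hv : ∀ i, vol (Z ∩ tidx b h ⁻¹' {i}) ≤ ENNReal.ofReal c * vol (A ∩ tidx b h ⁻¹' {i})) :
    mu M Z ≤ c * mu M A :=
  hM.tile_mu _ _ (tidx_meas b h) (tidx_near hb hh) Z A hZ hA c hc hv
end

/-- the edges of tiles -/
def Edge (b : ℝ) (h w : ℕ) : Set P :=
  {p | p.2.2 < 2 * h * (tidx b h p).1 + w} ∪ {p | 2 * h * (tidx b h p).1 + 2 * h - w ≤ p.2.2} ∪
  {p | p.1 < ((tidx b h p).2.1 + w * b ^ ((w : ℤ) - h)) * Wx b h (tidx b h p).1} ∪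
  {p | ((tidx b h p).2.1 + 1 - w * b ^ ((w : ℤ) - h)) * Wx b h (tidx b h p).1 ≤ p.1} ∪
  {p | p.2.1 < ((tidx b h p).2.2 + w * b ^ ((w : ℤ) - h)) * Wy b h (tidx b h p).1} ∪
  {p | ((tidx b h p).2.2 + 1 - w * b ^ ((w : ℤ) - h)) * Wy b h (tidx b h p).1 ≤ p.2.1}

theorem idx_meas {α : Type*} [MeasurableSpace α] (b : ℝ) (h : ℕ) (f : ℤ × ℤ × ℤ → α) :
    Measurable (fun p : P => f (tidx b h p)) :=
  (measurable_of_countable f).comp (tidx_meas b h)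

theorem Edge_meas (b : ℝ) (h w : ℕ) : MeasurableSet (Edge b h w) := by
  unfold Edge
  have m1 : Measurable fun p : P => p.2.2 := by fun_prop
  have m2 : Measurable fun p : P => p.1 := by fun_prop
  have m3 : Measurable fun p : P => p.2.1 := by fun_prop
  refine ((((?_ : MeasurableSet _).union ?_).union ?_).union ?_).union ?_ |>.union ?_
  · exact measurableSet_lt m1 (idx_meas b h fun i => 2 * h * i.1 + w)
  · exact measurableSet_le (idx_meas b h fun i => 2 * h * i.1 + 2 * h - w) m1
  · exact measurableSet_lt m2 (idx_meas b h fun i => (i.2.1 + w * b ^ ((w : ℤ) - h)) * Wx b h i.1)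
  · exact measurableSet_le (idx_meas b h fun i => (i.2.1 + 1 - w * b ^ ((w : ℤ) - h)) * Wx b h i.1) m2
  · exact measurableSet_lt m3 (idx_meas b h fun i => (i.2.2 + w * b ^ ((w : ℤ) - h)) * Wy b h i.1)
  · exact measurableSet_le (idx_meas b h fun i => (i.2.2 + 1 - w * b ^ ((w : ℤ) - h)) * Wy b h i.1) m3

end SolPf
end

section
open MeasureTheory Set Filter Topology
namespace SolPf

theorem count_Ico (k1 k2 : ℤ) : Measure.count (Ico k1 k2) = ENNReal.ofReal ((k2 - k1 : ℤ) : ℝ) := by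
  rw [← Finset.coe_Ico, Measure.count_apply_finset, Int.card_Ico]
  rcases le_total k1 k2 with hk | hk
  · obtain ⟨n, rfl⟩ := Int.le.dest hk
    simp
  · rw [ENNReal.ofReal_of_nonpos (by exact_mod_cast (by omega))]
    have : (k2 - k1).toNat = 0 := by omega
    simp [this]

theorem vol_Ico (a1 a2 c1 c2 : ℝ) (k1 k2 : ℤ) (ha : a1 ≤ a2) (hc : c1 ≤ c2) :
    vol (Ico a1 a2 ×ˢ Ico c1 c2 ×ˢ Ico k1 k2) = ENNReal.ofReal ((a2 - a1) * ((c2 - c1) * ((k2 - k1 : ℤ) : ℝ))) := by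
  rw [vol_box, Real.volume_Ico, Real.volume_Ico, count_Ico, ENNReal.ofReal_mul (by linarith),
    ENNReal.ofReal_mul (by linarith)]

section
variable {b : ℝ} (hb : 1 < b) {h : ℕ} (hh : 1 ≤ h)
include hb hh

theorem vol_tile (i : ℤ × ℤ × ℤ) : vol (tidx b h ⁻¹' {i}) =
    ENNReal.ofReal (Wx b h i.1 * (Wy b h i.1 * (2 * h))) := by
  have hx := Wx_pos hb (h := h) i.1
  have hy := Wy_pos hb (h := h) i.1
  rw [tile_eq hb hh, vol_Ico _ _ _ _ _ _ (by nlinarith) (by nlinarith)]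
  congr 1
  push_cast
  ring

/-- pieces of tiles -/
theorem piece_mu {M : (P → ℝ) → ℝ} (hM : IsMean b M) (S : Set P) (hS : MeasurableSet S) (c : ℝ) (hc : 0 ≤ c)
    (a1 a2 c1 c2 : ℤ × ℤ × ℤ → ℝ) (k1 k2 : ℤ × ℤ × ℤ → ℤ) (ha : ∀ i, a1 i ≤ a2 i) (hcc : ∀ i, c1 i ≤ c2 i)
    (hsub : ∀ i, S ∩ tidx b h ⁻¹' {i} ⊆ Ico (a1 i) (a2 i) ×ˢ Ico (c1 i) (c2 i) ×ˢ Ico (k1 i) (k2 i))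
    (hle : ∀ i, (a2 i - a1 i) * ((c2 i - c1 i) * ((k2 i - k1 i : ℤ) : ℝ)) ≤ c * (Wx b h i.1 * (Wy b h i.1 * (2 * h)))) :
    mu M S ≤ c := by
  have h1 := IsMean.tidx_mu hb hh hM S univ hS MeasurableSet.univ c hc (fun i => by
    refine (measure_mono (hsub i)).trans ?_
    rw [vol_Ico _ _ _ _ _ _ (ha i) (hcc i), univ_inter, vol_tile hb hh, ← ENNReal.ofReal_mul hc]
    exact ENNReal.ofReal_le_ofReal (hle i))
  have := hM.mu_univ_le
  nlinarith

theorem Edge_mu {M : (P → ℝ) → ℝ} (hM : IsMean b M) (w : ℕ) :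
    mu M (Edge b h w) ≤ w / h + 4 * (w * b ^ ((w : ℤ) - h)) := by
  have hb0 : 0 < b := by linarith
  set η : ℝ := w * b ^ ((w : ℤ) - h) with hη
  have hη0 : 0 ≤ η := by positivity
  have hh0 : (0 : ℝ) < h := by exact_mod_cast hh
  have hx := fun i : ℤ × ℤ × ℤ => Wx_pos hb (h := h) i.1
  have hy := fun i : ℤ × ℤ × ℤ => Wy_pos hb (h := h) i.1
  have m1 : Measurable fun p : P => p.2.2 := by fun_prop
  have m2 : Measurable fun p : P => p.1 := by fun_prop
  have m3 : Measurable fun p : P => p.2.1 := by fun_prop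
  have b1 : MeasurableSet {p : P | p.2.2 < 2 * h * (tidx b h p).1 + w} :=
    measurableSet_lt m1 (idx_meas b h fun i => 2 * h * i.1 + w)
  have b2 : MeasurableSet {p : P | 2 * h * (tidx b h p).1 + 2 * h - w ≤ p.2.2} :=
    measurableSet_le (idx_meas b h fun i => 2 * h * i.1 + 2 * h - w) m1
  have b3 : MeasurableSet {p : P | p.1 < ((tidx b h p).2.1 + η) * Wx b h (tidx b h p).1} :=
    measurableSet_lt m2 (idx_meas b h fun i => (i.2.1 + η) * Wx b h i.1)
  have b4 : MeasurableSet {p : P | ((tidx b h p).2.1 + 1 - η) * Wx b h (tidx b h p).1 ≤ p.1} :=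
    measurableSet_le (idx_meas b h fun i => (i.2.1 + 1 - η) * Wx b h i.1) m2
  have b5 : MeasurableSet {p : P | p.2.1 < ((tidx b h p).2.2 + η) * Wy b h (tidx b h p).1} :=
    measurableSet_lt m3 (idx_meas b h fun i => (i.2.2 + η) * Wy b h i.1)
  have b6 : MeasurableSet {p : P | ((tidx b h p).2.2 + 1 - η) * Wy b h (tidx b h p).1 ≤ p.2.1} :=
    measurableSet_le (idx_meas b h fun i => (i.2.2 + 1 - η) * Wy b h i.1) m3
  have s1 : mu M {p : P | p.2.2 < 2 * h * (tidx b h p).1 + w} ≤ w / h / 2 := by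
    refine piece_mu hb hh hM _ b1 _ (by positivity) (fun i => i.2.1 * Wx b h i.1) (fun i => (i.2.1 + 1) * Wx b h i.1)
      (fun i => i.2.2 * Wy b h i.1) (fun i => (i.2.2 + 1) * Wy b h i.1) (fun i => 2 * h * i.1) (fun i => 2 * h * i.1 + w)
      (fun i => by have := hx i; nlinarith) (fun i => by have := hy i; nlinarith) (fun i => ?_) (fun i => le_of_eq ?_)
    · rintro p ⟨q1, q2⟩
      have q3 : tidx b h p = i := q2
      rw [tile_eq hb hh] at q2
      simp only [mem_ofPred_eq, q3] at q1
      exact ⟨q2.1, q2.2.1, q2.2.2.1, q1⟩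
    · push_cast; field_simp; ring
  have s2 : mu M {p : P | 2 * h * (tidx b h p).1 + 2 * h - w ≤ p.2.2} ≤ w / h / 2 := by
    refine piece_mu hb hh hM _ b2 _ (by positivity) (fun i => i.2.1 * Wx b h i.1) (fun i => (i.2.1 + 1) * Wx b h i.1)
      (fun i => i.2.2 * Wy b h i.1) (fun i => (i.2.2 + 1) * Wy b h i.1) (fun i => 2 * h * i.1 + 2 * h - w)
      (fun i => 2 * h * i.1 + 2 * h)
      (fun i => by have := hx i; nlinarith) (fun i => by have := hy i; nlinarith) (fun i => ?_) (fun i => le_of_eq ?_)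
    · rintro p ⟨q1, q2⟩
      have q3 : tidx b h p = i := q2
      rw [tile_eq hb hh] at q2
      simp only [mem_ofPred_eq, q3] at q1
      exact ⟨q2.1, q2.2.1, q1, q2.2.2.2⟩
    · push_cast; field_simp; ring
  have s3 : mu M {p : P | p.1 < ((tidx b h p).2.1 + η) * Wx b h (tidx b h p).1} ≤ η := by
    refine piece_mu hb hh hM _ b3 _ (by positivity) (fun i => i.2.1 * Wx b h i.1) (fun i => (i.2.1 + η) * Wx b h i.1)
      (fun i => i.2.2 * Wy b h i.1) (fun i => (i.2.2 + 1) * Wy b h i.1) (fun i => 2 * h * i.1) (fun i => 2 * h * i.1 + 2 * h)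
      (fun i => by have := hx i; nlinarith) (fun i => by have := hy i; nlinarith) (fun i => ?_) (fun i => le_of_eq ?_)
    · rintro p ⟨q1, q2⟩
      have q3 : tidx b h p = i := q2
      rw [tile_eq hb hh] at q2
      simp only [mem_ofPred_eq, q3] at q1
      exact ⟨⟨q2.1.1, q1⟩, q2.2.1, q2.2.2⟩
    · push_cast; ring
  have s4 : mu M {p : P | ((tidx b h p).2.1 + 1 - η) * Wx b h (tidx b h p).1 ≤ p.1} ≤ η := by
    refine piece_mu hb hh hM _ b4 _ (by positivity) (fun i => (i.2.1 + 1 - η) * Wx b h i.1) (fun i => (i.2.1 + 1) * Wx b h i.1)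
      (fun i => i.2.2 * Wy b h i.1) (fun i => (i.2.2 + 1) * Wy b h i.1) (fun i => 2 * h * i.1) (fun i => 2 * h * i.1 + 2 * h)
      (fun i => by have := hx i; nlinarith) (fun i => by have := hy i; nlinarith) (fun i => ?_) (fun i => le_of_eq ?_)
    · rintro p ⟨q1, q2⟩
      have q3 : tidx b h p = i := q2
      rw [tile_eq hb hh] at q2
      simp only [mem_ofPred_eq, q3] at q1
      exact ⟨⟨q1, q2.1.2⟩, q2.2.1, q2.2.2⟩
    · push_cast; ring
  have s5 : mu M {p : P | p.2.1 < ((tidx b h p).2.2 + η) * Wy b h (tidx b h p).1} ≤ η := by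
    refine piece_mu hb hh hM _ b5 _ (by positivity) (fun i => i.2.1 * Wx b h i.1) (fun i => (i.2.1 + 1) * Wx b h i.1)
      (fun i => i.2.2 * Wy b h i.1) (fun i => (i.2.2 + η) * Wy b h i.1) (fun i => 2 * h * i.1) (fun i => 2 * h * i.1 + 2 * h)
      (fun i => by have := hx i; nlinarith) (fun i => by have := hy i; nlinarith) (fun i => ?_) (fun i => le_of_eq ?_)
    · rintro p ⟨q1, q2⟩
      have q3 : tidx b h p = i := q2
      rw [tile_eq hb hh] at q2
      simp only [mem_ofPred_eq, q3] at q1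
      exact ⟨q2.1, ⟨q2.2.1.1, q1⟩, q2.2.2⟩
    · push_cast; ring
  have s6 : mu M {p : P | ((tidx b h p).2.2 + 1 - η) * Wy b h (tidx b h p).1 ≤ p.2.1} ≤ η := by
    refine piece_mu hb hh hM _ b6 _ (by positivity) (fun i => i.2.1 * Wx b h i.1) (fun i => (i.2.1 + 1) * Wx b h i.1)
      (fun i => (i.2.2 + 1 - η) * Wy b h i.1) (fun i => (i.2.2 + 1) * Wy b h i.1) (fun i => 2 * h * i.1) (fun i => 2 * h * i.1 + 2 * h)
      (fun i => by have := hx i; nlinarith) (fun i => by have := hy i; nlinarith) (fun i => ?_) (fun i => le_of_eq ?_)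
    · rintro p ⟨q1, q2⟩
      have q3 : tidx b h p = i := q2
      rw [tile_eq hb hh] at q2
      simp only [mem_ofPred_eq, q3] at q1
      exact ⟨q2.1, ⟨q1, q2.2.1.2⟩, q2.2.2⟩
    · push_cast; ring
  have u1 := hM.mu_union b1 b2
  have u2 := hM.mu_union (b1.union b2) b3
  have u3 := hM.mu_union ((b1.union b2).union b3) b4
  have u4 := hM.mu_union (((b1.union b2).union b3).union b4) b5
  have u5 := hM.mu_union ((((b1.union b2).union b3).union b4).union b5) b6
  unfold Edge
  rw [← hη]
  linarith

theorem edge_same (B : ℝ) (hB : 0 ≤ B) (w n : ℕ) (hw : n * B ≤ w) (c : ℕ → P)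
    (hc : ∀ i < n, near b B (c i) (c (i + 1))) (h0 : c 0 ∉ Edge b h w) (m : ℕ) (hm : m ≤ n) :
    tidx b h (c m) = tidx b h (c 0) := by
  have hb0 : 0 < b := by linarith
  have hh' : ∀ i ≤ n, |((c i).2.2 : ℝ) - (c 0).2.2| ≤ i * B := by
    intro i
    induction i with
    | zero => simp
    | succ i ih =>
      intro hi
      have h1 := ih (by omega)
      have h2 := (hc i (by omega)).2.2
      have := abs_sub_le ((c (i + 1)).2.2 : ℝ) (c i).2.2 (c 0).2.2
      push_cast
      linarith
  have hhw : ∀ i ≤ n, |((c i).2.2) - (c 0).2.2| ≤ (w : ℤ) := by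
    intro i hi
    have h1 := hh' i hi
    have : (i : ℝ) * B ≤ n * B := by gcongr
    have h2 := h1.trans (this.trans hw)
    exact_mod_cast h2
  have hmB : (m : ℝ) * B ≤ w := le_trans (by gcongr) hw
  have hX := path_x b hb B hB c ((c 0).2.2 + w) m (fun i hi => hc i (by omega))
    (fun i hi => by have := abs_le.1 (hhw i (by omega)); omega)
  have hY := path_y b hb B hB c ((c 0).2.2 - w) m (fun i hi => hc i (by omega))
    (fun i hi => by have := abs_le.1 (hhw i (by omega)); omega)
  have hH := abs_le.1 (hhw m hm)
  have hmem : c 0 ∈ tidx b h ⁻¹' {tidx b h (c 0)} := rfl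
  rw [tile_eq hb hh] at hmem
  obtain ⟨-, -, d5, d6⟩ := hmem
  simp only [Edge, mem_union, mem_ofPred_eq, not_or, not_lt, not_le] at h0
  obtain ⟨⟨⟨⟨⟨g1, g2⟩, g3⟩, g4⟩, g5⟩, g6⟩ := h0
  set i := tidx b h (c 0) with hi
  set η : ℝ := w * b ^ ((w : ℤ) - h) with hη
  have hXX : |(c m).1 - (c 0).1| ≤ η * Wx b h i.1 := by
    refine hX.trans ?_
    rw [← mul_assoc, hη, Wx, mul_assoc (w : ℝ) (b ^ ((w : ℤ) - h)), ← zpow_add₀ hb0.ne']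
    apply mul_le_mul hmB _ (by positivity) (by positivity)
    apply zpow_le_zpow_right₀ hb.le
    omega
  have hYY : |(c m).2.1 - (c 0).2.1| ≤ η * Wy b h i.1 := by
    refine hY.trans ?_
    rw [← mul_assoc, hη, Wy, mul_assoc (w : ℝ) (b ^ ((w : ℤ) - h)), ← zpow_add₀ hb0.ne']
    apply mul_le_mul hmB _ (by positivity) (by positivity)
    apply zpow_le_zpow_right₀ hb.le
    omega
  have hXX := abs_le.1 hXX
  have hYY := abs_le.1 hYY
  have : c m ∈ tidx b h ⁻¹' {i} := by
    rw [tile_eq hb hh]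
    refine ⟨⟨by linarith, by linarith⟩, ⟨by linarith, by linarith⟩, ?_, ?_⟩ <;> omega
  exact this

end
end SolPf
end

section
open MeasureTheory Set Filter Topology
namespace SolPf

section
variable {b : ℝ} (hb : 1 < b) {h : ℕ} (hh : 1 ≤ h)
include hb hh

theorem vol_slices (S : Set P) (hS : MeasurableSet S) (i : ℤ × ℤ × ℤ) :
    vol (S ∩ tidx b h ⁻¹' {i}) = ∑ k ∈ Finset.Ico (2 * h * i.1) (2 * h * i.1 + 2 * h),
      volume ({z : ℝ × ℝ | (z.1, z.2, k) ∈ S} ∩ (Ico (i.2.1 * Wx b h i.1) ((i.2.1 + 1) * Wx b h i.1)) ×ˢ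
    (Ico (i.2.2 * Wy b h i.1) ((i.2.2 + 1) * Wy b h i.1))) := by
  rw [vol_apply _ (hS.inter (tidx_meas b h (MeasurableSet.singleton i))), tile_eq hb hh]
  rw [tsum_eq_sum (s := Finset.Ico (2 * h * i.1) (2 * h * i.1 + 2 * h))]
  · apply Finset.sum_congr rfl
    intro k hk
    congr 1
    ext z
    rw [Finset.mem_Ico] at hk
    simp only [mem_ofPred_eq, mem_inter_iff, mem_prod, mem_Ico]
    tauto
  · intro k hk
    rw [Finset.mem_Ico] at hk
    have : {z : ℝ × ℝ | (z.1, z.2, k) ∈ S ∩ (Ico (i.2.1 * Wx b h i.1) ((i.2.1 + 1) * Wx b h i.1)) ×ˢ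
      (Ico (i.2.2 * Wy b h i.1) ((i.2.2 + 1) * Wy b h i.1)) ×ˢ (Ico (2 * h * i.1) (2 * h * i.1 + 2 * h))} = ∅ := by
      ext z
      simp only [mem_ofPred_eq, mem_inter_iff, mem_prod, mem_Ico, mem_empty_iff_false, iff_false]
      tauto
    rw [this, measure_empty]

theorem select (A : Set P) (hA : MeasurableSet A) (i : ℤ × ℤ × ℤ) :
    ∃ (t : ℤ) (x : ℝ), 2 * h * i.1 ≤ t ∧ t < 2 * h * i.1 + 2 * h ∧
      x ∈ Ico (i.2.1 * Wx b h i.1) ((i.2.1 + 1) * Wx b h i.1) ∧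
      vol ({p : P | (p.1, p.2.1, t) ∈ A ∨ (x, p.2.1, t) ∈ A} ∩ tidx b h ⁻¹' {i}) ≤
        ENNReal.ofReal 2 * vol (A ∩ tidx b h ⁻¹' {i}) := by
  have hx := Wx_pos hb (h := h) i.1
  have hy := Wy_pos hb (h := h) i.1
  have hh0 : (0 : ℝ) < h := by exact_mod_cast hh
  set Ix := Ico (i.2.1 * Wx b h i.1) ((i.2.1 + 1) * Wx b h i.1) with hIx
  set Iy := Ico (i.2.2 * Wy b h i.1) ((i.2.2 + 1) * Wy b h i.1) with hIy
  set It := Finset.Ico (2 * h * i.1) (2 * h * i.1 + 2 * h) with hIt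
  have hcard : It.card = 2 * h := by rw [hIt, Int.card_Ico]; omega
  set ν : ℤ → ENNReal := fun k => volume ({z : ℝ × ℝ | (z.1, z.2, k) ∈ A} ∩ Ix ×ˢ Iy) with hν
  obtain ⟨t, ht, hmin⟩ := Finset.exists_min_image It ν (Finset.card_pos.1 (by omega))
  have hA1 : (2 * h : ℕ) * ν t ≤ vol (A ∩ tidx b h ⁻¹' {i}) := by
    rw [vol_slices hb hh A hA i, ← hcard, ← nsmul_eq_mul]
    exact Finset.card_nsmul_le_sum _ _ _ hmin
  have hAt : MeasurableSet {z : ℝ × ℝ | (z.1, z.2, t) ∈ A} :=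
    hA.preimage (by fun_prop : Measurable fun z : ℝ × ℝ => (z.1, z.2, t))
  have e1 : ν t = ∫⁻ x in Ix, volume.restrict Iy {y | (x, y, t) ∈ A} := by
    rw [hν]
    simp only
    rw [← Measure.restrict_apply hAt, Measure.volume_eq_prod, ← Measure.prod_restrict, Measure.prod_apply hAt]
    rfl
  have hvIx : volume Ix = ENNReal.ofReal (Wx b h i.1) := by
    rw [hIx, Real.volume_Ico]; congr 1; ring
  obtain ⟨x, hxI, hxle⟩ := exists_le_setLAverage (μ := volume) (s := Ix)
    (f := fun x => volume.restrict Iy {y | (x, y, t) ∈ A}) (by rw [hvIx]; simpa using hx) (by rw [hvIx]; simp)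
    (measurable_measure_prodMk_left hAt).aemeasurable
  rw [setLAverage_eq, ← e1] at hxle
  have hxle' : volume Ix * volume.restrict Iy {y | (x, y, t) ∈ A} ≤ ν t := by
    rw [mul_comm]
    exact ENNReal.mul_le_of_le_div hxle
  rw [hIt, Finset.mem_Ico] at ht
  refine ⟨t, x, ht.1, ht.2, hxI, ?_⟩
  have m1 : MeasurableSet {p : P | (p.1, p.2.1, t) ∈ A} :=
    hA.preimage (by fun_prop : Measurable fun p : P => (p.1, p.2.1, t))
  have m3 : MeasurableSet {y : ℝ | (x, y, t) ∈ A} :=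
    hA.preimage (by fun_prop : Measurable fun y : ℝ => (x, y, t))
  have e2 : vol ({p : P | (p.1, p.2.1, t) ∈ A} ∩ tidx b h ⁻¹' {i}) ≤ (2 * h : ℕ) * ν t := by
    rw [vol_slices hb hh _ m1 i]
    simp only [mem_ofPred_eq]
    rw [Finset.sum_const, nsmul_eq_mul, hcard]
  have e3 : vol ({p : P | (x, p.2.1, t) ∈ A} ∩ tidx b h ⁻¹' {i}) ≤ (2 * h : ℕ) * ν t := by
    have : {p : P | (x, p.2.1, t) ∈ A} ∩ tidx b h ⁻¹' {i} =
        Ix ×ˢ ({y : ℝ | (x, y, t) ∈ A} ∩ Iy) ×ˢ Ico (2 * h * i.1) (2 * h * i.1 + 2 * h) := by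
      rw [tile_eq hb hh]
      ext p
      simp only [mem_inter_iff, mem_ofPred_eq, mem_prod]
      tauto
    rw [this, vol_box, ← Measure.restrict_apply m3, count_Ico, ← mul_assoc, mul_comm]
    refine mul_le_mul' (le_of_eq ?_) hxle'
    rw [← ENNReal.ofReal_natCast]
    congr 1
    push_cast
    ring
  have e4 : {p : P | (p.1, p.2.1, t) ∈ A ∨ (x, p.2.1, t) ∈ A} ∩ tidx b h ⁻¹' {i} =
      ({p : P | (p.1, p.2.1, t) ∈ A} ∩ tidx b h ⁻¹' {i}) ∪ ({p : P | (x, p.2.1, t) ∈ A} ∩ tidx b h ⁻¹' {i}) := by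
    ext p
    simp only [mem_inter_iff, mem_ofPred_eq, mem_union]
    tauto
  rw [e4]
  refine (measure_union_le _ _).trans ((add_le_add e2 e3).trans ?_)
  rw [← two_mul]
  have : ENNReal.ofReal 2 = 2 := by simp
  rw [this]
  gcongr

end

theorem affine_ext (f : ℝ → ℝ) (c l : ℝ) (hf : ∀ t, f t = c + l * t) (e t1 h t : ℝ) (hh : 0 < h)
    (h1 : |f t1| ≤ e) (h2 : |f (t1 + h)| ≤ e) (ht : |t - t1| ≤ 4 * h) : |f t| ≤ 9 * e := by
  have e1 : l * h = f (t1 + h) - f t1 := by rw [hf, hf]; ring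
  have e2 : |l| * h ≤ 2 * e := by
    have e0 : |l| * h = |l * h| := by rw [abs_mul, abs_of_pos hh]
    rw [e0, e1]
    refine (abs_sub _ _).trans ?_
    linarith
  have e3 : f t = f t1 + l * (t - t1) := by rw [hf, hf]; ring
  rw [e3]
  refine (abs_add_le _ _).trans ?_
  rw [abs_mul]
  have : |l| * |t - t1| ≤ |l| * (4 * h) := by gcongr
  linarith

end SolPf
end

section
open MeasureTheory Set Filter Topology
namespace SolPf

/-- two lines merging -/
theorem merge_two (a1 a2 : ℤ → ℝ) (l1 l2 E B : ℝ) (t T : ℤ) (h : ℕ) (hh : 1 ≤ h)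
    (h1 : ∀ r : ℤ, |r| ≤ 4 * h → |a1 (t + r) - a1 t - l1 * r| ≤ E)
    (h2 : ∀ r : ℤ, |r| ≤ 4 * h → |a2 (t + r) - a2 t - l2 * r| ≤ E)
    (hT : |T - t| ≤ 4 * h) (hT' : |T + h - t| ≤ 4 * h)
    (m1 : |a1 T - a2 T| ≤ B) (m2 : |a1 (T + h) - a2 (T + h)| ≤ B) (k : ℤ) (hk : |k - T| ≤ 4 * h) :
    |(a1 t + l1 * (k - t)) - (a2 t + l2 * (k - t))| ≤ 9 * (2 * E + B) := by
  have hh0 : (0 : ℝ) < h := by exact_mod_cast hh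
  have key : ∀ T : ℤ, |T - t| ≤ 4 * h → |a1 T - a2 T| ≤ B →
      |(a1 t + l1 * (T - t)) - (a2 t + l2 * (T - t))| ≤ 2 * E + B := by
    intro T hT hm
    have e1 := h1 (T - t) hT
    have e2 := h2 (T - t) hT
    rw [show t + (T - t) = T by ring] at e1 e2
    push_cast at e1 e2
    rw [abs_le] at *
    constructor <;> linarith
  refine affine_ext (fun s => (a1 t + l1 * (s - t)) - (a2 t + l2 * (s - t)))
    (a1 t - l1 * t - (a2 t - l2 * t)) (l1 - l2) (fun s => by ring) (2 * E + B) T h k hh0 (key T hT m1) ?_ ?_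
  · have := key (T + h) hT' m2
    push_cast at this
    exact this
  · exact_mod_cast hk

theorem merge {b : ℝ} (hb : 1 < b) {h : ℕ} (hh : 1 ≤ h) (B : ℕ) (ε : ℝ) (hε : 0 < ε) (v : P → ℝ)
    (hv : ∀ p q, near b 1 p q → |v p - v q| ≤ B) (A : Set P) (hA : MeasurableSet A) (L : Set ℝ)
    (hL : ∀ p ∉ A, ∃ l ∈ L, ∀ r : ℤ, |r| ≤ 4 * h → |v (fl r p) - v p - l * r| ≤ ε * h) :
    ∃ Z : Set P, MeasurableSet Z ∧ (∀ M, IsMean b M → mu M Z ≤ 2 * mu M A) ∧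
      ∃ Lam Cc : ℤ × ℤ × ℤ → ℝ, ∀ p ∉ Z, Lam (tidx b h p) ∈ L ∧
        |v p - Lam (tidx b h p) * p.2.2 - Cc (tidx b h p)| ≤ 37 * (ε * h + B) := by
  have hb0 : 0 < b := by linarith
  have hh0 : (0 : ℝ) < h := by exact_mod_cast hh
  choose t x ht1 ht2 hx hvol using select hb hh A hA
  set Z : Set P := {p | (p.1, p.2.1, t (tidx b h p)) ∈ A ∨ (x (tidx b h p), p.2.1, t (tidx b h p)) ∈ A} with hZ
  have hZm : MeasurableSet Z := by
    have m1 : Measurable fun p : P => ((p.1, p.2.1, t (tidx b h p)) : P) :=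
      measurable_fst.prodMk (measurable_snd.fst.prodMk (idx_meas b h t))
    have m2 : Measurable fun p : P => ((x (tidx b h p), p.2.1, t (tidx b h p)) : P) :=
      (idx_meas b h x).prodMk (measurable_snd.fst.prodMk (idx_meas b h t))
    exact (m1 hA).union (m2 hA)
  refine ⟨Z, hZm, fun M hM => hM.tidx_mu hb hh Z A hZm hA 2 (by norm_num) fun i => ?_, ?_⟩
  · refine (measure_mono ?_).trans (hvol i)
    rintro p ⟨hp, hpi⟩
    rw [mem_preimage, mem_singleton_iff] at hpi
    refine ⟨?_, hpi⟩
    rw [hZ, mem_ofPred_eq, hpi] at hp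
    exact hp
  have main : ∀ i, ∃ lam c : ℝ, ∀ p ∉ Z, tidx b h p = i → lam ∈ L ∧ |v p - lam * p.2.2 - c| ≤ 37 * (ε * h + B) := by
    intro i
    by_cases hne : ∃ p0 ∉ Z, tidx b h p0 = i
    swap
    · refine ⟨0, 0, fun p hp hpi => (hne ⟨p, hp, hpi⟩).elim⟩
    obtain ⟨p0, hp0, hp0i⟩ := hne
    have hA' : ∀ p ∉ Z, tidx b h p = i → (p.1, p.2.1, t i) ∉ A ∧ (x i, p.2.1, t i) ∉ A := by
      intro p hp hpi
      rw [hZ, mem_ofPred_eq, hpi] at hp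
      push Not at hp
      exact hp
    obtain ⟨l3, hl3, hr3⟩ := hL _ (hA' p0 hp0 hp0i).2
    refine ⟨l3, v (x i, p0.2.1, t i) - l3 * t i, fun p hp hpi => ⟨hl3, ?_⟩⟩
    obtain ⟨l2, hl2, hr2⟩ := hL _ (hA' p hp hpi).2
    obtain ⟨l1, hl1, hr1⟩ := hL _ (hA' p hp hpi).1
    simp only [fl] at hr1 hr2 hr3
    have hpT : p ∈ tidx b h ⁻¹' {i} := hpi
    have hp0T : p0 ∈ tidx b h ⁻¹' {i} := hp0i
    rw [tile_eq hb hh] at hpT hp0T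
    obtain ⟨⟨px1, px2⟩, ⟨py1, py2⟩, pk1, pk2⟩ := hpT
    obtain ⟨-, ⟨p0y1, p0y2⟩, -⟩ := hp0T
    obtain ⟨x1, x2⟩ := hx i
    have t1 := ht1 i
    have t2 := ht2 i
    have hWx := Wx_pos hb (h := h) i.1
    have hWy := Wy_pos hb (h := h) i.1
    have hdx : |x i - p.1| ≤ Wx b h i.1 := by rw [abs_le]; constructor <;> nlinarith
    have hdy : |p0.2.1 - p.2.1| ≤ Wy b h i.1 := by rw [abs_le]; constructor <;> nlinarith
    set T0 := 2 * h * i.1 with hT0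
    have hvx : ∀ T : ℤ, T0 + 3 * h ≤ T → |v (p.1, p.2.1, T) - v (x i, p.2.1, T)| ≤ B := by
      intro T hT
      refine hv _ _ ⟨?_, by simp; positivity, by simp⟩
      simp only [one_mul]
      exact hdx.trans (zpow_le_zpow_right₀ hb.le hT)
    have hvy : ∀ T : ℤ, T ≤ T0 - h → |v (x i, p.2.1, T) - v (x i, p0.2.1, T)| ≤ B := by
      intro T hT
      refine hv _ _ ⟨by simp; positivity, ?_, by simp⟩
      simp only [one_mul]
      exact hdy.trans (zpow_le_zpow_right₀ hb.le (by omega))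
    have q1 := merge_two (fun s => v (p.1, p.2.1, s)) (fun s => v (x i, p.2.1, s)) l1 l2 (ε * h) B (t i)
      (T0 + 3 * h) h hh hr1 hr2 (by rw [abs_le]; omega) (by rw [abs_le]; omega) (hvx _ le_rfl) (hvx _ (by omega))
      p.2.2 (by rw [abs_le]; omega)
    have q2 := merge_two (fun s => v (x i, p.2.1, s)) (fun s => v (x i, p0.2.1, s)) l2 l3 (ε * h) B (t i)
      (T0 - 2 * h) h hh hr2 hr3 (by rw [abs_le]; omega) (by rw [abs_le]; omega) (hvy _ (by omega)) (hvy _ (by omega))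
      p.2.2 (by rw [abs_le]; omega)
    have q0 := hr1 (p.2.2 - t i) (by rw [abs_le]; omega)
    rw [show t i + (p.2.2 - t i) = p.2.2 by ring, show (p.1, p.2.1, p.2.2) = p from rfl] at q0
    push_cast at q0
    have hB : (0 : ℝ) ≤ B := by positivity
    have hεh : 0 ≤ ε * h := by positivity
    rw [abs_le] at *
    constructor <;> linarith
  choose lam c hmain using main
  exact ⟨lam, c, fun p hp => hmain _ p hp rfl⟩

end SolPf
end

section
open MeasureTheory Set Filter Topology
namespace SolPf

theorem slope_bad (u : ℤ → ℝ) (B : ℕ) (hu : ∀ i, |u (i + 1) - u i| ≤ B) (G s : ℕ) (hs : 1 ≤ s)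
    (c0 C lam e ε0 κ : ℝ) (he0 : 0 < ε0) (hl : 1 + ε0 ≤ |lam|)
    (hg : ∀ l : ℕ, l ≤ G → |(c0 + (l * s : ℕ)) - lam * u ((l * s : ℕ) : ℤ) - C| ≤ e)
    (hκ : 2 * e + 2 * B * s + (G * s : ℕ) / (1 + ε0) ≤ κ * (G * s : ℕ)) :
    ∀ i ≤ G * s, ∀ j ≤ G * s, u i - u j ≤ κ * (G * s : ℕ) := by
  have key : ∀ l ≤ G, ∀ k ≤ G, |u ((l * s : ℕ) : ℤ) - u ((k * s : ℕ) : ℤ)| ≤ (G * s : ℕ) / (1 + ε0) + 2 * e := by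
    intro l hl' k hk
    have h1 := hg l hl'
    have h2 := hg k hk
    have he : 0 ≤ e := (abs_nonneg _).trans h1
    set U := u ((l * s : ℕ) : ℤ) - u ((k * s : ℕ) : ℤ) with hU
    have a1 : (l * s : ℕ) ≤ ((G * s : ℕ) : ℝ) := by exact_mod_cast Nat.mul_le_mul_right s hl'
    have a2 : (k * s : ℕ) ≤ ((G * s : ℕ) : ℝ) := by exact_mod_cast Nat.mul_le_mul_right s hk
    have a3 : (0 : ℝ) ≤ (l * s : ℕ) := by positivity
    have a4 : (0 : ℝ) ≤ (k * s : ℕ) := by positivity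
    have h3 : |lam * U| ≤ (G * s : ℕ) + 2 * e := by
      rw [hU, mul_sub]
      rw [abs_le] at *
      constructor <;> linarith
    rw [abs_mul] at h3
    have h4 : (1 + ε0) * |U| ≤ (G * s : ℕ) + 2 * e := (mul_le_mul_of_nonneg_right hl (abs_nonneg _)).trans h3
    have h5 : |U| ≤ ((G * s : ℕ) + 2 * e) / (1 + ε0) := by
      rw [le_div_iff₀ (by linarith)]; linarith
    refine h5.trans ?_
    rw [add_div]
    have : 2 * e / (1 + ε0) ≤ 2 * e := div_le_self (by linarith) (by linarith)
    linarith
  have near : ∀ i ≤ G * s, ∃ l ≤ G, |u i - u ((l * s : ℕ) : ℤ)| ≤ B * s := by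
    intro i hi
    refine ⟨i / s, Nat.div_le_of_le_mul (by rwa [mul_comm]), ?_⟩
    refine (lip_seq' u B hu _ _).trans ?_
    have h1 : i / s * s ≤ i := Nat.div_mul_le_self i s
    have h2 : i < i / s * s + s := by
      have := Nat.lt_div_mul_add (a := i) (b := s) (by omega)
      exact this
    refine mul_le_mul_of_nonneg_left ?_ (by positivity)
    rw [abs_le]
    simp only [Int.cast_natCast]
    have h1' : ((i / s * s : ℕ) : ℝ) ≤ i := by exact_mod_cast h1
    have h2' : (i : ℝ) ≤ (i / s * s : ℕ) + s := by exact_mod_cast h2.le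
    have : (0 : ℝ) ≤ s := by positivity
    constructor <;> linarith
  intro i hi j hj
  obtain ⟨l, hl1, hl2⟩ := near i hi
  obtain ⟨k, hk1, hk2⟩ := near j hj
  have := key l hl1 k hk1
  rw [abs_le] at *
  linarith

structure Core (b : ℝ) (B : ℕ) (H : Set ℤ) (Θ Φ : P → P) (M M' : (P → ℝ) → ℝ) : Prop where
  hM : IsMean b M
  hM' : IsMean b M'
  Θm : Measurable Θ
  Φm : Measurable fun p => (Φ p).2.2
  Θ1 : ∀ p q, near b 1 p q → near b B (Θ p) (Θ q)
  Θ2 : ∀ p q, near b 1 (Θ p) (Θ q) → near b B p q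
  Φ1 : ∀ p q, near b 1 p q → near b B (Φ p) (Φ q)
  Φ2 : ∀ p q, near b 1 (Φ p) (Φ q) → near b B p q
  comp : ∀ w, (Φ (Θ w)).2.2 = w.2.2
  even : ∀ k, Even k → k ∈ H
  trans : ∀ S, MeasurableSet S → mu M' (Θ ⁻¹' S) = mu M ({p | p.2.2 ∈ H} ∩ S)

theorem Edge_small (b : ℝ) (hb : 1 < b) (θ : ℝ) (hθ : 0 < θ) (hθ' : θ ≤ 1 / 2) : ∃ h1 : ℕ, ∀ h ≥ h1, 1 ≤ h →
    ∀ w : ℕ, (w : ℝ) ≤ θ * h → ∀ M, IsMean b M → mu M (Edge b h w) ≤ 2 * θ := by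
  have hb0 : 0 < b := by linarith
  have hlim : Tendsto (fun n : ℕ => (n : ℝ) * (Real.sqrt b)⁻¹ ^ n) atTop (𝓝 0) := by
    apply tendsto_self_mul_const_pow_of_lt_one (by positivity)
    exact inv_lt_one_of_one_lt₀ (by rw [Real.lt_sqrt (by norm_num)]; simpa using hb)
  obtain ⟨h1, hh1⟩ := (hlim.eventually (gt_mem_nhds (show (0 : ℝ) < 1 / 4 by norm_num))).exists_forall_of_atTop
  refine ⟨h1, fun h hh hh' w hw M hM => (Edge_mu hb hh' hM w).trans ?_⟩
  have h0 : (0 : ℝ) < h := by exact_mod_cast hh'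
  have e1 : (w : ℝ) / h ≤ θ := by rwa [div_le_iff₀ h0]
  have e2 : b ^ ((w : ℤ) - h) ≤ (Real.sqrt b)⁻¹ ^ h := by
    have : (Real.sqrt b)⁻¹ ^ h = b ^ (-(h / 2 : ℝ)) := by
      rw [Real.sqrt_eq_rpow, ← Real.rpow_neg hb0.le, ← Real.rpow_natCast, ← Real.rpow_mul hb0.le]
      congr 1
      ring
    rw [this, ← Real.rpow_intCast]
    apply Real.rpow_le_rpow_of_exponent_le hb.le
    push_cast
    nlinarith
  have e3 := hh1 h hh
  have e4 : w * b ^ ((w : ℤ) - h) ≤ θ * h * (Real.sqrt b)⁻¹ ^ h := by gcongr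
  nlinarith
end SolPf
end

section
open MeasureTheory Set Filter Topology
namespace SolPf

theorem DC_meas (H : Set ℤ) : MeasurableSet {p : P | p.2.2 ∈ H} :=
  (by fun_prop : Measurable fun p : P => p.2.2) (MeasurableSet.of_discrete (s := H))

namespace Core
variable {b : ℝ} {B : ℕ} {H : Set ℤ} {Θ Φ : P → P} {M M' : (P → ℝ) → ℝ} (c : Core b B H Θ Φ M M')
include c

theorem trans_le (S : Set P) (hS : MeasurableSet S) : mu M' (Θ ⁻¹' S) ≤ mu M S := by
  rw [c.trans S hS]
  exact c.hM.mu_mono ((DC_meas H).inter hS) hS inter_subset_right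

theorem Θm' : Measurable fun p => (Θ p).2.2 := c.Θm.snd.snd

theorem Θstep (hb : 1 < b) (w : P) (i : ℤ) : near b B (Θ (fl i w)) (Θ (fl (i + 1) w)) := c.Θ1 _ _ (near_fl_one b hb w i)

theorem u_lip (hb : 1 < b) (w : P) (i : ℤ) : |((Θ (fl (i + 1) w)).2.2 : ℝ) - (Θ (fl i w)).2.2| ≤ B :=
  (c.Θstep hb w i).2.2

theorem v_lip (p q : P) (h : near b 1 p q) : |((Φ p).2.2 : ℝ) - (Φ q).2.2| ≤ B := by
  rw [abs_sub_comm]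
  exact (c.Φ1 _ _ h).2.2

theorem v_step (hb : 1 < b) (p : P) : |((Φ (fl 1 p)).2.2 : ℝ) - (Φ p).2.2| ≤ B := by
  have := near_fl_one b hb p 0
  rw [fl_zero, zero_add] at this
  exact (c.Φ1 _ _ this).2.2

theorem vm : Measurable fun p => ((Φ p).2.2 : ℝ) := (measurable_of_countable (fun k : ℤ => (k : ℝ))).comp c.Φm

theorem steep (hb : 1 < b) {h : ℕ} (hh : 1 ≤ h) (Z : Set P) (hZ : MeasurableSet Z) (Lam Cc : ℤ × ℤ × ℤ → ℝ) (e : ℝ)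
    (hLam : ∀ p ∉ Z, |((Φ p).2.2 : ℝ) - Lam (tidx b h p) * p.2.2 - Cc (tidx b h p)| ≤ e)
    (G s w : ℕ) (hs : 1 ≤ s) (hw : (G * s : ℕ) * B ≤ w) (hw1 : 1 ≤ w) (ε0 κ : ℝ) (he0 : 0 < ε0)
    (hκ : 2 * e + 2 * B * s + (G * s : ℕ) / (1 + ε0) ≤ κ * (G * s : ℕ)) :
    mu M {p | 1 + ε0 ≤ |Lam (tidx b h p)|} ≤
      2 * (mu M' (Bad Θ κ (G * s)) + mu M (Edge b h w) + (G + 1) * mu M Z) + mu M (Edge b h w) := by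
  set Q : Set P := {p | 1 + ε0 ≤ |Lam (tidx b h p)|} with hQ
  have hQm : MeasurableSet Q := by
    have := idx_meas b h fun i => |Lam i|
    exact measurableSet_le measurable_const this
  have hE := Edge_meas b h w
  have hBad := Bad_meas Θ c.Θm' κ (G * s)
  have hFl : ∀ l ∈ Finset.range (G + 1), MeasurableSet (fl ((l * s : ℕ) : ℤ) ⁻¹' (Θ ⁻¹' Z)) :=
    fun l _ => (fl_meas _) (c.Θm hZ)
  have sub : Θ ⁻¹' Q ⊆ (Bad Θ κ (G * s) ∪ Θ ⁻¹' Edge b h w) ∪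
      ⋃ l ∈ Finset.range (G + 1), fl ((l * s : ℕ) : ℤ) ⁻¹' (Θ ⁻¹' Z) := by
    intro x hx
    by_contra hcon
    simp only [mem_union, mem_iUnion, not_or, not_exists, mem_preimage, Finset.mem_range] at hcon
    obtain ⟨⟨h1, h2⟩, h3⟩ := hcon
    have hsame := edge_same hb hh B (by positivity) w (G * s) (by exact_mod_cast hw) (fun i => Θ (fl (i : ℤ) x))
      (fun i _ => by have := c.Θstep hb x i; exact_mod_cast this) (by simpa [fl_zero] using h2)
    simp only [Nat.cast_zero, fl_zero] at hsame
    refine h1 (slope_bad (fun i => ((Θ (fl i x)).2.2 : ℝ)) B (c.u_lip hb x) G s hs x.2.2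
      (Cc (tidx b h (Θ x))) (Lam (tidx b h (Θ x))) e ε0 κ he0 hx ?_ hκ)
    intro l hl
    have q := hLam _ (h3 l (by omega))
    rw [c.comp, hsame (l * s) (Nat.mul_le_mul_right s hl)] at q
    have : (fl ((l * s : ℕ) : ℤ) x).2.2 = x.2.2 + (l * s : ℕ) := rfl
    rw [this] at q
    push_cast at q ⊢
    exact q
  have hDC := DC_meas H
  have b1 : mu M ({p | p.2.2 ∈ H} ∩ Q) ≤ mu M' (Bad Θ κ (G * s)) + mu M (Edge b h w) + (G + 1) * mu M Z := by
    rw [← c.trans Q hQm]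
    refine (c.hM'.mu_mono (c.Θm hQm) ((hBad.union (c.Θm hE)).union (Finset.measurableSet_biUnion _ hFl)) sub).trans ?_
    refine (c.hM'.mu_union (hBad.union (c.Θm hE)) (Finset.measurableSet_biUnion _ hFl)).trans ?_
    refine add_le_add ((c.hM'.mu_union hBad (c.Θm hE)).trans (add_le_add le_rfl (c.trans_le _ hE))) ?_
    refine (c.hM'.mu_biUnion _ _ hFl).trans ?_
    refine (Finset.sum_le_card_nsmul _ _ (mu M Z) fun l _ => ?_).trans ?_
    · rw [c.hM'.mu_fl (c.Θm hZ)]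
      exact c.trans_le Z hZ
    · simp
  have sub2 : Q ⊆ (({p | p.2.2 ∈ H} ∩ Q) ∪ fl 1 ⁻¹' ({p | p.2.2 ∈ H} ∩ Q)) ∪ Edge b h w := by
    intro p hp
    by_contra hcon
    simp only [mem_union, not_or] at hcon
    obtain ⟨⟨h1, h2⟩, h3⟩ := hcon
    have hp1 : p.2.2 ∉ H := fun hh' => h1 ⟨hh', hp⟩
    have hsame := edge_same hb hh 1 (by norm_num) w 1 (by simpa using hw1) (fun i => fl (i : ℤ) p)
      (fun i _ => by have := near_fl_one b hb p i; exact_mod_cast this) (by simpa [fl_zero] using h3) 1 le_rfl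
    simp only [Nat.cast_zero, fl_zero, Nat.cast_one] at hsame
    refine h2 ⟨c.even _ ?_, ?_⟩
    · show Even (p.2.2 + 1)
      have : ¬ Even p.2.2 := fun h' => hp1 (c.even _ h')
      rw [Int.even_add_one]
      exact this
    · show 1 + ε0 ≤ |Lam (tidx b h (fl 1 p))|
      rw [hsame]
      exact hp
  have hDQ := hDC.inter hQm
  refine (c.hM.mu_mono hQm ((hDQ.union (fl_meas 1 hDQ)).union hE) sub2).trans ?_
  refine (c.hM.mu_union (hDQ.union (fl_meas 1 hDQ)) hE).trans ?_
  have := c.hM.mu_union hDQ (fl_meas 1 hDQ)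
  rw [c.hM.mu_fl hDQ] at this
  linarith

end Core
end SolPf
end

section
open MeasureTheory Set Filter Topology
namespace SolPf

/-- excess stretch over `s` steps -/
noncomputable def gex (Φ : P → P) (s : ℕ) (p : P) : ℝ :=
  max (|((Φ (fl s p)).2.2 : ℝ) - (Φ p).2.2| / s - 1) 0

namespace Core
variable {b : ℝ} {B : ℕ} {H : Set ℤ} {Θ Φ : P → P} {M M' : (P → ℝ) → ℝ} (c : Core b B H Θ Φ M M')
include c

theorem v_lip' (hb : 1 < b) (p : P) (i j : ℤ) : |((Φ (fl i p)).2.2 : ℝ) - (Φ (fl j p)).2.2| ≤ B * |(i : ℝ) - j| :=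
  lip_seq' (fun i => ((Φ (fl i p)).2.2 : ℝ)) B
    (fun i => (c.Φ1 _ _ (near_fl_one b hb p i)).2.2) i j

omit c in
theorem gex_nonneg (s : ℕ) (p : P) : 0 ≤ gex Φ s p := le_max_right _ _

theorem gex_le (hb : 1 < b) (s : ℕ) (hs : 1 ≤ s) (p : P) : gex Φ s p ≤ B := by
  have hs0 : (0 : ℝ) < s := by exact_mod_cast hs
  have := c.v_lip' hb p s 0
  simp only [Int.cast_natCast, Int.cast_zero, sub_zero, fl_zero, abs_of_pos hs0] at this
  refine max_le ?_ (by positivity)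
  have : |((Φ (fl s p)).2.2 : ℝ) - (Φ p).2.2| / s ≤ B := by rwa [div_le_iff₀ hs0]
  linarith

theorem gex_BM (hb : 1 < b) (s : ℕ) (hs : 1 ≤ s) : BM (gex Φ s) := by
  refine ⟨?_, B, fun p => by rw [abs_of_nonneg (gex_nonneg s p)]; exact c.gex_le hb s hs p⟩
  have m1 := c.vm
  have m2 := c.vm.comp (fl_meas s)
  unfold gex
  have m3 : Measurable fun p => |((Φ (fl s p)).2.2 : ℝ) - (Φ p).2.2| := by
    have := (m2.sub m1).abs
    exact this
  exact ((m3.div_const _).sub_const _).max measurable_const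

theorem gex_int (hb : 1 < b) {h : ℕ} (hh : 1 ≤ h) (Z : Set P) (hZ : MeasurableSet Z) (Lam Cc : ℤ × ℤ × ℤ → ℝ) (e : ℝ)
    (hLam : ∀ p ∉ Z, |((Φ p).2.2 : ℝ) - Lam (tidx b h p) * p.2.2 - Cc (tidx b h p)| ≤ e)
    (m w : ℕ) (hm : 1 ≤ m) (hw : m ≤ w) (ε0 : ℝ) (he0 : 0 < ε0) (hme : 2 * e ≤ ε0 * m) :
    M (gex Φ m) ≤ 2 * ε0 + B * (2 * mu M Z + mu M (Edge b h w) + mu M {p | 1 + ε0 ≤ |Lam (tidx b h p)|}) := by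
  set Q : Set P := {p | 1 + ε0 ≤ |Lam (tidx b h p)|} with hQ
  have hQm : MeasurableSet Q := by
    have := idx_meas b h fun i => |Lam i|
    exact measurableSet_le measurable_const this
  have hE := Edge_meas b h w
  have hFl : MeasurableSet (fl (m : ℤ) ⁻¹' Z) := fl_meas _ hZ
  have hR1 := hZ.union hFl
  have hR2 := hR1.union hE
  have hR := hR2.union hQm
  set R : Set P := ((Z ∪ fl (m : ℤ) ⁻¹' Z) ∪ Edge b h w) ∪ Q with hRdef
  have hm0 : (0 : ℝ) < m := by exact_mod_cast hm
  have pt : ∀ p, gex Φ m p ≤ 2 * ε0 + B * R.indicator (fun _ => 1) p := by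
    intro p
    by_cases hp : p ∈ R
    · rw [indicator_of_mem hp]
      have := c.gex_le hb m hm p
      linarith
    · rw [indicator_of_notMem hp]
      simp only [hRdef, mem_union, not_or] at hp
      obtain ⟨⟨⟨h1, h2⟩, h3⟩, h4⟩ := hp
      have hsame := edge_same hb hh 1 (by norm_num) w m (by simpa using hw) (fun i => fl (i : ℤ) p)
        (fun i _ => by have := near_fl_one b hb p i; exact_mod_cast this) (by simpa [fl_zero] using h3) m le_rfl
      simp only [Nat.cast_zero, fl_zero] at hsame
      have q1 := hLam _ h1
      have q2 := hLam _ h2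
      rw [hsame] at q2
      have : (fl (m : ℤ) p).2.2 = p.2.2 + (m : ℤ) := rfl
      rw [this] at q2
      push_cast at q2
      have h4' : |Lam (tidx b h p)| ≤ 1 + ε0 := by
        by_contra hc; exact h4 (not_le.1 hc).le
      set lam := Lam (tidx b h p)
      have q3 : |((Φ (fl m p)).2.2 : ℝ) - (Φ p).2.2| ≤ |lam * m| + 2 * e := by
        have : ((Φ (fl m p)).2.2 : ℝ) - (Φ p).2.2 - lam * m =
          (((Φ (fl m p)).2.2 : ℝ) - lam * (p.2.2 + m) - Cc (tidx b h p)) - ((Φ p).2.2 - lam * p.2.2 - Cc (tidx b h p)) := by ring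
        have q4 := abs_sub (((Φ (fl m p)).2.2 : ℝ) - lam * (p.2.2 + m) - Cc (tidx b h p)) ((Φ p).2.2 - lam * p.2.2 - Cc (tidx b h p))
        rw [← this] at q4
        have q5 := abs_sub_abs_le_abs_sub (((Φ (fl m p)).2.2 : ℝ) - (Φ p).2.2) (lam * m)
        linarith
      rw [abs_mul, abs_of_pos hm0] at q3
      refine max_le ?_ (by linarith)
      rw [mul_zero, add_zero, sub_le_iff_le_add, div_le_iff₀ hm0]
      nlinarith
  have hB0 : (0 : ℝ) ≤ B := by positivity
  have h1 := c.hM.mono (c.gex_BM hb m hm) ((BM.const (2 * ε0)).add ((BM.ind hR).smul B)) pt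
  rw [c.hM.add (BM.const _) ((BM.ind hR).smul B), c.hM.smul _ (BM.ind hR)] at h1
  have h2 := c.hM.le_const (BM.const (2 * ε0)) (by linarith) fun _ => le_rfl
  have h3 : mu M R ≤ 2 * mu M Z + mu M (Edge b h w) + mu M Q := by
    have a1 := c.hM.mu_union hR2 hQm
    have a2 := c.hM.mu_union hR1 hE
    have a3 := c.hM.mu_union hZ hFl
    rw [c.hM.mu_fl hZ] at a3
    linarith
  have h4 : (B : ℝ) * mu M R ≤ B * (2 * mu M Z + mu M (Edge b h w) + mu M Q) := by gcongr
  unfold mu at *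
  linarith

end Core

set_option maxHeartbeats 1000000 in
theorem S4 (b : ℝ) (hb : 1 < b) (B : ℕ) (hB : 1 ≤ B) (η : ℝ) (hη : 0 < η) : ∃ smax : ℕ, ∀ (H : Set ℤ) (Θ Φ : P → P)
    (M M' : (P → ℝ) → ℝ), Core b B H Θ Φ M M' → ∃ s : ℕ, 1 ≤ s ∧ s ≤ smax ∧ M (gex Φ s) ≤ η := by
  have hB0 : (1 : ℝ) ≤ B := by exact_mod_cast hB
  have hBp : (0 : ℝ) < B := by linarith
  set ε0 : ℝ := η / 8 with hε0
  have he0 : 0 < ε0 := by positivity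
  set c0 : ℝ := ε0 / (2 * (1 + ε0)) with hc0
  have hc0p : 0 < c0 := by positivity
  have hc0le : c0 ≤ ε0 := by
    rw [hc0]; exact div_le_self he0.le (by linarith)
  set κ : ℝ := 1 / (1 + ε0) + c0 with hκ
  have hκ0 : 0 ≤ κ := by positivity
  have hκ1 : κ < 1 := by
    rw [hκ, hc0]
    have : 1 / (1 + ε0) + ε0 / (2 * (1 + ε0)) = (2 + ε0) / (2 + 2 * ε0) := by field_simp
    rw [this, div_lt_one (by linarith)]
    linarith
  set θ : ℝ := min (1 / 2) (η / (64 * B)) with hθ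
  have hθ0 : 0 < θ := by rw [hθ]; positivity
  have hθ1 : θ ≤ 1 / 2 := min_le_left _ _
  have hθ2 : 8 * B * θ ≤ η / 8 := by
    have : θ ≤ η / (64 * B) := min_le_right _ _
    calc 8 * B * θ ≤ 8 * B * (η / (64 * B)) := by gcongr
      _ = η / 8 := by field_simp; ring
  set δ : ℝ := η / (16 * B) with hδ
  have hδ0 : 0 < δ := by positivity
  have hδ2 : 2 * B * δ = η / 8 := by rw [hδ]; field_simp; ring
  obtain ⟨G, hG⟩ := exists_nat_gt (4 * B / c0)
  have hG0 : (0 : ℝ) < G := lt_trans (by positivity) hG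
  have hG' : 4 * B ≤ c0 * G := by
    rw [div_lt_iff₀ hc0p] at hG; linarith
  set δA : ℝ := η / (32 * B * (G + 2)) with hδA
  have hδA0 : 0 < δA := by positivity
  have hδA2 : 4 * B * (G + 2) * δA = η / 8 := by rw [hδA]; field_simp; ring
  set ε : ℝ := c0 * θ / (592 * B) with hε
  have hεp : 0 < ε := by positivity
  obtain ⟨h1, hh1⟩ := Edge_small b hb θ hθ0 hθ1
  obtain ⟨m0, hm0⟩ := tree_count b hb B κ hκ0 hκ1 δ hδ0
  obtain ⟨N1, hN1⟩ := exists_nat_ge (B / ε)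
  obtain ⟨N2, hN2⟩ := exists_nat_ge (B * G / θ)
  obtain ⟨N3, hN3⟩ := exists_nat_ge (2 * B * m0 / θ)
  set h0 : ℕ := 1 + h1 + N1 + N2 + N3 with hh0
  obtain ⟨hmax, hdiff⟩ := diff_scale b B ε δA hεp hδA0 h0 (by omega)
  refine ⟨hmax, fun H Θ Φ M M' c => ?_⟩
  obtain ⟨h, hle, hmx, A, hA, hAmu, hAl⟩ := hdiff M c.hM (fun p => ((Φ p).2.2 : ℝ)) c.vm (c.v_step hb)
  have hh : 1 ≤ h := by omega
  obtain ⟨Z, hZ, hZmu, Lam, Cc, hLC⟩ := merge hb hh B ε hεp (fun p => ((Φ p).2.2 : ℝ)) c.v_lip A hA univ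
    (fun p hp => by obtain ⟨l, hl⟩ := hAl p hp; exact ⟨l, mem_univ _, hl⟩)
  have hZmu' : mu M Z ≤ 2 * δA := (hZmu M c.hM).trans (by linarith)
  have hhR : (0 : ℝ) < h := by exact_mod_cast hh
  have a1 : (N1 : ℝ) ≤ h := by exact_mod_cast (by omega : N1 ≤ h)
  have a2 : (N2 : ℝ) ≤ h := by exact_mod_cast (by omega : N2 ≤ h)
  have a3 : (N3 : ℝ) ≤ h := by exact_mod_cast (by omega : N3 ≤ h)
  have hBε : B ≤ ε * h := by
    have := hN1.trans a1
    rw [div_le_iff₀ hεp] at this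
    linarith
  have hBG : B * G ≤ θ * h := by
    have := hN2.trans a2
    rw [div_le_iff₀ hθ0] at this
    linarith
  have hBm : 2 * B * m0 ≤ θ * h := by
    have := hN3.trans a3
    rw [div_le_iff₀ hθ0] at this
    linarith
  set s : ℕ := ⌊θ * h / (B * G)⌋₊ with hs
  have hBGp : 0 < (B : ℝ) * G := by positivity
  have hs1 : 1 ≤ s := by
    rw [hs, Nat.one_le_floor_iff, le_div_iff₀ hBGp]; linarith
  have hs1' : (1 : ℝ) ≤ s := by exact_mod_cast hs1
  have hsle : (s : ℝ) * (B * G) ≤ θ * h := by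
    rw [← le_div_iff₀ hBGp]; exact Nat.floor_le (by positivity)
  have hsge : θ * h ≤ 2 * s * (B * G) := by
    have := Nat.lt_floor_add_one (θ * h / (B * G))
    rw [← hs, div_lt_iff₀ hBGp] at this
    have h7 : 1 * (B * G : ℝ) ≤ s * (B * G) := by gcongr
    linarith
  have hGn : 1 ≤ G := by exact_mod_cast Nat.one_le_iff_ne_zero.2 (by rintro rfl; simp at hG0)
  have hm1 : 1 ≤ G * s := Nat.mul_pos hGn hs1
  set e : ℝ := 37 * (ε * h + B) with he
  have hmr : ((G * s : ℕ) : ℝ) = G * s := by push_cast; ring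
  have hεh : ε * h * (592 * B) = c0 * (θ * h) := by rw [hε]; field_simp
  have he2 : 2 * e ≤ c0 * (G * s) / 2 := by
    have : 4 * (2 * e) * B ≤ c0 * (θ * h) := by
      have h5 : 4 * (2 * e) ≤ 592 * (ε * h) := by rw [he]; linarith
      have h6 := mul_le_mul_of_nonneg_right h5 hBp.le
      linarith
    have h2 : c0 * (θ * h) ≤ c0 * (2 * s * (B * G)) := by gcongr
    have h3 : 4 * (2 * e) * B ≤ 4 * (c0 * (G * s) / 2) * B := by linarith
    have := le_of_mul_le_mul_right h3 hBp
    linarith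
  have hsB : 2 * B * s ≤ c0 * (G * s) / 2 := by
    have := mul_le_mul_of_nonneg_right hG' (zero_le_one.trans hs1')
    linarith
  have hwθ : ((G * s * B : ℕ) : ℝ) ≤ θ * h := by push_cast; linarith
  have hE := hh1 h (by omega) hh (G * s * B) hwθ M c.hM
  have hm0le : m0 ≤ G * s := by
    have : (m0 : ℝ) * (2 * B) ≤ (G * s : ℕ) * (2 * B) := by rw [hmr]; linarith
    exact_mod_cast le_of_mul_le_mul_right this (by positivity)
  have hBad := hm0 (G * s) hm0le Θ c.Θm' c.Θ1 c.Θ2 M' c.hM'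
  have hst := c.steep hb hh Z hZ Lam Cc e (fun p hp => (hLC p hp).2) G s (G * s * B) hs1 le_rfl
    (Nat.mul_pos hm1 hB) ε0 κ he0 (by
      rw [hmr, hκ, add_mul]
      have : (G * s : ℝ) / (1 + ε0) = 1 / (1 + ε0) * (G * s) := by ring
      linarith)
  have hgi := c.gex_int hb hh Z hZ Lam Cc e (fun p hp => (hLC p hp).2) (G * s) (G * s * B) hm1
    (Nat.le_mul_of_pos_right _ hB) ε0 he0 (by
      rw [hmr]
      have h8 : c0 * (G * s) ≤ ε0 * (G * s) := by gcongr
      have h9 : 0 ≤ c0 * (G * s) := by positivity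
      linarith)
  refine ⟨G * s, hm1, ?_, hgi.trans ?_⟩
  · have : ((G * s : ℕ) : ℝ) ≤ h := by
      have h2 : ((G * s : ℕ) : ℝ) ≤ (G * s * B : ℕ) := by exact_mod_cast Nat.le_mul_of_pos_right _ hB
      have h3 : θ * h ≤ 1 * h := by gcongr; linarith
      linarith
    exact (by exact_mod_cast this : G * s ≤ h).trans hmx
  · have q : 2 * mu M Z + mu M (Edge b h (G * s * B)) + mu M {p | 1 + ε0 ≤ |Lam (tidx b h p)|} ≤
        2 * (G + 2) * (2 * δA) + 4 * (2 * θ) + 2 * δ := by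
      have : (G + 2 : ℝ) * mu M Z ≤ (G + 2) * (2 * δA) := by gcongr
      linarith
    have q2 := mul_le_mul_of_nonneg_left q hBp.le
    have q3 : (B : ℝ) * (2 * (G + 2) * (2 * δA) + 4 * (2 * θ) + 2 * δ) = 4 * B * (G + 2) * δA + 8 * B * θ + 2 * B * δ := by ring
    rw [hδA2, hδ2] at q3
    linarith
end SolPf
end

section
open MeasureTheory Set Filter Topology
namespace SolPf

/-- averaged telescoping -/
theorem avg_lip (a g : ℕ → ℝ) (B : ℝ) (s : ℕ) (hs : 1 ≤ s) (hB : 0 ≤ B)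
    (ha : ∀ i j : ℕ, |a i - a j| ≤ B * |(i : ℝ) - j|)
    (hg : ∀ i, |a (i + s) - a i| ≤ s * (1 + g i)) (hg0 : ∀ i, 0 ≤ g i) (W : ℕ) (C : ℝ)
    (hC : ∑ i ∈ Finset.range W, g i ≤ C) (i j : ℕ) (hij : i ≤ j) (hj : j ≤ W) :
    |a j - a i| ≤ (j - i) + C + 2 * B * s := by
  have hs0 : (0 : ℝ) < s := by exact_mod_cast hs
  set A : ℕ → ℝ := fun i => ∑ o ∈ Finset.range s, a (i + o) with hA
  have hstep : ∀ i, A (i + 1) - A i = a (i + s) - a i := by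
    intro i
    have h1 : A (i + 1) + a i = A i + a (i + s) := by
      simp only [hA]
      rw [← Finset.sum_range_succ (fun o => a (i + o)) s, Finset.sum_range_succ' (fun o => a (i + o)) s]
      simp only [add_zero]
      congr 1
      apply Finset.sum_congr rfl
      intro o _
      congr 1
      ring
    linarith
  have hnear : ∀ i, |A i - s * a i| ≤ s * (B * s) := by
    intro i
    have : A i - s * a i = ∑ o ∈ Finset.range s, (a (i + o) - a i) := by
      rw [Finset.sum_sub_distrib]; simp [hA]
    rw [this]
    refine (Finset.abs_sum_le_sum_abs _ _).trans ?_
    refine (Finset.sum_le_card_nsmul _ _ (B * s) fun o ho => ?_).trans (by simp)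
    refine (ha _ _).trans ?_
    have : (o : ℝ) ≤ s := by exact_mod_cast (Finset.mem_range.1 ho).le
    push_cast
    rw [add_sub_cancel_left, abs_of_nonneg (by positivity)]
    gcongr
  have htel : |A j - A i| ≤ s * ((j - i) + C) := by
    have h1 : |A j - A i| ≤ s * ((j - i) + ∑ k ∈ Finset.Ico i j, g k) := by
      clear hj
      induction j, hij using Nat.le_induction with
      | base => simp
      | succ j hij ih =>
        rw [Finset.sum_Ico_succ_top hij]
        have h2 := hg j
        rw [← hstep] at h2
        have h3 := abs_add_le (A (j + 1) - A j) (A j - A i)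
        rw [sub_add_sub_cancel] at h3
        push_cast
        linarith
    have h2 : ∑ k ∈ Finset.Ico i j, g k ≤ ∑ k ∈ Finset.range W, g k := by
      refine Finset.sum_le_sum_of_subset_of_nonneg (fun k hk => ?_) fun k _ _ => hg0 k
      simp only [Finset.mem_Ico, Finset.mem_range] at *
      omega
    refine h1.trans ?_
    gcongr
    linarith
  have h1 := hnear i
  have h2 := hnear j
  have : s * |a j - a i| ≤ s * ((j - i) + C + 2 * B * s) := by
    have e0 : (s : ℝ) * |a j - a i| = |s * a j - s * a i| := by rw [← mul_sub, abs_mul, abs_of_pos hs0]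
    rw [e0]
    rw [abs_le] at *
    constructor <;> linarith
  exact le_of_mul_le_mul_left this hs0

theorem straight (a : ℕ → ℝ) (W : ℕ) (e κ : ℝ) (hκ : κ ≤ 1) (he : 0 ≤ e)
    (ha : ∀ i ≤ W, ∀ j ≤ W, |a i - a j| ≤ |(i : ℝ) - j| + e * W) (i j : ℕ) (hi : i ≤ W) (hj : j ≤ W) (hji : j ≤ i)
    (h : κ * W < a i - a j) (k c : ℕ) (hk : k ≤ W) (hc : c ≤ W) :
    |a k - a c - (k - c)| ≤ 6 * (1 - κ + e) * W := by
  have hW : (0 : ℝ) ≤ W := by positivity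
  have hji' : (j : ℝ) ≤ i := by exact_mod_cast hji
  have hiW : (i : ℝ) ≤ W := by exact_mod_cast hi
  have hj0 : (0 : ℝ) ≤ j := by positivity
  have heW : 0 ≤ e * W := by positivity
  have h0 := ha i hi j hj
  rw [abs_of_nonneg (by linarith : (0 : ℝ) ≤ i - j), abs_le] at h0
  have key : ∀ k ≤ W, |a k - a j - (k - j)| ≤ 3 * (1 - κ + e) * W := by
    intro k hk
    have hk0 : (0 : ℝ) ≤ k := by positivity
    have hkW : (k : ℝ) ≤ W := by exact_mod_cast hk
    have h1 := ha k hk j hj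
    have h2 := ha i hi k hk
    have h3 : |(k : ℝ) - j| ≤ (k - j) + 2 * ((1 - κ + e) * W) := by
      rw [abs_le]
      constructor <;> nlinarith
    have h4 : |(i : ℝ) - k| ≤ (i - k) + 2 * ((1 - κ + e) * W) := by
      rw [abs_le]
      constructor <;> nlinarith
    rw [abs_le] at h1 h2 ⊢
    constructor <;> nlinarith
  have h1 := key k hk
  have h2 := key c hc
  rw [abs_le] at *
  constructor <;> linarith

theorem straight' (a : ℕ → ℝ) (W : ℕ) (e κ : ℝ) (hκ : κ ≤ 1) (he : 0 ≤ e)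
    (ha : ∀ i ≤ W, ∀ j ≤ W, |a i - a j| ≤ |(i : ℝ) - j| + e * W) (i j : ℕ) (hi : i ≤ W) (hj : j ≤ W)
    (h : κ * W < a i - a j) : ∃ l ∈ ({1, -1} : Set ℝ), ∀ (k c : ℕ), k ≤ W → c ≤ W →
    |a k - a c - l * (k - c)| ≤ 6 * (1 - κ + e) * W := by
  rcases le_total j i with hji | hji
  · refine ⟨1, by simp, fun k c hk hc => ?_⟩
    rw [one_mul]
    exact straight a W e κ hκ he ha i j hi hj hji h k c hk hc
  · refine ⟨-1, by simp, fun k c hk hc => ?_⟩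
    have := straight (fun i => - a i) W e κ hκ he (fun i hi j hj => by
      have := ha i hi j hj
      rw [← abs_neg, show -(-a i - -a j) = a i - a j by ring]; exact this) j i hj hi hji
      (by show _ < -a j - -a i; linarith) k c hk hc
    rw [← abs_neg] at this
    convert this using 2
    ring

theorem S5 (b : ℝ) (hb : 1 < b) (B : ℕ) (hB : 1 ≤ B) (ε δ : ℝ) (hε : 0 < ε) (hε1 : ε ≤ 1) (hδ : 0 < δ) :
    ∃ h0 : ℕ, ∀ h ≥ h0, 1 ≤ h → ∀ (H : Set ℤ) (Θ Φ : P → P)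
    (M M' : (P → ℝ) → ℝ), Core b B H Θ Φ M M' → ∃ A : Set P, MeasurableSet A ∧ mu M A ≤ δ ∧
      ∀ p ∉ A, ∃ l ∈ ({1, -1} : Set ℝ), ∀ r : ℤ, |r| ≤ 4 * h →
        |((Φ (fl r p)).2.2 : ℝ) - (Φ p).2.2 - l * r| ≤ ε * h := by
  have hB0 : (1 : ℝ) ≤ B := by exact_mod_cast hB
  set cc : ℝ := ε / 192 with hcc
  have hccp : 0 < cc := by positivity
  obtain ⟨smax, hS4⟩ := S4 b hb B hB (cc * (δ / 2)) (by positivity)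
  set κ : ℝ := 1 - ε / 96 with hκ
  obtain ⟨m0, hm0⟩ := tree_count b hb B κ (by linarith) (by linarith) (δ / 2) (by positivity)
  obtain ⟨N, hN⟩ := exists_nat_ge (2 * B * smax / (8 * cc))
  refine ⟨N + m0, fun h hh hh1 H Θ Φ M M' c => ?_⟩
  obtain ⟨s, hs1, hs2, hgex⟩ := hS4 H Θ Φ M M' c
  have hh0 : (0 : ℝ) < h := by exact_mod_cast hh1
  set W : ℕ := 8 * h with hW
  have hW0 : (0 : ℝ) < W := by rw [hW]; push_cast; positivity
  have hWr : (W : ℝ) = 8 * h := by rw [hW]; push_cast; ring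
  have hsB : 2 * B * s ≤ cc * W := by
    have h1 : (s : ℝ) ≤ smax := by exact_mod_cast hs2
    have h2 : (N : ℝ) ≤ h := by exact_mod_cast (by omega : N ≤ h)
    have h3 := hN.trans h2
    rw [div_le_iff₀ (by positivity)] at h3
    have h4 : 2 * B * (s : ℝ) ≤ 2 * B * smax := by gcongr
    rw [hWr]
    linarith
  set avg : P → ℝ := fun p => (W : ℝ)⁻¹ * ∑ i ∈ Finset.range W, gex Φ s (fl i p) with havg
  have hgB := c.gex_BM hb s hs1
  have hsumBM : BM fun p => ∑ i ∈ Finset.range W, gex Φ s (fl i p) :=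
    BM.sum _ (fun i : ℕ => fun p => gex Φ s (fl i p)) fun i _ => hgB.comp (fl_meas i)
  have havgBM : BM avg := hsumBM.smul _
  have havg0 : ∀ p, 0 ≤ avg p := fun p =>
    mul_nonneg (by positivity) (Finset.sum_nonneg fun i _ => Core.gex_nonneg s _)
  have hMavg : M avg = M (gex Φ s) := by
    rw [havg, c.hM.smul _ hsumBM,
      c.hM.sum _ (fun i : ℕ => fun p => gex Φ s (fl i p)) fun i _ => hgB.comp (fl_meas i)]
    have : ∀ i ∈ Finset.range W, M (fun p => gex Φ s (fl i p)) = M (gex Φ s) := fun i _ => c.hM.inv_fl _ hgB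
    rw [Finset.sum_congr rfl this, Finset.sum_const, Finset.card_range, nsmul_eq_mul, ← mul_assoc,
      inv_mul_cancel₀ hW0.ne', one_mul]
  have hmk := c.hM.markov havgBM havg0 hccp
  have hA1 : MeasurableSet {p | cc < avg p} := measurableSet_lt measurable_const havgBM.1
  have hA2 := Bad_meas Φ c.Φm κ W
  have hBad := hm0 W (by omega) Φ c.Φm c.Φ1 c.Φ2 M c.hM
  set A0 := {p | cc < avg p} ∪ Bad Φ κ W with hA0
  have hA0m : MeasurableSet A0 := hA1.union hA2
  refine ⟨fl (-(4 * h)) ⁻¹' A0, fl_meas _ hA0m, ?_, ?_⟩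
  · rw [c.hM.mu_fl hA0m]
    refine (c.hM.mu_union hA1 hA2).trans ?_
    have : M avg / cc ≤ δ / 2 := by
      rw [div_le_iff₀ hccp, hMavg]; linarith
    linarith
  · intro p hp
    rw [mem_preimage] at hp
    set p' := fl (-(4 * h)) p with hp'
    have hpp : ∀ r : ℤ, fl r p = fl (r + 4 * h) p' := by
      intro r; rw [hp', fl_fl]; congr 1; ring
    rw [hA0, mem_union, not_or] at hp
    obtain ⟨hp1, hp2⟩ := hp
    have hp1 : avg p' ≤ cc := not_lt.1 hp1
    simp only [Bad, mem_ofPred_eq] at hp2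
    push Not at hp2
    obtain ⟨i, hi, j, hj, hij⟩ := hp2
    have hsum : ∑ i ∈ Finset.range W, gex Φ s (fl i p') ≤ cc * W := by
      simp only [havg] at hp1
      rw [inv_mul_le_iff₀ hW0] at hp1
      linarith
    set a : ℕ → ℝ := fun i => ((Φ (fl (i : ℕ) p')).2.2 : ℝ) with ha
    have hs0 : (0 : ℝ) < s := by exact_mod_cast hs1
    have hal : ∀ i j : ℕ, |a i - a j| ≤ B * |(i : ℝ) - j| := by
      intro i j
      have := c.v_lip' hb p' i j
      simpa using this
    have hlip : ∀ i j : ℕ, i ≤ j → j ≤ W → |a j - a i| ≤ (j - i) + cc * W + 2 * B * s := by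
      intro i j
      refine avg_lip a (fun i => gex Φ s (fl i p')) B s hs1 (by positivity) hal (fun i => ?_)
        (fun i => Core.gex_nonneg _ _) W _ hsum i j
      have : |((Φ (fl s (fl i p'))).2.2 : ℝ) - (Φ (fl i p')).2.2| / s - 1 ≤ gex Φ s (fl i p') := le_max_left _ _
      rw [sub_le_iff_le_add, div_le_iff₀ hs0, fl_fl] at this
      simp only [ha]
      push_cast
      linarith
    have hcW : cc * W + 2 * B * s ≤ ε / 96 * W := by
      have : ε / 96 * W = cc * W + cc * W := by rw [hcc]; ring
      linarith
    have hlip' : ∀ i ≤ W, ∀ j ≤ W, |a i - a j| ≤ |(i : ℝ) - j| + ε / 96 * W := by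
      intro i hi j hj
      rcases le_total i j with hle | hle
      · have := hlip i j hle hj
        have h2 : (i : ℝ) ≤ j := by exact_mod_cast hle
        rw [abs_sub_comm, abs_sub_comm (i : ℝ), abs_of_nonneg (by linarith : (0 : ℝ) ≤ j - i)]
        linarith
      · have := hlip j i hle hi
        have h2 : (j : ℝ) ≤ i := by exact_mod_cast hle
        rw [abs_of_nonneg (by linarith : (0 : ℝ) ≤ i - j)]
        linarith
    obtain ⟨l, hl, hl2⟩ := straight' a W (ε / 96) κ (by linarith) (by positivity) hlip' i j hi hj hij
    refine ⟨l, hl, fun r hr => ?_⟩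
    rw [abs_le] at hr
    have q := hl2 (r + 4 * h).toNat (4 * h) (by omega) (by omega)
    have e1 : (((r + 4 * h).toNat : ℕ) : ℤ) = r + 4 * h := Int.toNat_of_nonneg (by omega)
    have e2 : (((r + 4 * h).toNat : ℕ) : ℝ) = r + 4 * h := by exact_mod_cast e1
    have e3 : fl 0 p = p := fl_zero p
    have e4 := hpp 0
    rw [e3, zero_add] at e4
    simp only [ha] at q
    rw [e1, e2, ← hpp] at q
    push_cast at q
    rw [← e4, hκ, hWr] at q
    rw [show l * (r : ℝ) = l * (r + 4 * h - 4 * h) by ring]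
    refine q.trans (le_of_eq ?_)
    ring
end SolPf
end

section
open MeasureTheory Set Filter Topology
namespace SolPf

/-- the local pattern -/
def Hq (q : ℕ) : Set ℤ := {k | Even k ∨ Even (k / (2 * (q : ℤ)))}

theorem block_shift (q : ℕ) (hq : 1 ≤ q) (k k' e : ℤ) (lam : ℤ) (hlam : lam = 1 ∨ lam = -1)
    (hk : Even (k / (2 * (q : ℤ)))) (h1 : e ≤ k % (2 * (q : ℤ))) (h2 : k % (2 * (q : ℤ)) < 2 * q - e)
    (h3 : |k' - k - lam * (2 * q)| ≤ e) : ¬ Even (k' / (2 * (q : ℤ))) := by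
  have hk' := Int.mul_ediv_add_emod k (2 * (q : ℤ))
  set n := k / (2 * (q : ℤ))
  set r := k % (2 * (q : ℤ))
  have hz : k' / (2 * (q : ℤ)) = n + lam := by
    rw [Int.ediv_eq_iff_of_pos (by omega)]
    rw [abs_le] at h3
    constructor <;> nlinarith
  rw [hz, Int.not_even_iff_odd]
  apply hk.add_odd
  rcases hlam with rfl | rfl <;> decide

theorem emod_iff (n x r : ℤ) (h0 : 0 ≤ r) (h1 : r < n) : x % n = r ↔ n ∣ x - r := by
  constructor
  · rintro rfl
    exact Int.dvd_self_sub_emod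
  · rintro ⟨c, hc⟩
    rw [show x = r + n * c by linarith, Int.add_mul_emod_self_left, Int.emod_eq_of_lt h0 h1]

theorem IsMean.residue {b : ℝ} {M : (P → ℝ) → ℝ} (hM : IsMean b M) (q : ℕ) (hq : 1 ≤ q) (r : ℤ) :
    mu M {p | p.2.2 % (2 * (q : ℤ)) = r} ≤ 1 / (2 * q) := by
  have hm : ∀ r, MeasurableSet {p : P | p.2.2 % (2 * (q : ℤ)) = r} := fun r => DC_meas {k | k % (2 * (q : ℤ)) = r}
  by_cases hr : 0 ≤ r ∧ r < 2 * q
  swap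
  · have : {p : P | p.2.2 % (2 * (q : ℤ)) = r} = ∅ := by
      ext p
      simp only [mem_ofPred_eq, mem_empty_iff_false, iff_false]
      rintro rfl
      exact hr ⟨Int.emod_nonneg _ (by omega), Int.emod_lt_of_pos _ (by omega)⟩
    rw [this]
    simp only [mu, indicator_empty]
    have := hM.zero
    simp only [hM.zero]
    positivity
  have hq0 : (0 : ℝ) < 2 * q := by positivity
  rw [le_div_iff₀ hq0]
  have h1 : ∀ j ∈ Finset.range (2 * q), M (({p : P | p.2.2 % (2 * (q : ℤ)) = j}).indicator fun _ => 1) = mu M {p | p.2.2 % (2 * (q : ℤ)) = r} := by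
    intro j hj
    rw [Finset.mem_range] at hj
    rw [← hM.mu_fl (hm r) (r - j)]
    unfold mu
    congr 2
    ext p
    simp only [fl, mem_preimage, mem_ofPred_eq]
    rw [emod_iff _ _ j (by omega) (by omega), emod_iff _ _ r hr.1 hr.2]
    rw [show p.2.2 + (r - j) - r = p.2.2 - j by ring]
  have h2 := hM.sum (Finset.range (2 * q)) (fun j => ({p : P | p.2.2 % (2 * (q : ℤ)) = j}).indicator fun _ => (1 : ℝ))
    fun j _ => BM.ind (hm j)
  rw [Finset.sum_congr rfl h1, Finset.sum_const, Finset.card_range, nsmul_eq_mul] at h2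
  have h3 : M (fun p => ∑ j ∈ Finset.range (2 * q), ({p : P | p.2.2 % (2 * (q : ℤ)) = j}).indicator (fun _ => (1 : ℝ)) p) ≤ 1 := by
    refine hM.le_const (BM.sum _ (fun j : ℕ => ({p : P | p.2.2 % (2 * (q : ℤ)) = j}).indicator fun _ => (1 : ℝ)) fun j _ => BM.ind (hm j)) zero_le_one fun p => ?_
    rw [Finset.sum_eq_single (p.2.2 % (2 * (q : ℤ))).toNat]
    · exact indicator_le_self' (by simp) p
    · intro j _ hj
      apply indicator_of_notMem
      simp only [mem_ofPred_eq]
      omega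
    · intro h
      exfalso
      have := Int.emod_lt_of_pos p.2.2 (by omega : 0 < 2 * (q : ℤ))
      have := Int.emod_nonneg p.2.2 (by omega : 2 * (q : ℤ) ≠ 0)
      simp only [Finset.mem_range] at h
      omega
  rw [h2] at h3
  push_cast at h3
  linarith

theorem S6 (b : ℝ) (hb : 1 < b) (B : ℕ) (hB : 1 ≤ B) : ∃ q : ℕ, 1 ≤ q ∧ ∀ (H : Set ℤ) (Θ Φ : P → P)
    (M M' : (P → ℝ) → ℝ), Core b B H Θ Φ M M' → M (fun _ => 1) = 1 →
    mu M {p | ¬ (p.2.2 ∈ H ↔ p.2.2 ∈ Hq q)} = 0 → False := by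
  have hB0 : (1 : ℝ) ≤ B := by exact_mod_cast hB
  have hBp : (0 : ℝ) < B := by linarith
  set θ : ℝ := 1 / 64 with hθ
  have hθ0 : 0 < θ := by norm_num [hθ]
  set ε : ℝ := θ / (149 * 64 * B) with hε
  have hεp : 0 < ε := by positivity
  have hε1 : ε ≤ 1 := by
    rw [hε, div_le_one (by positivity), hθ]
    linarith
  obtain ⟨h1, hh1⟩ := Edge_small b hb θ hθ0 (by norm_num [hθ])
  obtain ⟨h2, hh2⟩ := S5 b hb B hB ε (1 / 64) hεp hε1 (by norm_num)
  obtain ⟨N1, hN1⟩ := exists_nat_ge (B / ε)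
  obtain ⟨N2, hN2⟩ := exists_nat_ge (2 * B / θ)
  set h : ℕ := 1 + h1 + h2 + N1 + N2 with hh
  have hh' : 1 ≤ h := by omega
  have hhR : (0 : ℝ) < h := by exact_mod_cast hh'
  have a1 : (N1 : ℝ) ≤ h := by exact_mod_cast (by omega : N1 ≤ h)
  have a2 : (N2 : ℝ) ≤ h := by exact_mod_cast (by omega : N2 ≤ h)
  have hBε : B ≤ ε * h := by
    have := hN1.trans a1
    rw [div_le_iff₀ hεp] at this
    linarith
  have hBG : 2 * B ≤ θ * h := by
    have := hN2.trans a2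
    rw [div_le_iff₀ hθ0] at this
    linarith
  set q : ℕ := ⌊θ * h / (2 * B)⌋₊ with hq
  have h2B : (0 : ℝ) < 2 * B := by positivity
  have hq1 : 1 ≤ q := by
    rw [hq, Nat.one_le_floor_iff, le_div_iff₀ h2B]; linarith
  have hq1' : (1 : ℝ) ≤ q := by exact_mod_cast hq1
  have hqle : (q : ℝ) * (2 * B) ≤ θ * h := by
    rw [← le_div_iff₀ h2B]; exact Nat.floor_le (by positivity)
  have hqge : θ * h ≤ 2 * q * (2 * B) := by
    have := Nat.lt_floor_add_one (θ * h / (2 * B))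
    rw [← hq, div_lt_iff₀ h2B] at this
    have h7 : 1 * (2 * B : ℝ) ≤ q * (2 * B) := by gcongr
    linarith
  clear_value q
  refine ⟨q, hq1, fun H Θ Φ M M' c hM1 hH => ?_⟩
  obtain ⟨A, hA, hAmu, hAl⟩ := hh2 h (by omega) hh' H Θ Φ M M' c
  obtain ⟨Z, hZ, hZmu, Lam, Cc, hLC⟩ := merge hb hh' B ε hεp (fun p => ((Φ p).2.2 : ℝ)) c.v_lip A hA {1, -1} hAl
  have hZmu' := hZmu M c.hM
  set e : ℝ := 37 * (ε * h + B) with he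
  set e' : ℕ := ⌈2 * e⌉₊ with he'
  have he0 : 0 ≤ e := by positivity
  have hee : 2 * e ≤ e' := Nat.le_ceil _
  have he'q : (e' : ℝ) ≤ q / 16 := by
    have h3 : (e' : ℝ) < 2 * e + 1 := Nat.ceil_lt_add_one (by positivity)
    have h4 : 2 * e + 1 ≤ 149 * (ε * h) := by linarith
    have h5 : 149 * (ε * h) * (64 * B) = θ * h := by rw [hε]; field_simp
    have h6 : 149 * (ε * h) * (64 * B) ≤ (q / 16) * (64 * B) := by
      rw [h5, show ((q : ℝ) / 16) * (64 * B) = 2 * q * (2 * B) by ring]; exact hqge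
    have := le_of_mul_le_mul_right h6 (by positivity)
    linarith
  clear_value e'
  set w : ℕ := 2 * q * B with hw
  have hE := Edge_meas b h w
  have hEmu := hh1 h (by omega) hh' w (by rw [hw]; push_cast; linarith) M c.hM
  set Bl1 : Set P := ⋃ r ∈ Finset.range e', {p : P | p.2.2 % (2 * (q : ℤ)) = (r : ℤ)} with hBl1
  set Bl2 : Set P := ⋃ r ∈ Finset.range e', {p : P | p.2.2 % (2 * (q : ℤ)) = 2 * q - 1 - (r : ℤ)} with hBl2
  have hres : ∀ r : ℤ, MeasurableSet {p : P | p.2.2 % (2 * (q : ℤ)) = r} := fun r => DC_meas {k | k % (2 * (q : ℤ)) = r}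
  have hBl1m : MeasurableSet Bl1 := Finset.measurableSet_biUnion _ fun r _ => hres _
  have hBl2m : MeasurableSet Bl2 := Finset.measurableSet_biUnion _ fun r _ => hres _
  have hq16 : (e' : ℝ) * (1 / (2 * q)) ≤ 1 / 32 := by
    have : (e' : ℝ) * (1 / (2 * q)) ≤ (q / 16) * (1 / (2 * q)) := by gcongr
    refine this.trans (le_of_eq ?_)
    field_simp
    norm_num
  have hBl1mu : mu M Bl1 ≤ 1 / 32 := by
    refine (c.hM.mu_biUnion _ _ fun r _ => hres _).trans ?_
    refine (Finset.sum_le_card_nsmul _ _ _ fun r _ => c.hM.residue q hq1 _).trans ?_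
    simpa using hq16
  have hBl2mu : mu M Bl2 ≤ 1 / 32 := by
    refine (c.hM.mu_biUnion _ _ fun r _ => hres _).trans ?_
    refine (Finset.sum_le_card_nsmul _ _ _ fun r _ => c.hM.residue q hq1 _).trans ?_
    simpa using hq16
  set Dn : Set P := {p | Even (p.2.2 / (2 * (q : ℤ)))} with hDn
  set Sp : Set P := {p | ¬ Even (p.2.2 / (2 * (q : ℤ)))} with hSp
  have hDnm : MeasurableSet Dn := DC_meas {k | Even (k / (2 * (q : ℤ)))}
  have hSpm : MeasurableSet Sp := DC_meas {k | ¬ Even (k / (2 * (q : ℤ)))}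
  have hflip : fl (2 * q) ⁻¹' Dn = Sp := by
    ext p
    simp only [hDn, hSp, mem_preimage, mem_ofPred_eq, fl]
    have : (p.2.2 + 2 * (q : ℤ)) / (2 * (q : ℤ)) = p.2.2 / (2 * (q : ℤ)) + 1 := by
      rw [Int.add_ediv_of_dvd_right (dvd_refl _), Int.ediv_self (by omega)]
    rw [this, Int.even_add_one]
  have hDS : mu M Dn = mu M Sp := by rw [← hflip, c.hM.mu_fl hDnm]
  have hDS1 : mu M Dn + mu M Sp = 1 := by
    rw [← c.hM.mu_disj hDnm hSpm (by rw [Set.disjoint_left]; intro p hp hp'; exact hp' hp)]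
    have : Dn ∪ Sp = univ := by ext p; exact iff_of_true (em _) trivial
    rw [this]; simpa [mu] using hM1
  have hEv : MeasurableSet {p : P | Even p.2.2} := DC_meas {k | Even k}
  have hOd : MeasurableSet {p : P | ¬ Even p.2.2} := DC_meas {k | ¬ Even k}
  have hpar : fl 1 ⁻¹' (Sp ∩ {p : P | ¬ Even p.2.2}) = Sp ∩ {p : P | Even p.2.2} := by
    ext p
    simp only [hSp, mem_preimage, mem_inter_iff, mem_ofPred_eq, fl]
    have hpe : ¬ Even (p.2.2 + 1) ↔ Even p.2.2 := by rw [Int.even_add_one, not_not]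
    rw [hpe]
    refine and_congr_left fun hev => ?_
    have : (p.2.2 + 1) / (2 * (q : ℤ)) = p.2.2 / (2 * (q : ℤ)) := by
      obtain ⟨d, hd⟩ := hev
      rw [Int.ediv_eq_iff_of_pos (by omega)]
      have e1 := Int.mul_ediv_add_emod p.2.2 (2 * (q : ℤ))
      have e2 := Int.emod_nonneg p.2.2 (by omega : 2 * (q : ℤ) ≠ 0)
      have e3 := Int.emod_lt_of_pos p.2.2 (by omega : 0 < 2 * (q : ℤ))
      have e4 : (p.2.2 % (2 * (q : ℤ))) % 2 = 0 := by
        rw [Int.emod_emod_of_dvd _ (dvd_mul_right 2 (q : ℤ))]; omega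
      have e5 : p.2.2 % (2 * (q : ℤ)) + 1 < 2 * q := by omega
      constructor <;> nlinarith
    rw [this]
  have hSpE : mu M (Sp ∩ {p : P | Even p.2.2}) = 1 / 4 := by
    have h1 : mu M (Sp ∩ {p : P | Even p.2.2}) = mu M (Sp ∩ {p : P | ¬ Even p.2.2}) := by
      rw [← hpar, c.hM.mu_fl (hSpm.inter hOd)]
    have h2 := c.hM.mu_disj (hSpm.inter hEv) (hSpm.inter hOd) (by
      rw [Set.disjoint_left]; rintro p ⟨_, hp⟩ ⟨_, hp'⟩; exact hp' hp)
    rw [← inter_union_distrib_left] at h2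
    have : {p : P | Even p.2.2} ∪ {p : P | ¬ Even p.2.2} = univ := by ext p; exact iff_of_true (em _) trivial
    rw [this, inter_univ] at h2
    linarith
  set X : Set P := {p | ¬ (p.2.2 ∈ H ↔ p.2.2 ∈ Hq q)} with hX
  have hXm : MeasurableSet X := DC_meas {k | ¬ (k ∈ H ↔ k ∈ Hq q)}
  have hDCm := DC_meas H
  have hDense : 1 / 2 ≤ mu M' (Θ ⁻¹' Dn) := by
    rw [c.trans _ hDnm]
    have : Dn ⊆ ({p | p.2.2 ∈ H} ∩ Dn) ∪ X := by
      intro p hp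
      by_cases hpX : p ∈ X
      · exact Or.inr hpX
      · rw [hX, mem_ofPred_eq, not_not] at hpX
        exact Or.inl ⟨hpX.2 (Or.inr hp), hp⟩
    have := c.hM.mu_le_two hDnm (hDCm.inter hDnm) hXm this
    linarith
  have hSparse : mu M' (Θ ⁻¹' Sp) ≤ 1 / 4 := by
    rw [c.trans _ hSpm]
    have : {p | p.2.2 ∈ H} ∩ Sp ⊆ (Sp ∩ {p : P | Even p.2.2}) ∪ X := by
      rintro p ⟨hp1, hp2⟩
      by_cases hpX : p ∈ X
      · exact Or.inr hpX
      · rw [hX, mem_ofPred_eq, not_not] at hpX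
        exact Or.inl ⟨hp2, (hpX.1 hp1).resolve_right hp2⟩
    have := c.hM.mu_le_two (hDCm.inter hSpm) (hSpm.inter hEv) hXm this
    linarith
  have sub : Θ ⁻¹' Dn ⊆ fl (2 * q) ⁻¹' (Θ ⁻¹' Sp) ∪ (Θ ⁻¹' (Edge b h w ∪ Z ∪ (Bl1 ∪ Bl2)) ∪
      fl (2 * q) ⁻¹' (Θ ⁻¹' Z)) := by
    intro x hx
    by_contra hcon
    simp only [mem_union, mem_preimage, not_or] at hcon
    obtain ⟨k1, ⟨⟨k2, k3⟩, k4, k5⟩, k6⟩ := hcon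
    have hsame := edge_same hb hh' B (by positivity) w (2 * q) (by rw [hw]; push_cast; exact le_rfl)
      (fun i => Θ (fl (i : ℤ) x))
      (fun i _ => by have := c.Θstep hb x i; exact_mod_cast this) (by simpa [fl_zero] using k2) (2 * q) le_rfl
    simp only [Nat.cast_zero, fl_zero] at hsame
    push_cast at hsame
    obtain ⟨l1, l2⟩ := hLC _ k3
    obtain ⟨-, l3⟩ := hLC _ k6
    rw [hsame, c.comp] at l3
    rw [c.comp] at l2
    set lam := Lam (tidx b h (Θ x))
    have hfx : (fl (2 * (q : ℤ)) x).2.2 = x.2.2 + 2 * q := rfl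
    rw [hfx] at l3
    push_cast at l3
    have hd : ∃ li : ℤ, (li = 1 ∨ li = -1) ∧ (li : ℝ) = lam := by
      rcases l1 with l1 | l1
      · exact ⟨1, Or.inl rfl, by rw [l1]; norm_num⟩
      · exact ⟨-1, Or.inr rfl, by rw [l1]; norm_num⟩
    obtain ⟨li, hli, hli2⟩ := hd
    refine k1 (block_shift q hq1 (Θ x).2.2 _ e' li hli hx ?_ ?_ ?_)
    · by_contra hlt
      refine k4 ?_
      rw [hBl1, mem_iUnion₂]
      have := Int.emod_nonneg (Θ x).2.2 (by omega : 2 * (q : ℤ) ≠ 0)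
      exact ⟨((Θ x).2.2 % (2 * (q : ℤ))).toNat, by rw [Finset.mem_range]; omega, by
        simp only [mem_ofPred_eq]; omega⟩
    · by_contra hlt
      refine k5 ?_
      rw [hBl2, mem_iUnion₂]
      have := Int.emod_lt_of_pos (Θ x).2.2 (by omega : 0 < 2 * (q : ℤ))
      exact ⟨(2 * q - 1 - (Θ x).2.2 % (2 * (q : ℤ))).toNat, by rw [Finset.mem_range]; omega, by
        simp only [mem_ofPred_eq]; omega⟩
    · have : |((Θ (fl (2 * (q : ℤ)) x)).2.2 : ℝ) - (Θ x).2.2 - li * (2 * q)| ≤ e' := by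
        refine le_trans ?_ hee
        rw [← hli2] at l2 l3
        rw [abs_le] at *
        rcases hli with rfl | rfl
        · push_cast at *
          constructor <;> linarith
        · push_cast at *
          constructor <;> linarith
      exact_mod_cast this
  have hBl := hBl1m.union hBl2m
  have hEZ := hE.union hZ
  have hall := hEZ.union hBl
  have f1 := c.hM'.mu_le_two (c.Θm hDnm) (fl_meas (2 * q) (c.Θm hSpm)) ((c.Θm hall).union (fl_meas (2 * q) (c.Θm hZ))) sub
  have f2 := c.hM'.mu_union (c.Θm hall) (fl_meas (2 * q) (c.Θm hZ))
  rw [c.hM'.mu_fl (c.Θm hSpm)] at f1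
  rw [c.hM'.mu_fl (c.Θm hZ)] at f2
  have f3 := c.trans_le _ hall
  have f4 := c.trans_le _ hZ
  have f5 := c.hM.mu_union hEZ hBl
  have f6 := c.hM.mu_union hE hZ
  have f7 := c.hM.mu_union hBl1m hBl2m
  have g1 : mu M (Edge b h w) ≤ 1 / 32 := hEmu.trans (by rw [hθ]; norm_num)
  clear_value Bl1 Bl2 w Dn Sp
  clear hEmu hθ0
  linarith only [f1, f2, f3, f4, f5, f6, f7, g1, hDense, hSparse, hZmu', hAmu, hBl1mu, hBl2mu]

end SolPf
end

section
open MeasureTheory Set Filter Topology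
namespace SolPf

structure Fol (b : ℝ) (Ω : ℕ → Set P) (V : ℕ → ℝ) : Prop where
  meas : ∀ n, MeasurableSet (Ω n)
  pos : ∀ n, 0 < V n
  le : ∀ n, vol (Ω n) ≤ ENNReal.ofReal (V n)
  bdry : ∀ ρ : ℝ, ∃ (E : ℕ → Set P) (e : ℕ → ℝ), Tendsto e atTop (𝓝 0) ∧ ∀ n, MeasurableSet (E n) ∧ 0 ≤ e n ∧
    vol (E n) ≤ ENNReal.ofReal (e n * V n) ∧ ∀ p q, near b ρ p q → ¬ (p ∈ Ω n ↔ q ∈ Ω n) → p ∈ E n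

/-- averages -/
noncomputable def avg (Ω : ℕ → Set P) (V : ℕ → ℝ) (f : P → ℝ) (n : ℕ) : ℝ := (V n)⁻¹ * ∫ p in Ω n, f p ∂vol

noncomputable def folM (Ω : ℕ → Set P) (V : ℕ → ℝ) (f : P → ℝ) : ℝ := limUnder (hyperfilter ℕ : Filter ℕ) (avg Ω V f)

theorem ultra_tendsto (a : ℕ → ℝ) (C : ℝ) (h : ∀ n, |a n| ≤ C) :
    Tendsto a (hyperfilter ℕ) (𝓝 (limUnder (hyperfilter ℕ : Filter ℕ) a)) := by
  apply tendsto_nhds_limUnder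
  obtain ⟨x, -, hx⟩ := (isCompact_Icc (a := -C) (b := C)).ultrafilter_le_nhds' ((hyperfilter ℕ).map a)
    (by rw [Ultrafilter.mem_map]; exact Filter.univ_mem' fun n => abs_le.1 (h n))
  exact ⟨x, hx⟩

namespace Fol
variable {b : ℝ} {Ω : ℕ → Set P} {V : ℕ → ℝ} (F : Fol b Ω V)
include F

theorem lt_top (n : ℕ) : vol (Ω n) < ⊤ := (F.le n).trans_lt ENNReal.ofReal_lt_top

theorem real_le (n : ℕ) : vol.real (Ω n) ≤ V n := ENNReal.toReal_le_of_le_ofReal (F.pos n).le (F.le n)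

theorem integrable {f : P → ℝ} (hf : BM f) (n : ℕ) : IntegrableOn f (Ω n) vol := by
  obtain ⟨hm, C, hC⟩ := hf
  exact IntegrableOn.of_bound (F.lt_top n) hm.aestronglyMeasurable C (Filter.Eventually.of_forall hC)

theorem avg_le {f : P → ℝ} {C : ℝ} (hC : ∀ p, |f p| ≤ C) (n : ℕ) : |avg Ω V f n| ≤ C := by
  have hC0 : 0 ≤ C := (abs_nonneg _).trans (hC (0, 0, 0))
  unfold avg
  rw [abs_mul, abs_of_pos (inv_pos.2 (F.pos n)), inv_mul_le_iff₀ (F.pos n)]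
  have := norm_setIntegral_le_of_norm_le_const (μ := vol) (F.lt_top n) (f := f) (C := C) fun p _ => hC p
  rw [Real.norm_eq_abs] at this
  refine this.trans ?_
  rw [mul_comm]
  exact mul_le_mul_of_nonneg_right (F.real_le n) hC0

theorem tendsto {f : P → ℝ} (hf : BM f) : Tendsto (avg Ω V f) (hyperfilter ℕ) (𝓝 (folM Ω V f)) := by
  obtain ⟨hm, C, hC⟩ := hf
  exact ultra_tendsto _ C (F.avg_le hC)

theorem M_le {f g : P → ℝ} (hf : BM f) (hg : BM g) (d : ℕ → ℝ) (hd : Tendsto d atTop (𝓝 0))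
    (h : ∀ n, ∫ p in Ω n, f p ∂vol ≤ ∫ p in Ω n, g p ∂vol + d n * V n) : folM Ω V f ≤ folM Ω V g := by
  have hd' : Tendsto d (hyperfilter ℕ) (𝓝 0) := hd.mono_left Nat.hyperfilter_le_atTop
  have := (F.tendsto hg).add hd'
  rw [add_zero] at this
  refine le_of_tendsto_of_tendsto (F.tendsto hf) this (Filter.Eventually.of_forall fun n => ?_)
  simp only [avg]
  have hV := F.pos n
  rw [inv_mul_le_iff₀ hV, mul_add, mul_inv_cancel_left₀ hV.ne']
  linarith [h n]

theorem E_int {E : Set P} {e : ℝ} {n : ℕ} (hE : MeasurableSet E) (he : 0 ≤ e) (hv : vol E ≤ ENNReal.ofReal (e * V n)) 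
    (C : ℝ) (hC : 0 ≤ C) : Integrable (E.indicator fun _ => C) vol ∧ ∫ p, E.indicator (fun _ => C) p ∂vol ≤ C * e * V n := by
  have hlt := hv.trans_lt ENNReal.ofReal_lt_top
  refine ⟨(integrableOn_const hlt.ne).integrable_indicator hE, ?_⟩
  rw [integral_indicator_const _ hE, smul_eq_mul]
  have : vol.real E ≤ e * V n := ENNReal.toReal_le_of_le_ofReal (mul_nonneg he (F.pos n).le) hv
  nlinarith

theorem M_inv {T : P → P} (hT : MeasurePreserving T vol vol) (ρ : ℝ) (hn : ∀ p, near b ρ p (T p)) {f : P → ℝ} (hf : BM f) :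
    folM Ω V (fun p => f (T p)) = folM Ω V f := by
  obtain ⟨E, e, he, hE⟩ := F.bdry ρ
  have hf' := hf
  obtain ⟨hm, C, hC⟩ := hf'
  have hC0 : 0 ≤ C := (abs_nonneg _).trans (hC (0, 0, 0))
  have hd : Tendsto (fun n => C * e n) atTop (𝓝 0) := by simpa using he.const_mul C
  have key : ∀ n, |∫ p in Ω n, f (T p) ∂vol - ∫ p in Ω n, f p ∂vol| ≤ C * e n * V n := by
    intro n
    obtain ⟨h1, h2, h3, h4⟩ := hE n
    have hO := F.meas n
    obtain ⟨i1, i2⟩ := F.E_int h1 h2 h3 C hC0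
    have a1 : ∫ p in Ω n, f p ∂vol = ∫ p, (Ω n).indicator f (T p) ∂vol := by
      rw [← integral_indicator hO]
      conv_lhs => rw [← hT.map_eq]
      rw [integral_map hT.measurable.aemeasurable]
      exact (hm.indicator hO).aestronglyMeasurable
    have g1 : Integrable ((Ω n).indicator f) vol := (F.integrable hf n).integrable_indicator hO
    have g2 : Integrable (fun p => (Ω n).indicator f (T p)) vol := hT.integrable_comp_of_integrable g1
    have g3 : Integrable ((Ω n).indicator fun p => f (T p)) vol :=
      (F.integrable (hf.comp hT.measurable) n).integrable_indicator hO
    rw [a1, ← integral_indicator hO, ← integral_sub g3 g2]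
    rw [← Real.norm_eq_abs]
    refine (norm_integral_le_of_norm_le i1 (Filter.Eventually.of_forall fun p => ?_)).trans i2
    by_cases hp : (p ∈ Ω n ↔ T p ∈ Ω n)
    · have : (Ω n).indicator (fun p => f (T p)) p - (Ω n).indicator f (T p) = 0 := by
        by_cases hq : p ∈ Ω n
        · rw [indicator_of_mem hq, indicator_of_mem (hp.1 hq), sub_self]
        · rw [indicator_of_notMem hq, indicator_of_notMem (fun h => hq (hp.2 h)), sub_self]
      rw [this, norm_zero]
      exact indicator_nonneg (fun _ _ => hC0) _
    · rw [indicator_of_mem (h4 p (T p) (hn p) hp), Real.norm_eq_abs]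
      by_cases hq : p ∈ Ω n
      · rw [indicator_of_mem hq, indicator_of_notMem (fun h => hp (iff_of_true hq h)), sub_zero]
        exact hC _
      · rw [indicator_of_notMem hq, zero_sub, abs_neg]
        by_cases hq' : T p ∈ Ω n
        · rw [indicator_of_mem hq']; exact hC _
        · rw [indicator_of_notMem hq', abs_zero]; exact hC0
  apply le_antisymm
  · exact F.M_le (hf.comp hT.measurable) hf _ hd fun n => by have := abs_le.1 (key n); linarith
  · exact F.M_le hf (hf.comp hT.measurable) _ hd fun n => by have := abs_le.1 (key n); linarith

theorem M_tile (ρ : ℝ) (idx : P → ℤ × ℤ × ℤ) (hidx : Measurable idx) (hn : ∀ p q, idx p = idx q → near b ρ p q)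
    {f g : P → ℝ} (hf : BM f) (hg : BM g)
    (h : ∀ i, ∫ p in idx ⁻¹' {i}, f p ∂vol ≤ ∫ p in idx ⁻¹' {i}, g p ∂vol) : folM Ω V f ≤ folM Ω V g := by
  obtain ⟨E, e, he, hE⟩ := F.bdry ρ
  have hk := hf.sub hg
  obtain ⟨hm, C, hC⟩ := hk
  have hC0 : 0 ≤ C := (abs_nonneg _).trans (hC (0, 0, 0))
  have hd : Tendsto (fun n => C * e n) atTop (𝓝 0) := by simpa using he.const_mul C
  refine F.M_le hf hg _ hd fun n => ?_
  obtain ⟨h1, h2, h3, h4⟩ := hE n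
  have hO := F.meas n
  obtain ⟨i1, i2⟩ := F.E_int h1 h2 h3 C hC0
  set J : Set (ℤ × ℤ × ℤ) := {i | idx ⁻¹' {i} ⊆ Ω n} with hJ
  have hJO : idx ⁻¹' J ⊆ Ω n := fun p hp => hp rfl
  have hJm : MeasurableSet (idx ⁻¹' J) := hidx (Set.to_countable J).measurableSet
  have hkint : IntegrableOn (fun p => f p - g p) (Ω n) vol := F.integrable (hf.sub hg) n
  have c1 : ∫ p in idx ⁻¹' J, (f p - g p) ∂vol ≤ 0 := by
    have hU : idx ⁻¹' J = ⋃ i : J, idx ⁻¹' {(i : ℤ × ℤ × ℤ)} := by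
      ext p; simp
    have hs := hasSum_integral_iUnion (μ := vol) (f := fun p => f p - g p) (s := fun i : J => idx ⁻¹' {(i : ℤ × ℤ × ℤ)})
      (fun i => hidx (measurableSet_singleton _)) (by
        intro i j hij
        rw [Function.onFun, Set.disjoint_left]
        intro p hp hp'
        exact hij (Subtype.ext (hp.symm.trans hp'))) (by rw [← hU]; exact hkint.mono_set hJO)
    rw [hU, ← hs.tsum_eq]
    refine tsum_nonpos fun i => ?_
    have e1 : IntegrableOn f (idx ⁻¹' {(i : ℤ × ℤ × ℤ)}) vol := (F.integrable hf n).mono_set i.2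
    have e2 : IntegrableOn g (idx ⁻¹' {(i : ℤ × ℤ × ℤ)}) vol := (F.integrable hg n).mono_set i.2
    rw [integral_sub e1 e2]
    linarith [h i]
  have c2 : ∫ p in Ω n \ idx ⁻¹' J, (f p - g p) ∂vol ≤ C * e n * V n := by
    rw [← integral_indicator (hO.diff hJm)]
    refine le_trans (integral_mono ((hkint.mono_set sdiff_subset).integrable_indicator (hO.diff hJm)) i1 fun p => ?_) i2
    by_cases hp : p ∈ Ω n \ idx ⁻¹' J
    · rw [indicator_of_mem hp]
      have : ∃ q, idx q = idx p ∧ q ∉ Ω n := by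
        have h5 := hp.2
        rw [mem_preimage, hJ, mem_ofPred_eq, Set.not_subset] at h5
        exact h5
      obtain ⟨q, hq1, hq2⟩ := this
      rw [indicator_of_mem (h4 p q (hn p q hq1.symm) fun h => hq2 (h.1 hp.1))]
      exact (abs_le.1 (hC p)).2
    · rw [indicator_of_notMem hp]
      exact indicator_nonneg (fun _ _ => hC0) _
  have c3 := setIntegral_union (μ := vol) (f := fun p => f p - g p) (disjoint_sdiff_right (s := idx ⁻¹' J) (t := Ω n))
    (hO.diff hJm) (hkint.mono_set hJO) (hkint.mono_set sdiff_subset)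
  rw [union_sdiff_cancel hJO, integral_sub (F.integrable hf n) (F.integrable hg n)] at c3
  linarith

end Fol
end SolPf
end

section
open MeasureTheory Set Filter Topology
namespace SolPf

theorem mp_of (T : P → P) (hT : Measurable T) (h : ∀ S, MeasurableSet S → vol (T ⁻¹' S) = vol S) :
    MeasurePreserving T vol vol :=
  ⟨hT, by ext S hS; rw [Measure.map_apply hT hS, h S hS]⟩

theorem fl_mp (r : ℤ) : MeasurePreserving (fl r) vol vol := by
  refine mp_of _ (fl_meas r) fun S hS => ?_
  rw [vol_apply _ (fl_meas r hS), vol_apply _ hS,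
    ← (Equiv.addRight r).tsum_eq fun k : ℤ => volume {z : ℝ × ℝ | (z.1, z.2, k) ∈ S}]
  rfl

theorem yy_mp (b s : ℝ) : MeasurePreserving (yy b s) vol vol := by
  refine mp_of _ (yy_meas b s) fun S hS => ?_
  rw [vol_apply _ (yy_meas b s hS), vol_apply _ hS]
  refine tsum_congr fun k => ?_
  have := measure_preimage_add_right (volume : Measure (ℝ × ℝ)) (0, b ^ (-k) * s) {z : ℝ × ℝ | (z.1, z.2, k) ∈ S}
  rw [← this]
  congr 1
  ext z
  simp [yy]

theorem Fol.isMean {b : ℝ} (hb : 1 < b) {Ω : ℕ → Set P} {V : ℕ → ℝ} (F : Fol b Ω V) : IsMean b (folM Ω V) where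
  add := fun {f g} hf hg => by
    refine ((F.tendsto hf).add (F.tendsto hg)).limUnder_eq.symm ▸ ?_
    unfold folM
    congr 1
    ext n
    simp only [avg]
    rw [integral_add (F.integrable hf n) (F.integrable hg n), mul_add]
  smul := fun {f} c hf => by
    refine ((F.tendsto hf).const_mul c).limUnder_eq.symm ▸ ?_
    unfold folM
    congr 1
    ext n
    simp only [avg]
    rw [integral_const_mul]
    ring
  mono := fun {f g} hf hg h => F.M_le hf hg (fun _ => 0) tendsto_const_nhds fun n => by
    simpa using integral_mono (F.integrable hf n) (F.integrable hg n) h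
  one_le := le_of_tendsto (F.tendsto (BM.const 1)) (Filter.Eventually.of_forall fun n =>
    (abs_le.1 (F.avg_le (f := fun _ => 1) (C := 1) (by simp) n)).2)
  inv_fl := fun {f} r hf => F.M_inv (fl_mp r) |(r : ℝ)| (fun p => by
    have : 0 < b := by linarith
    refine ⟨?_, ?_, ?_⟩ <;> simp [fl] <;> positivity) hf
  inv_yy := fun {f} s hf => F.M_inv (yy_mp b s) |s| (fun p => by
    have : 0 < b := by linarith
    refine ⟨?_, ?_, ?_⟩ 
    · simp [yy]; positivity
    · simp only [yy, add_sub_cancel_left, abs_mul, abs_zpow, abs_of_pos this]; rw [mul_comm]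
    · simp [yy]) hf
  tile := fun ρ idx h1 h2 {f g} hf hg h3 => F.M_tile ρ idx h1 h2 hf hg h3

theorem one_dim (a c s u v : ℝ) (h : |v - u| < s) (hor : u ∈ Ico a c ∨ v ∈ Ico a c) :
    u ∈ Ico (a - s) (c + s) ∧ (¬ (u ∈ Ico a c ↔ v ∈ Ico a c) → u ∈ Ico (a - s) (a + s) ∨ u ∈ Ico (c - s) (c + s)) := by
  rw [abs_lt] at h
  simp only [mem_Ico] at *
  refine ⟨by rcases hor with h | h <;> constructor <;> linarith, fun hn => ?_⟩
  by_contra hcon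
  push Not at hcon
  apply hn
  obtain ⟨c1, c2⟩ := hcon
  rcases hor with h' | h'
  · refine iff_of_true h' ?_
    constructor
    · by_contra h5; have := c1 (by linarith); linarith
    · by_contra h5; have := c2 (by linarith); linarith
  · refine iff_of_true ?_ h'
    constructor
    · by_contra h5; have := c1 (by linarith); linarith
    · by_contra h5; have := c2 (by linarith); linarith

theorem one_dim_int (a c s u v : ℤ) (h : |v - u| < s) (hor : u ∈ Ico a c ∨ v ∈ Ico a c) :
    u ∈ Ico (a - s) (c + s) ∧ (¬ (u ∈ Ico a c ↔ v ∈ Ico a c) → u ∈ Ico (a - s) (a + s) ∨ u ∈ Ico (c - s) (c + s)) := by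
  rw [abs_lt] at h
  simp only [mem_Ico] at *
  omega

def box (L : ℝ) (k1 k2 : ℤ) : Set P := Ico (-L) L ×ˢ Ico (-L) L ×ˢ Ico k1 k2

def ebox (L s : ℝ) (k1 k2 R : ℤ) : Set P :=
  (Ico (-L - s) (L + s) ×ˢ Ico (-L - s) (L + s) ×ˢ Ico (k1 - R) (k1 + R)) ∪
  (Ico (-L - s) (L + s) ×ˢ Ico (-L - s) (L + s) ×ˢ Ico (k2 - R) (k2 + R)) ∪
  (Ico (-L - s) (-L + s) ×ˢ Ico (-L - s) (L + s) ×ˢ Ico (k1 - R) (k2 + R)) ∪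
  (Ico (L - s) (L + s) ×ˢ Ico (-L - s) (L + s) ×ˢ Ico (k1 - R) (k2 + R)) ∪
  (Ico (-L - s) (L + s) ×ˢ Ico (-L - s) (-L + s) ×ˢ Ico (k1 - R) (k2 + R)) ∪
  (Ico (-L - s) (L + s) ×ˢ Ico (L - s) (L + s) ×ˢ Ico (k1 - R) (k2 + R))

theorem box3_meas (a1 a2 c1 c2 : ℝ) (k1 k2 : ℤ) : MeasurableSet (Ico a1 a2 ×ˢ Ico c1 c2 ×ˢ Ico k1 k2 : Set P) :=
  measurableSet_Ico.prod (measurableSet_Ico.prod measurableSet_Ico)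

theorem ebox_meas (L s : ℝ) (k1 k2 R : ℤ) : MeasurableSet (ebox L s k1 k2 R) := by
  unfold ebox
  exact (((((box3_meas _ _ _ _ _ _).union (box3_meas _ _ _ _ _ _)).union (box3_meas _ _ _ _ _ _)).union
    (box3_meas _ _ _ _ _ _)).union (box3_meas _ _ _ _ _ _)).union (box3_meas _ _ _ _ _ _)

theorem ebox_vol (L s : ℝ) (k1 k2 R : ℤ) (hL : 0 ≤ L) (hs : 0 ≤ s) (hk : k1 ≤ k2) (hR : 0 ≤ R) :
    vol (ebox L s k1 k2 R) ≤ ENNReal.ofReal (16 * R * (L + s) ^ 2 + 16 * s * (L + s) * (k2 - k1 + 2 * R)) := by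
  have hk' : (k1 : ℝ) ≤ k2 := by exact_mod_cast hk
  have hR' : (0 : ℝ) ≤ R := by exact_mod_cast hR
  have hd : (0 : ℝ) ≤ k2 - k1 := by linarith
  have hA : (0 : ℝ) ≤ 8 * R * (L + s) ^ 2 := by positivity
  have hB : (0 : ℝ) ≤ 4 * s * (L + s) * (k2 - k1 + 2 * R) := by positivity
  unfold ebox
  refine (measure_union_le _ _).trans ?_
  refine (add_le_add_left ((measure_union_le _ _).trans (add_le_add_left ((measure_union_le _ _).trans (add_le_add_left 
    ((measure_union_le _ _).trans (add_le_add_left (measure_union_le _ _) _)) _)) _)) _).trans ?_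
  simp only [vol_Ico _ _ _ _ _ _ (show -L - s ≤ L + s by linarith) (show -L - s ≤ L + s by linarith), 
    vol_Ico _ _ _ _ _ _ (show -L - s ≤ -L + s by linarith) (show -L - s ≤ L + s by linarith), 
    vol_Ico _ _ _ _ _ _ (show L - s ≤ L + s by linarith) (show -L - s ≤ L + s by linarith), 
    vol_Ico _ _ _ _ _ _ (show -L - s ≤ L + s by linarith) (show -L - s ≤ -L + s by linarith), 
    vol_Ico _ _ _ _ _ _ (show -L - s ≤ L + s by linarith) (show L - s ≤ L + s by linarith)]
  push_cast
  have q1 : ∀ k : ℝ, (L + s - (-L - s)) * ((L + s - (-L - s)) * (k + R - (k - R))) = 8 * R * (L + s) ^ 2 := by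
    intro k; ring
  have q2 : (-L + s - (-L - s)) * ((L + s - (-L - s)) * (k2 + R - (k1 - R))) = 4 * s * (L + s) * (k2 - k1 + 2 * R) := by ring
  have q3 : (L + s - (L - s)) * ((L + s - (-L - s)) * (k2 + R - (k1 - R))) = 4 * s * (L + s) * (k2 - k1 + 2 * R) := by ring
  have q4 : (L + s - (-L - s)) * ((-L + s - (-L - s)) * (k2 + R - (k1 - R))) = 4 * s * (L + s) * (k2 - k1 + 2 * R) := by ring
  have q5 : (L + s - (-L - s)) * ((L + s - (L - s)) * (k2 + R - (k1 - R))) = 4 * s * (L + s) * (k2 - k1 + 2 * R) := by ring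
  rw [q1, q1, q2, q3, q4, q5, ← ENNReal.ofReal_add hA hA, ← ENNReal.ofReal_add (by positivity) hB, 
    ← ENNReal.ofReal_add (by positivity) hB, ← ENNReal.ofReal_add (by positivity) hB, ← ENNReal.ofReal_add (by positivity) hB]
  apply ENNReal.ofReal_le_ofReal
  linarith

theorem ebox_mem (L s : ℝ) (k1 k2 R : ℤ) (p q : P) (h1 : |q.1 - p.1| < s) (h2 : |q.2.1 - p.2.1| < s) 
    (h3 : |q.2.2 - p.2.2| < R) (h : ¬ (p ∈ box L k1 k2 ↔ q ∈ box L k1 k2)) : p ∈ ebox L s k1 k2 R := by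
  have hor : p ∈ box L k1 k2 ∨ q ∈ box L k1 k2 := by tauto
  simp only [box, mem_prod] at hor h
  obtain ⟨x1, x2⟩ := one_dim (-L) L s _ _ h1 (hor.imp (fun h => h.1) fun h => h.1)
  obtain ⟨y1, y2⟩ := one_dim (-L) L s _ _ h2 (hor.imp (fun h => h.2.1) fun h => h.2.1)
  obtain ⟨z1, z2⟩ := one_dim_int k1 k2 R _ _ h3 (hor.imp (fun h => h.2.2) fun h => h.2.2)
  unfold ebox
  by_cases hz : p.2.2 ∈ Ico k1 k2 ↔ q.2.2 ∈ Ico k1 k2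
  swap
  · rcases z2 hz with h | h
    · exact Or.inl (Or.inl (Or.inl (Or.inl (Or.inl ⟨x1, y1, h⟩))))
    · exact Or.inl (Or.inl (Or.inl (Or.inl (Or.inr ⟨x1, y1, h⟩))))
  by_cases hx : p.1 ∈ Ico (-L) L ↔ q.1 ∈ Ico (-L) L
  swap
  · rcases x2 hx with h | h
    · exact Or.inl (Or.inl (Or.inl (Or.inr ⟨h, y1, z1⟩)))
    · exact Or.inl (Or.inl (Or.inr ⟨h, y1, z1⟩))
  by_cases hy : p.2.1 ∈ Ico (-L) L ↔ q.2.1 ∈ Ico (-L) L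
  swap
  · rcases y2 hy with h | h
    · exact Or.inl (Or.inr ⟨x1, h, z1⟩)
    · exact Or.inr ⟨x1, h, z1⟩
  exact absurd (by rw [hx, hy, hz]) h

end SolPf
end

section
open MeasureTheory Set Filter Topology
namespace SolPf

theorem near_trans {b : ℝ} (hb : 1 < b) (ρ1 ρ2 : ℝ) : ∃ ρ3, ∀ p q r, near b ρ1 p q → near b ρ2 q r → near b ρ3 p r := by
  set N := ⌈ρ1⌉₊ with hN
  have hb0 : 0 < b := by linarith
  have hN1 : ρ1 ≤ N := Nat.le_ceil _
  have hbN : 1 ≤ b ^ N := one_le_pow₀ hb.le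
  refine ⟨ρ1 + ρ2 * b ^ N, fun p q r h1 h2 => ?_⟩
  obtain ⟨a1, a2, a3⟩ := h1
  obtain ⟨c1, c2, c3⟩ := h2
  have hρ2 : 0 ≤ ρ2 := (abs_nonneg _).trans c3
  have hk := abs_le.1 (a3.trans hN1)
  have hk1 : q.2.2 ≤ p.2.2 + N := by have := hk.2; rw [← @Int.cast_le ℝ]; push_cast; linarith
  have hk2 : -q.2.2 ≤ -p.2.2 + N := by have := hk.1; rw [← @Int.cast_le ℝ]; push_cast; linarith
  have e1 : b ^ q.2.2 ≤ b ^ p.2.2 * b ^ N := by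
    rw [← zpow_natCast, ← zpow_add₀ hb0.ne']; exact zpow_le_zpow_right₀ hb.le hk1
  have e2 : b ^ (-q.2.2) ≤ b ^ (-p.2.2) * b ^ N := by
    rw [← zpow_natCast, ← zpow_add₀ hb0.ne']; exact zpow_le_zpow_right₀ hb.le hk2
  refine ⟨?_, ?_, ?_⟩
  · have := abs_sub_le r.1 q.1 p.1
    have := mul_le_mul_of_nonneg_left e1 hρ2
    linarith
  · have := abs_sub_le r.2.1 q.2.1 p.2.1
    have := mul_le_mul_of_nonneg_left e2 hρ2
    linarith
  · have := abs_sub_le (r.2.2 : ℝ) q.2.2 p.2.2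
    have := mul_le_mul_of_nonneg_left hbN hρ2
    linarith

theorem near_chain {b : ℝ} (hb : 1 < b) (ρ : ℝ) (n : ℕ) : ∃ ρ', ∀ c : ℕ → P,
    (∀ i < n, near b ρ (c i) (c (i + 1))) → near b ρ' (c 0) (c n) := by
  induction n with
  | zero => exact ⟨0, fun c _ => by simp [near]⟩
  | succ n ih =>
    obtain ⟨ρ', h⟩ := ih
    obtain ⟨ρ3, h3⟩ := near_trans hb ρ' ρ
    exact ⟨ρ3, fun c hc => h3 _ _ _ (h c fun i hi => hc i (by omega)) (hc n (by omega))⟩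

theorem near_iter {b : ℝ} (hb : 1 < b) (B : ℝ) (ρ : ℝ) : ∃ ρ', ∀ Θ : P → P, 
    (∀ p q, near b 1 p q → near b B (Θ p) (Θ q)) → ∀ p q, near b ρ p q → near b ρ' (Θ p) (Θ q) := by
  have hb0 : 0 < b := by linarith
  set N := ⌈ρ⌉₊ + 1 with hN
  have hNρ : ρ ≤ N := (Nat.le_ceil ρ).trans (by rw [hN]; push_cast; linarith)
  have hN0 : (0 : ℝ) < N := by rw [hN]; positivity
  obtain ⟨ρ1, h1⟩ := near_chain hb B N
  obtain ⟨ρ3, h3⟩ := near_trans hb ρ1 ρ1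
  refine ⟨ρ3, fun Θ hΘ p q hpq => ?_⟩
  obtain ⟨a1, a2, a3⟩ := hpq
  refine h3 _ (Θ (q.1, q.2.1, p.2.2)) _ ?_ ?_
  · have := h1 (fun i => Θ (p.1 + i * ((q.1 - p.1) / N), p.2.1 + i * ((q.2.1 - p.2.1) / N), p.2.2)) (fun i _ => by
      apply hΘ
      refine ⟨?_, ?_, by simp⟩
      · simp only
        rw [show p.1 + ((i + 1 : ℕ) : ℝ) * ((q.1 - p.1) / N) - (p.1 + i * ((q.1 - p.1) / N)) = (q.1 - p.1) / N by push_cast; ring,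
          abs_div, abs_of_pos hN0, div_le_iff₀ hN0]
        nlinarith [zpow_pos hb0 p.2.2]
      · simp only
        rw [show p.2.1 + ((i + 1 : ℕ) : ℝ) * ((q.2.1 - p.2.1) / N) - (p.2.1 + i * ((q.2.1 - p.2.1) / N)) = (q.2.1 - p.2.1) / N by push_cast; ring,
          abs_div, abs_of_pos hN0, div_le_iff₀ hN0]
        nlinarith [zpow_pos hb0 (-p.2.2)])
    simp only [Nat.cast_zero, zero_mul, add_zero] at this
    rw [mul_div_cancel₀ _ hN0.ne', mul_div_cancel₀ _ hN0.ne', add_sub_cancel, add_sub_cancel] at this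
    exact this
  · have hk : |q.2.2 - p.2.2| ≤ N := by
      have := a3.trans hNρ
      exact_mod_cast this
    rw [abs_le] at hk
    have := h1 (fun i => Θ (q.1, q.2.1, p.2.2 + max (-(i : ℤ)) (min (i : ℤ) (q.2.2 - p.2.2)))) (fun i _ => by
      apply hΘ
      refine ⟨by simp; positivity, by simp; positivity, ?_⟩
      simp only
      have : |(p.2.2 + max (-((i + 1 : ℕ) : ℤ)) (min ((i + 1 : ℕ) : ℤ) (q.2.2 - p.2.2))) - (p.2.2 + max (-(i : ℤ)) (min (i : ℤ) (q.2.2 - p.2.2)))| ≤ 1 := by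
        push_cast
        rw [abs_le]
        omega
      exact_mod_cast this)
    have e1 : p.2.2 + max (-((0 : ℕ) : ℤ)) (min ((0 : ℕ) : ℤ) (q.2.2 - p.2.2)) = p.2.2 := by push_cast; omega
    have e2 : p.2.2 + max (-(N : ℤ)) (min (N : ℤ) (q.2.2 - p.2.2)) = q.2.2 := by omega
    simp only [e1, e2] at this
    exact this

noncomputable def bL (b : ℝ) (j : ℕ) : ℝ := 2 ^ j * b ^ (2 ^ (j + 1))
noncomputable def bΩ (b : ℝ) (j : ℕ) : Set P := box (bL b j) (2 ^ j) (2 ^ (j + 1))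
noncomputable def bV (b : ℝ) (j : ℕ) : ℝ := 4 * bL b j ^ 2 * 2 ^ j

theorem bL_pos {b : ℝ} (hb : 1 < b) (j : ℕ) : 0 < bL b j := by
  have : 0 < b := by linarith
  unfold bL
  positivity

theorem bΩ_vol {b : ℝ} (hb : 1 < b) (j : ℕ) : vol (bΩ b j) = ENNReal.ofReal (bV b j) := by
  have := bL_pos hb j
  rw [bΩ, box, vol_Ico _ _ _ _ _ _ (by linarith) (by linarith), bV]
  congr 1
  push_cast
  ring

theorem box_fol {b : ℝ} (hb : 1 < b) (j : ℕ → ℕ) (hj : Tendsto j atTop atTop) :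
    Fol b (fun n => bΩ b (j n)) (fun n => bV b (j n)) where
  meas := fun n => box3_meas _ _ _ _ _ _
  pos := fun n => by have := bL_pos hb (j n); unfold bV; positivity
  le := fun n => (bΩ_vol hb _).le
  bdry := fun ρ => by
    have hb0 : 0 < b := by linarith
    set R : ℕ := ⌈ρ⌉₊ + 1 with hR
    have hρR : ρ < R := (Nat.le_ceil ρ).trans_lt (by rw [hR]; push_cast; linarith)
    set c : ℝ := R * b ^ R with hc
    have hc0 : 0 < c := by rw [hc, hR]; positivity
    set φ : ℝ → ℝ := fun z => 4 * R * z * (1 + c * z) ^ 2 + 4 * c * z * (1 + c * z) * (1 + 2 * R * z) with hφ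
    have hφc : Continuous φ := by rw [hφ]; fun_prop
    have hz : Tendsto (fun n => ((2 : ℝ) ^ (j n))⁻¹) atTop (𝓝 0) :=
      (tendsto_inv_atTop_zero.comp (tendsto_pow_atTop_atTop_of_one_lt (by norm_num : (1 : ℝ) < 2))).comp hj
    refine ⟨fun n => ebox (bL b (j n)) (R * b ^ (2 ^ (j n + 1) + R)) (2 ^ (j n)) (2 ^ (j n + 1)) R, 
      fun n => φ ((2 : ℝ) ^ (j n))⁻¹, ?_, fun n => ⟨ebox_meas _ _ _ _ _, ?_, ?_, ?_⟩⟩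
    · have := (hφc.tendsto 0).comp hz
      have h0 : φ 0 = 0 := by simp [hφ]
      rw [h0] at this
      exact this
    · simp only [hφ]; positivity
    · have h2 : (2 : ℤ) ^ (j n) ≤ 2 ^ (j n + 1) := pow_le_pow_right₀ (by norm_num) (by omega)
      have hL := bL_pos hb (j n)
      refine (ebox_vol _ _ _ _ _ hL.le (by positivity) h2 (by positivity)).trans (ENNReal.ofReal_le_ofReal (le_of_eq ?_))
      have hs : (R * b ^ (2 ^ (j n + 1) + R) : ℝ) = bL b (j n) * (c * ((2 : ℝ) ^ (j n))⁻¹) := by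
        rw [bL, hc, pow_add]; field_simp
      rw [hs, bV]
      simp only [hφ]
      push_cast
      field_simp
      ring
    · intro p q hpq hne
      have hne' : ¬ (p ∈ box (bL b (j n)) (2 ^ j n) (2 ^ (j n + 1)) ↔ q ∈ box (bL b (j n)) (2 ^ j n) (2 ^ (j n + 1))) := hne
      obtain ⟨h1, h2, h3⟩ := hpq
      have h3' : |q.2.2 - p.2.2| < R := by
        have := h3.trans_lt hρR
        exact_mod_cast this
      have h2j : (0 : ℤ) < 2 ^ j n := by positivity
      have hk : p.2.2 ≤ 2 ^ (j n + 1) + R ∧ -p.2.2 ≤ 2 ^ (j n + 1) + R := by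
        have hor : p.2.2 ∈ Ico ((2 : ℤ) ^ j n) (2 ^ (j n + 1)) ∨ q.2.2 ∈ Ico ((2 : ℤ) ^ j n) (2 ^ (j n + 1)) := by
          by_contra hcon
          push Not at hcon
          exact hne' (iff_of_false (fun h => hcon.1 h.2.2) (fun h => hcon.2 h.2.2))
        simp only [mem_Ico] at hor
        rw [abs_lt] at h3'
        omega
      have e1 : b ^ p.2.2 ≤ b ^ (2 ^ (j n + 1) + R) := by
        rw [← zpow_natCast]; apply zpow_le_zpow_right₀ hb.le; push_cast; exact hk.1
      have e2 : b ^ (-p.2.2) ≤ b ^ (2 ^ (j n + 1) + R) := by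
        rw [← zpow_natCast]; apply zpow_le_zpow_right₀ hb.le; push_cast; exact hk.2
      have hp1 := zpow_pos hb0 p.2.2
      have hp2 := zpow_pos hb0 (-p.2.2)
      refine ebox_mem _ _ _ _ _ p q (h1.trans_lt ?_) (h2.trans_lt ?_) h3' hne
      · exact (mul_lt_mul_of_pos_right hρR hp1).trans_le (by gcongr)
      · exact (mul_lt_mul_of_pos_right hρR hp2).trans_le (by gcongr)

theorem Fol.pull {b : ℝ} (hb : 1 < b) {Ω : ℕ → Set P} {V : ℕ → ℝ} (F : Fol b Ω V) (Θ : P → P) (S : Set P)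
    (hΘ : MeasurePreserving Θ vol (vol.restrict S)) (B : ℝ) (h1 : ∀ p q, near b 1 p q → near b B (Θ p) (Θ q)) :
    Fol b (fun n => Θ ⁻¹' (Ω n)) V where
  meas := fun n => hΘ.measurable (F.meas n)
  pos := F.pos
  le := fun n => by
    rw [hΘ.measure_preimage (F.meas n).nullMeasurableSet]
    exact (Measure.restrict_apply_le _ _).trans (F.le n)
  bdry := fun ρ => by
    obtain ⟨ρ', h⟩ := near_iter hb B ρ
    obtain ⟨E, e, he, hE⟩ := F.bdry ρ'
    refine ⟨fun n => Θ ⁻¹' E n, e, he, fun n => ?_⟩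
    obtain ⟨a1, a2, a3, a4⟩ := hE n
    refine ⟨hΘ.measurable a1, a2, ?_, fun p q hpq hne => a4 _ _ (h Θ h1 p q hpq) hne⟩
    rw [hΘ.measure_preimage a1.nullMeasurableSet]
    exact (Measure.restrict_apply_le _ _).trans a3

def qq (j : ℕ) : ℕ := (Nat.unpair j).1 + 1

/-- the set of heights of the Delone set -/
def HH : Set ℤ := {k | Even k ∨ (0 < k ∧ Even (k / (2 * (qq (Nat.log 2 k.toNat) : ℤ))))}

theorem core_false (b : ℝ) (hb : 1 < b) (B : ℕ) (hB : 1 ≤ B) (Θ Φ : P → P)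
    (hΘ : MeasurePreserving Θ vol (vol.restrict {p | p.2.2 ∈ HH})) (Φm : Measurable fun p => (Φ p).2.2)
    (Θ1 : ∀ p q, near b 1 p q → near b B (Θ p) (Θ q))
    (Θ2 : ∀ p q, near b 1 (Θ p) (Θ q) → near b B p q)
    (Φ1 : ∀ p q, near b 1 p q → near b B (Φ p) (Φ q))
    (Φ2 : ∀ p q, near b 1 (Φ p) (Φ q) → near b B p q)
    (comp : ∀ w, (Φ (Θ w)).2.2 = w.2.2) : False := by
  obtain ⟨q, hq, hS6⟩ := S6 b hb B hB
  set j : ℕ → ℕ := fun n => Nat.pair (q - 1) n with hj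
  have hjt : Tendsto j atTop atTop := tendsto_atTop_mono (fun n => Nat.right_le_pair _ _) tendsto_id
  have hqj : ∀ n, qq (j n) = q := fun n => by simp only [qq, hj, Nat.unpair_pair]; omega
  have F := box_fol hb j hjt
  have F' := F.pull hb Θ _ hΘ B Θ1
  have hDC := DC_meas HH
  refine hS6 HH Θ Φ _ _ ⟨F.isMean hb, F'.isMean hb, hΘ.measurable, Φm, Θ1, Θ2, Φ1, Φ2, comp, fun k hk => Or.inl hk, ?_⟩ ?_ ?_
  · intro S hS
    unfold mu folM
    congr 1
    ext n
    simp only [avg]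
    congr 1
    rw [setIntegral_indicator (hΘ.measurable hS), setIntegral_indicator (hDC.inter hS), setIntegral_const, setIntegral_const]
    congr 1
    rw [← preimage_inter, Measure.real, Measure.real, hΘ.measure_preimage ((F.meas n).inter hS).nullMeasurableSet,
      Measure.restrict_apply ((F.meas n).inter hS)]
    congr 2
    ext p
    simp only [mem_inter_iff]
    tauto
  · unfold folM
    apply Tendsto.limUnder_eq
    refine tendsto_const_nhds.congr fun n => ?_
    simp only [avg]
    rw [setIntegral_const, Measure.real, bΩ_vol hb, ENNReal.toReal_ofReal (F.pos n).le]
    simp [(F.pos n).ne']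
  · unfold mu folM
    apply Tendsto.limUnder_eq
    refine tendsto_const_nhds.congr fun n => ?_
    simp only [avg]
    have hXm : MeasurableSet {p : P | ¬ (p.2.2 ∈ HH ↔ p.2.2 ∈ Hq q)} := DC_meas {k | ¬ (k ∈ HH ↔ k ∈ Hq q)}
    rw [setIntegral_indicator hXm]
    have : bΩ b (j n) ∩ {p : P | ¬ (p.2.2 ∈ HH ↔ p.2.2 ∈ Hq q)} = ∅ := by
      ext p
      simp only [mem_inter_iff, mem_ofPred_eq, mem_empty_iff_false, iff_false, not_and, not_not]
      intro hp
      obtain ⟨k1, k2⟩ := hp.2.2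
      have h2j : (0 : ℤ) < 2 ^ j n := by positivity
      have hk0 : 0 < p.2.2 := by omega
      obtain ⟨m, hm⟩ := Int.eq_ofNat_of_zero_le hk0.le
      have hlog : Nat.log 2 p.2.2.toNat = j n := by
        rw [hm] at k1 k2 ⊢
        rw [Int.toNat_natCast]
        exact Nat.log_eq_of_pow_le_of_lt_pow (by exact_mod_cast k1) (by exact_mod_cast k2)
      simp only [HH, Hq, mem_ofPred_eq, hlog, hqj, hk0, true_and]
    rw [this]
    simp

end SolPf
end

section
open MeasureTheory Set Filter Topology
namespace SolPf

@[simp] theorem mul_x (g h : SOL) : (g * h).x = g.x + Real.exp g.t * h.x := rfl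
@[simp] theorem mul_y (g h : SOL) : (g * h).y = g.y + Real.exp (-g.t) * h.y := rfl
@[simp] theorem mul_t (g h : SOL) : (g * h).t = g.t + h.t := rfl
@[simp] theorem inv_x (g : SOL) : (g⁻¹).x = -(Real.exp (-g.t) * g.x) := rfl
@[simp] theorem inv_y (g : SOL) : (g⁻¹).y = -(Real.exp g.t * g.y) := rfl
@[simp] theorem inv_t (g : SOL) : (g⁻¹).t = -g.t := rfl
@[simp] theorem one_x : (1 : SOL).x = 0 := rfl
@[simp] theorem one_y : (1 : SOL).y = 0 := rfl
@[simp] theorem one_t : (1 : SOL).t = 0 := rfl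

def Box (R : ℝ) : Set SOL := {g | |g.x| ≤ R ∧ |g.y| ≤ R ∧ |g.t| ≤ R}

theorem Box_nonneg {R : ℝ} {g : SOL} (h : g ∈ Box R) : 0 ≤ R := (abs_nonneg _).trans h.1

theorem Box_mono {R R' : ℝ} (h : R ≤ R') : Box R ⊆ Box R' := fun _ hg => ⟨hg.1.trans h, hg.2.1.trans h, hg.2.2.trans h⟩

theorem Box_mul (R R' : ℝ) : ∃ R'', ∀ g ∈ Box R, ∀ h ∈ Box R', g * h ∈ Box R'' := by
  refine ⟨R + Real.exp R * R', fun g hg h hh => ?_⟩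
  have hR' := Box_nonneg hh
  obtain ⟨a1, a2, a3⟩ := hg
  obtain ⟨c1, c2, c3⟩ := hh
  have e1 : Real.exp g.t ≤ Real.exp R := Real.exp_le_exp.2 ((le_abs_self _).trans a3)
  have e2 : Real.exp (-g.t) ≤ Real.exp R := Real.exp_le_exp.2 ((neg_le_abs _).trans a3)
  have e3 : 1 ≤ Real.exp R := Real.one_le_exp ((abs_nonneg _).trans a3)
  refine ⟨?_, ?_, ?_⟩
  · rw [mul_x]
    refine (abs_add_le _ _).trans (add_le_add a1 ?_)
    rw [abs_mul, abs_of_pos (Real.exp_pos _)]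
    exact mul_le_mul e1 c1 (abs_nonneg _) (Real.exp_pos _).le
  · rw [mul_y]
    refine (abs_add_le _ _).trans (add_le_add a2 ?_)
    rw [abs_mul, abs_of_pos (Real.exp_pos _)]
    exact mul_le_mul e2 c2 (abs_nonneg _) (Real.exp_pos _).le
  · rw [mul_t]
    refine (abs_add_le _ _).trans (add_le_add a3 ?_)
    nlinarith

theorem Box_inv (R : ℝ) : ∃ R', ∀ g ∈ Box R, g⁻¹ ∈ Box R' := by
  refine ⟨Real.exp R * R, fun g hg => ?_⟩
  have hR' := Box_nonneg hg
  obtain ⟨a1, a2, a3⟩ := hg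
  have e1 : Real.exp g.t ≤ Real.exp R := Real.exp_le_exp.2 ((le_abs_self _).trans a3)
  have e2 : Real.exp (-g.t) ≤ Real.exp R := Real.exp_le_exp.2 ((neg_le_abs _).trans a3)
  have e3 : 1 ≤ Real.exp R := Real.one_le_exp ((abs_nonneg _).trans a3)
  refine ⟨?_, ?_, ?_⟩
  · rw [inv_x, abs_neg, abs_mul, abs_of_pos (Real.exp_pos _)]
    exact mul_le_mul e2 a1 (abs_nonneg _) (Real.exp_pos _).le
  · rw [inv_y, abs_neg, abs_mul, abs_of_pos (Real.exp_pos _)]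
    exact mul_le_mul e1 a2 (abs_nonneg _) (Real.exp_pos _).le
  · rw [inv_t, abs_neg]
    nlinarith

theorem Box_mem (g : SOL) : ∃ R, g ∈ Box R :=
  ⟨max |g.x| (max |g.y| |g.t|), by simp [Box]⟩

theorem Box_finite {s : Set SOL} (hs : s.Finite) : ∃ R, s ⊆ Box R := by
  induction s, hs using Set.Finite.induction_on with
  | empty => exact ⟨0, empty_subset _⟩
  | @insert a s _ _ ih =>
    obtain ⟨R, hR⟩ := ih
    obtain ⟨R', hR'⟩ := Box_mem a
    exact ⟨max R R', insert_subset (Box_mono (le_max_right _ _) hR') (hR.trans (Box_mono (le_max_left _ _)))⟩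

theorem sol_cont : Continuous (fun g : SOL => (g.x, g.y, g.t)) := continuous_induced_dom

theorem Box_compact {C : Set SOL} (hC : IsCompact C) : ∃ R, C ⊆ Box R := by
  have h := (hC.image sol_cont).isBounded
  obtain ⟨R, hR⟩ := h.exists_norm_le
  refine ⟨R, fun g hg => ?_⟩
  have := hR _ (mem_image_of_mem _ hg)
  simp only [Prod.norm_def, Real.norm_eq_abs, max_le_iff] at this
  exact this

/-- discreteness at an element, metrically -/
theorem disc_metric (Γ : Subgroup SOL) (hd : ∀ γ ∈ Γ, ∃ U : Set SOL, IsOpen U ∧ U ∩ (Γ : Set SOL) = {γ}) (γ : SOL) (hγ : γ ∈ Γ) :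
    ∃ ε > 0, ∀ g ∈ Γ, |g.x - γ.x| < ε → |g.y - γ.y| < ε → |g.t - γ.t| < ε → g = γ := by
  obtain ⟨U, hU, hUΓ⟩ := hd γ hγ
  obtain ⟨V, hV, rfl⟩ := isOpen_induced_iff.1 hU
  have hm : γ ∈ (fun g : SOL => (g.x, g.y, g.t)) ⁻¹' V := by
    have : γ ∈ ({γ} : Set SOL) := rfl
    rw [← hUΓ] at this
    exact this.1
  obtain ⟨ε, hε, hb⟩ := Metric.isOpen_iff.1 hV _ hm
  refine ⟨ε, hε, fun g hg h1 h2 h3 => ?_⟩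
  have : g ∈ ({γ} : Set SOL) := by
    rw [← hUΓ]
    refine ⟨hb ?_, hg⟩
    simp only [Metric.mem_ball, Prod.dist_eq, Real.dist_eq, max_lt_iff]
    exact ⟨h1, h2, h3⟩
  exact this

theorem fin_Box (Γ : Subgroup SOL) (hd : ∀ γ ∈ Γ, ∃ U : Set SOL, IsOpen U ∧ U ∩ (Γ : Set SOL) = {γ}) (R : ℝ) :
    ((Γ : Set SOL) ∩ Box R).Finite := by
  obtain ⟨ε, hε, h1⟩ := disc_metric Γ hd 1 Γ.one_mem
  set η := ε / Real.exp |R| with hη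
  have hη0 : 0 < η := div_pos hε (Real.exp_pos _)
  have hηe : η * Real.exp |R| = ε := div_mul_cancel₀ _ (Real.exp_pos _).ne'
  have he1 : 1 ≤ Real.exp |R| := Real.one_le_exp (abs_nonneg _)
  set φ : SOL → ℤ × ℤ × ℤ := fun g => (⌊g.x / η⌋, ⌊g.y / η⌋, ⌊g.t / η⌋) with hφ
  have hmaps : MapsTo φ ((Γ : Set SOL) ∩ Box R) (Icc ⌊-R / η⌋ ⌊R / η⌋ ×ˢ Icc ⌊-R / η⌋ ⌊R / η⌋ ×ˢ Icc ⌊-R / η⌋ ⌊R / η⌋) := by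
    rintro g ⟨-, a1, a2, a3⟩
    rw [abs_le] at a1 a2 a3
    refine ⟨⟨?_, ?_⟩, ⟨?_, ?_⟩, ⟨?_, ?_⟩⟩ <;> apply Int.floor_le_floor <;> gcongr <;> linarith
  refine Set.Finite.of_injOn hmaps ?_ ((finite_Icc _ _).prod ((finite_Icc _ _).prod (finite_Icc _ _)))
  rintro g ⟨hg, hgB⟩ g' ⟨hg', -⟩ heq
  simp only [hφ, Prod.mk.injEq] at heq
  obtain ⟨e1, e2, e3⟩ := heq
  have key : ∀ u v : ℝ, ⌊u / η⌋ = ⌊v / η⌋ → |v - u| < η := by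
    intro u v h
    have := Int.abs_sub_lt_one_of_floor_eq_floor h.symm
    rw [← sub_div, abs_div, abs_of_pos hη0, div_lt_one hη0] at this
    exact this
  have k1 := key _ _ e1
  have k2 := key _ _ e2
  have k3 := key _ _ e3
  have t1 : Real.exp g.t ≤ Real.exp |R| := Real.exp_le_exp.2 ((le_abs_self _).trans (hgB.2.2.trans (le_abs_self _)))
  have t2 : Real.exp (-g.t) ≤ Real.exp |R| := Real.exp_le_exp.2 ((neg_le_abs _).trans (hgB.2.2.trans (le_abs_self _)))
  have : g⁻¹ * g' = 1 := by
    refine h1 _ (Γ.mul_mem (Γ.inv_mem hg) hg') ?_ ?_ ?_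
    · rw [mul_x, inv_x, inv_t, one_x, sub_zero, show -(Real.exp (-g.t) * g.x) + Real.exp (-g.t) * g'.x = (g'.x - g.x) * Real.exp (-g.t) by ring,
        abs_mul, abs_of_pos (Real.exp_pos _), ← hηe]
      exact mul_lt_mul k1 t2 (Real.exp_pos _) hη0.le
    · rw [mul_y, inv_y, inv_t, one_y, sub_zero, neg_neg, show -(Real.exp (g.t) * g.y) + Real.exp (g.t) * g'.y = (g'.y - g.y) * Real.exp (g.t) by ring,
        abs_mul, abs_of_pos (Real.exp_pos _), ← hηe]
      exact mul_lt_mul k2 t1 (Real.exp_pos _) hη0.le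
    · rw [mul_t, inv_t, one_t, sub_zero, show -g.t + g'.t = g'.t - g.t by ring, ← hηe]
      nlinarith
  rw [inv_mul_eq_one] at this
  exact this

structure Lat (Γ : Subgroup SOL) (τ : ℝ) : Prop where
  pos : 0 < τ
  ht : ∀ γ ∈ Γ, ∃ k : ℤ, γ.t = k * τ
  gen : ∃ g ∈ Γ, g.t = τ
  fin : ∀ R, ((Γ : Set SOL) ∩ Box R).Finite
  coc : ∃ R, ∀ g : SOL, ∃ γ ∈ Γ, γ⁻¹ * g ∈ Box R

theorem exists_lat (Γ : Subgroup SOL)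
    (hd : ∀ γ ∈ Γ, ∃ U : Set SOL, IsOpen U ∧ U ∩ (Γ : Set SOL) = {γ})
    (hc : ∃ C : Set SOL, IsCompact C ∧ ∀ g : SOL, ∃ γ ∈ Γ, ∃ c ∈ C, g = γ * c) : ∃ τ, Lat Γ τ := by
  have coc : ∃ R, ∀ g : SOL, ∃ γ ∈ Γ, γ⁻¹ * g ∈ Box R := by
    obtain ⟨C, hC, h⟩ := hc
    obtain ⟨R, hR⟩ := Box_compact hC
    refine ⟨R, fun g => ?_⟩
    obtain ⟨γ, hγ, c, hcC, rfl⟩ := h g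
    exact ⟨γ, hγ, by rw [inv_mul_cancel_left]; exact hR hcC⟩
  obtain ⟨R, hR⟩ := coc
  -- an element of nonzero height
  have h0 : ∃ γ ∈ Γ, γ.t ≠ 0 := by
    obtain ⟨γ, hγ, hB⟩ := hR ⟨0, 0, |R| + 1⟩
    refine ⟨γ, hγ, fun h => ?_⟩
    have := hB.2.2
    rw [mul_t, inv_t, h, neg_zero, zero_add] at this
    have h5 := (le_abs_self _).trans this
    have := le_abs_self R
    simp only at h5
    linarith
  obtain ⟨γ0, hγ0, ht0⟩ := h0
  -- a nontrivial horizontal element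
  have hN : ∃ n ∈ Γ, n.t = 0 ∧ n ≠ 1 := by
    by_contra hcon
    push Not at hcon
    have hcomm : ∀ γ ∈ Γ, γ * γ0 = γ0 * γ := by
      intro γ hγ
      have := hcon (γ * γ0 * γ⁻¹ * γ0⁻¹) (Γ.mul_mem (Γ.mul_mem (Γ.mul_mem hγ hγ0) (Γ.inv_mem hγ)) (Γ.inv_mem hγ0)) (by simp)
      rw [mul_inv_eq_one, mul_inv_eq_iff_eq_mul] at this
      exact this
    have he : Real.exp γ0.t - 1 ≠ 0 := by
      intro h; apply ht0; rw [← Real.exp_eq_one_iff]; linarith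
    have hx : ∀ γ ∈ Γ, γ.x = γ0.x / (Real.exp γ0.t - 1) * (Real.exp γ.t - 1) := by
      intro γ hγ
      have := congrArg SOL.x (hcomm γ hγ)
      simp only [mul_x] at this
      field_simp
      linarith
    set X : ℝ := |γ0.x / (Real.exp γ0.t - 1)| * (Real.exp R + 1) + Real.exp R * |R| + 1 with hX
    obtain ⟨γ, hγ, hB⟩ := hR ⟨X, 0, 0⟩
    obtain ⟨b1, -, b3⟩ := hB
    simp only [mul_x, mul_t, inv_x, inv_t, add_zero, abs_neg] at b1 b3
    have t1 : Real.exp γ.t ≤ Real.exp R := Real.exp_le_exp.2 ((le_abs_self _).trans b3)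
    have b2 : |X - γ.x| ≤ Real.exp R * |R| := by
      have : X - γ.x = Real.exp γ.t * (-(Real.exp (-γ.t) * γ.x) + Real.exp (-γ.t) * X) := by
        have := Real.exp_ne_zero γ.t
        rw [Real.exp_neg]; field_simp; ring
      rw [this, abs_mul, abs_of_pos (Real.exp_pos _)]
      exact mul_le_mul t1 (b1.trans (le_abs_self _)) (abs_nonneg _) (Real.exp_pos _).le
    have b4 : |γ.x| ≤ |γ0.x / (Real.exp γ0.t - 1)| * (Real.exp R + 1) := by
      rw [hx γ hγ, abs_mul]
      gcongr
      rw [abs_le]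
      constructor <;> linarith [Real.exp_pos γ.t, Real.exp_pos R]
    have := (abs_le.1 b2).2
    have := (abs_le.1 b4).2
    linarith
  obtain ⟨n, hn, hnt, hn1⟩ := hN
  let T : AddSubgroup ℝ := 
    { carrier := {t | ∃ γ ∈ Γ, γ.t = t}
      zero_mem' := ⟨1, Γ.one_mem, rfl⟩
      add_mem' := by
        rintro _ _ ⟨γ, h, rfl⟩ ⟨γ', h', rfl⟩
        exact ⟨γ * γ', Γ.mul_mem h h', rfl⟩
      neg_mem' := by
        rintro _ ⟨γ, h, rfl⟩
        exact ⟨γ⁻¹, Γ.inv_mem h, rfl⟩ }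
  rcases AddSubgroup.dense_or_cyclic T with hT | ⟨a, ha⟩
  · exfalso
    obtain ⟨ε, hε, h1⟩ := disc_metric Γ hd n hn
    have c1 : Tendsto (fun t : ℝ => |Real.exp t * n.x - n.x|) (𝓝 0) (𝓝 0) := by
      have : Continuous (fun t : ℝ => |Real.exp t * n.x - n.x|) := by fun_prop
      simpa using this.tendsto 0
    have c2 : Tendsto (fun t : ℝ => |Real.exp (-t) * n.y - n.y|) (𝓝 0) (𝓝 0) := by
      have : Continuous (fun t : ℝ => |Real.exp (-t) * n.y - n.y|) := by fun_prop
      simpa using this.tendsto 0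
    have hev := (c1.eventually_lt_const hε).and (c2.eventually_lt_const hε)
    obtain ⟨δ, hδ, hball⟩ := Metric.eventually_nhds_iff.1 hev
    obtain ⟨t, ⟨γ, hγ, rfl⟩, ht1, ht2⟩ := hT.exists_mem_open isOpen_Ioo (nonempty_Ioo.2 hδ)
    obtain ⟨d1, d2⟩ := @hball γ.t (by rw [Real.dist_eq, sub_zero, abs_of_pos ht1]; exact ht2)
    have heq := h1 (γ * n * γ⁻¹) (Γ.mul_mem (Γ.mul_mem hγ hn) (Γ.inv_mem hγ)) (by
      simp only [mul_x, mul_t, inv_x, hnt, add_zero, Real.exp_neg]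
      have := Real.exp_ne_zero γ.t
      rw [show γ.x + Real.exp γ.t * n.x + Real.exp γ.t * -((Real.exp γ.t)⁻¹ * γ.x) - n.x = Real.exp γ.t * n.x - n.x by field_simp; ring]
      exact d1) (by
      simp only [mul_y, mul_t, inv_y, hnt, add_zero]
      have := Real.exp_ne_zero γ.t
      rw [Real.exp_neg] at d2 ⊢
      rw [show γ.y + (Real.exp γ.t)⁻¹ * n.y + (Real.exp γ.t)⁻¹ * -((Real.exp γ.t) * γ.y) - n.y = (Real.exp γ.t)⁻¹ * n.y - n.y by field_simp; ring]
      exact d2) (by simp [hnt, hε])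
    rw [mul_inv_eq_iff_eq_mul] at heq
    have x1 := congrArg SOL.x heq
    have y1 := congrArg SOL.y heq
    simp only [mul_x, mul_y, hnt, Real.exp_zero, neg_zero, one_mul] at x1 y1
    have e1 : 1 < Real.exp γ.t := Real.one_lt_exp_iff.2 ht1
    have e2 : Real.exp (-γ.t) < 1 := by rw [Real.exp_lt_one_iff]; linarith
    apply hn1
    ext
    · simp only [one_x]
      have : (Real.exp γ.t - 1) * n.x = 0 := by linarith
      exact (mul_eq_zero.1 this).resolve_left (by linarith)
    · simp only [one_y]
      have : (Real.exp (-γ.t) - 1) * n.y = 0 := by linarith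
      exact (mul_eq_zero.1 this).resolve_left (by linarith)
    · exact hnt
  · have hmem : ∀ γ ∈ Γ, ∃ k : ℤ, γ.t = k * a := by
      intro γ hγ
      have : γ.t ∈ T := ⟨γ, hγ, rfl⟩
      rw [ha, AddSubgroup.mem_closure_singleton] at this
      obtain ⟨k, hk⟩ := this
      exact ⟨k, by rw [← hk, zsmul_eq_mul]⟩
    have haT : ∃ g ∈ Γ, g.t = a := by
      have : a ∈ T := by rw [ha]; exact AddSubgroup.mem_closure_singleton_self a
      exact this
    obtain ⟨g, hg, hga⟩ := haT
    have ha0 : a ≠ 0 := by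
      rintro rfl
      obtain ⟨k, hk⟩ := hmem γ0 hγ0
      exact ht0 (by simpa using hk)
    rcases lt_or_gt_of_ne ha0 with h | h
    · refine ⟨-a, by linarith, fun γ hγ => ?_, ⟨g⁻¹, Γ.inv_mem hg, by simp [hga]⟩, fin_Box Γ hd, ⟨R, hR⟩⟩
      obtain ⟨k, hk⟩ := hmem γ hγ
      exact ⟨-k, by rw [hk]; push_cast; ring⟩
    · exact ⟨a, h, hmem, ⟨g, hg, hga⟩, fin_Box Γ hd, ⟨R, hR⟩⟩

end SolPf
end

section
open MeasureTheory Set Filter Topology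
namespace SolPf

/-- the embedding of `P` in SOL -/
noncomputable def io (τ : ℝ) (p : P) : SOL := ⟨p.1, p.2.1, p.2.2 * τ⟩
noncomputable def hz (τ : ℝ) (g : SOL) : ℤ := round (g.t / τ)
noncomputable def toP (τ : ℝ) (g : SOL) : P := (g.x, g.y, hz τ g)
noncomputable def act (τ : ℝ) (g : SOL) (p : P) : P :=
  (g.x + Real.exp g.t * p.1, g.y + Real.exp (-g.t) * p.2.1, p.2.2 + hz τ g)

theorem hz_of {τ : ℝ} (hτ : 0 < τ) {g : SOL} {k : ℤ} (h : g.t = k * τ) : hz τ g = k := by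
  rw [hz, h, mul_div_assoc, div_self hτ.ne', mul_one, round_intCast]

theorem hz_io {τ : ℝ} (hτ : 0 < τ) (p : P) : hz τ (io τ p) = p.2.2 := hz_of hτ rfl

theorem toP_io {τ : ℝ} (hτ : 0 < τ) (p : P) : toP τ (io τ p) = p := by
  simp only [toP, hz_io hτ]; rfl

theorem io_inj {τ : ℝ} (hτ : 0 < τ) {p q : P} (h : io τ p = io τ q) : p = q := by
  rw [← toP_io hτ p, h, toP_io hτ]

theorem rexp_zpow (τ : ℝ) (k : ℤ) : Real.exp τ ^ k = Real.exp (k * τ) := by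
  rw [mul_comm, Real.exp_mul, Real.rpow_intCast]

theorem count_map_add (m : ℤ) : Measure.map (fun k : ℤ => k + m) Measure.count = Measure.count := by
  ext s hs
  rw [Measure.map_apply (by fun_prop) hs, Measure.count_apply hs, Measure.count_apply (by exact MeasurableSet.of_discrete)]
  congr 1
  have : (fun k : ℤ => k + m) ⁻¹' s = (fun k : ℤ => k - m) '' s := by
    ext k
    simp only [mem_preimage, mem_image]
    exact ⟨fun h => ⟨_, h, by ring⟩, by rintro ⟨j, hj, rfl⟩; simpa using hj⟩
  rw [this, Function.Injective.encard_image (sub_left_injective)]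

namespace Lat
variable {Γ : Subgroup SOL} {τ : ℝ} (L : Lat Γ τ)
include L

theorem t_eq {g : SOL} (hg : g ∈ Γ) : g.t = hz τ g * τ := by
  obtain ⟨k, hk⟩ := L.ht g hg
  rw [hz_of L.pos hk, hk]

theorem io_toP {g : SOL} (hg : g ∈ Γ) : io τ (toP τ g) = g := by
  ext
  · rfl
  · rfl
  · exact (L.t_eq hg).symm

theorem io_act {g : SOL} (hg : g ∈ Γ) (p : P) : io τ (act τ g p) = g * io τ p := by
  ext
  · rfl
  · rfl
  · simp only [io, act, mul_t]
    rw [L.t_eq hg]; push_cast; ring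

theorem act_act {g h : SOL} (hg : g ∈ Γ) (hh : h ∈ Γ) (p : P) : act τ g (act τ h p) = act τ (g * h) p := by
  apply io_inj L.pos
  rw [L.io_act hg, L.io_act hh, L.io_act (Γ.mul_mem hg hh), mul_assoc]

theorem act_one (p : P) : act τ 1 p = p := by
  apply io_inj L.pos
  rw [L.io_act Γ.one_mem, one_mul]

theorem hz_mul {g h : SOL} (hg : g ∈ Γ) (hh : h ∈ Γ) : hz τ (g * h) = hz τ g + hz τ h := by
  apply hz_of L.pos
  rw [mul_t, L.t_eq hg, L.t_eq hh]; push_cast; ring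

theorem hz_inv {g : SOL} (hg : g ∈ Γ) : hz τ g⁻¹ = - hz τ g := by
  apply hz_of L.pos
  rw [inv_t, L.t_eq hg]; push_cast; ring

theorem countable : (Γ : Set SOL).Countable := by
  have : (Γ : Set SOL) ⊆ ⋃ n : ℕ, ((Γ : Set SOL) ∩ Box n) := by
    intro g hg
    obtain ⟨R, hR⟩ := Box_mem g
    obtain ⟨n, hn⟩ := exists_nat_ge R
    exact mem_iUnion.2 ⟨n, hg, Box_mono hn hR⟩
  exact Set.Countable.mono this (Set.countable_iUnion fun n : ℕ => (L.fin n).countable)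

theorem near_of_Box (R : ℝ) : ∃ ρ, ∀ p q : P, (io τ p)⁻¹ * io τ q ∈ Box R → near (Real.exp τ) ρ p q := by
  have hτ := L.pos
  refine ⟨max R (R / τ), fun p q h => ?_⟩
  have hR := Box_nonneg h
  obtain ⟨h1, h2, h3⟩ := h
  simp only [io, mul_x, mul_y, mul_t, inv_x, inv_y, inv_t] at h1 h2 h3
  refine ⟨?_, ?_, ?_⟩
  · rw [rexp_zpow]
    rw [show -(Real.exp (-(p.2.2 * τ)) * p.1) + Real.exp (-(p.2.2 * τ)) * q.1 = (q.1 - p.1) / Real.exp (p.2.2 * τ) by rw [Real.exp_neg]; field_simp; ring,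
      abs_div, abs_of_pos (Real.exp_pos _), div_le_iff₀ (Real.exp_pos _)] at h1
    exact h1.trans (mul_le_mul_of_nonneg_right (le_max_left _ _) (Real.exp_pos _).le)
  · rw [rexp_zpow]
    rw [neg_neg, show -(Real.exp ((p.2.2 * τ)) * p.2.1) + Real.exp ((p.2.2 * τ)) * q.2.1 = (q.2.1 - p.2.1) / Real.exp (((-p.2.2 : ℤ) : ℝ) * τ) by push_cast; rw [neg_mul, Real.exp_neg]; field_simp; ring,
      abs_div, abs_of_pos (Real.exp_pos _), div_le_iff₀ (Real.exp_pos _)] at h2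
    exact h2.trans (mul_le_mul_of_nonneg_right (le_max_left _ _) (Real.exp_pos _).le)
  · rw [show -(p.2.2 * τ) + q.2.2 * τ = ((q.2.2 : ℝ) - p.2.2) * τ by ring, abs_mul, abs_of_pos hτ, ← le_div_iff₀ hτ] at h3
    exact h3.trans (le_max_right _ _)

theorem Box_of_near (ρ : ℝ) : ∃ R, ∀ p q : P, near (Real.exp τ) ρ p q → (io τ p)⁻¹ * io τ q ∈ Box R := by
  have hτ := L.pos
  refine ⟨max ρ (ρ * τ), fun p q h => ?_⟩
  obtain ⟨h1, h2, h3⟩ := h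
  rw [rexp_zpow] at h1 h2
  refine ⟨?_, ?_, ?_⟩ <;> simp only [io, mul_x, mul_y, mul_t, inv_x, inv_y, inv_t]
  · rw [show -(Real.exp (-(p.2.2 * τ)) * p.1) + Real.exp (-(p.2.2 * τ)) * q.1 = (q.1 - p.1) / Real.exp (p.2.2 * τ) by rw [Real.exp_neg]; field_simp; ring,
      abs_div, abs_of_pos (Real.exp_pos _), div_le_iff₀ (Real.exp_pos _)]
    exact h1.trans (mul_le_mul_of_nonneg_right (le_max_left _ _) (Real.exp_pos _).le)
  · rw [neg_neg, show -(Real.exp ((p.2.2 * τ)) * p.2.1) + Real.exp ((p.2.2 * τ)) * q.2.1 = (q.2.1 - p.2.1) / Real.exp (((-p.2.2 : ℤ) : ℝ) * τ) by push_cast; rw [neg_mul, Real.exp_neg]; field_simp; ring,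
      abs_div, abs_of_pos (Real.exp_pos _), div_le_iff₀ (Real.exp_pos _)]
    exact h2.trans (mul_le_mul_of_nonneg_right (le_max_left _ _) (Real.exp_pos _).le)
  · rw [show -(p.2.2 * τ) + q.2.2 * τ = ((q.2.2 : ℝ) - p.2.2) * τ by ring, abs_mul, abs_of_pos hτ]
    exact (mul_le_mul_of_nonneg_right h3 hτ.le).trans (le_max_right _ _)

theorem cover : ∃ R, ∀ p : P, ∃ γ ∈ Γ, hz τ γ = p.2.2 ∧ γ⁻¹ * io τ p ∈ Box R := by
  have hτ := L.pos
  obtain ⟨R, hR⟩ := L.coc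
  obtain ⟨g, hg, hgt⟩ := L.gen
  have hz1 : hz τ g = 1 := hz_of hτ (by rw [hgt]; simp)
  have hzp : ∀ m : ℤ, hz τ (g ^ m) = m := by
    intro m
    induction m using Int.induction_on with
    | zero => rw [zpow_zero]; exact hz_of hτ (by simp)
    | succ i ih => rw [zpow_add_one, L.hz_mul (Γ.zpow_mem hg _) hg, ih, hz1]
    | pred i ih => rw [zpow_sub_one, L.hz_mul (Γ.zpow_mem hg _) (Γ.inv_mem hg), ih, L.hz_inv hg, hz1]; ring
  set N := ⌈R / τ⌉ with hN
  have hfin : ((fun m : ℤ => (g ^ m)⁻¹) '' Icc (-N) N).Finite := (finite_Icc _ _).image _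
  obtain ⟨R1, hR1⟩ := Box_finite hfin
  obtain ⟨R2, hR2⟩ := Box_mul R1 R
  refine ⟨R2, fun p => ?_⟩
  obtain ⟨γ, hγ, hB⟩ := hR (io τ p)
  refine ⟨γ * g ^ (p.2.2 - hz τ γ), Γ.mul_mem hγ (Γ.zpow_mem hg _), by rw [L.hz_mul hγ (Γ.zpow_mem hg _), hzp]; ring, ?_⟩
  rw [mul_inv_rev, mul_assoc]
  refine hR2 _ (hR1 ⟨_, ?_, rfl⟩) _ hB
  have := hB.2.2
  rw [mul_t, inv_t, L.t_eq hγ] at this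
  simp only [io] at this
  rw [show -(hz τ γ * τ) + p.2.2 * τ = ((p.2.2 - hz τ γ : ℤ) : ℝ) * τ by push_cast; ring, abs_mul, abs_of_pos hτ, ← le_div_iff₀ hτ] at this
  have h5 := this.trans (Int.le_ceil (R / τ))
  have h6 : |p.2.2 - hz τ γ| ≤ N := by exact_mod_cast h5
  exact abs_le.1 h6

end Lat

theorem act_meas (τ : ℝ) (g : SOL) : Measurable (act τ g) := by
  unfold act
  fun_prop

theorem aff_map (c a : ℝ) (ha : 0 < a) : Measure.map (fun x : ℝ => c + a * x) volume = ENNReal.ofReal a⁻¹ • volume := by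
  have : (fun x : ℝ => c + a * x) = (fun x => c + x) ∘ (fun x => a * x) := rfl
  rw [this, ← Measure.map_map (by fun_prop) (by fun_prop), Real.map_volume_mul_left ha.ne', Measure.map_smul,
    (measurePreserving_add_left volume c).map_eq, abs_of_pos (inv_pos.2 ha)]

theorem act_mp (τ : ℝ) (g : SOL) : MeasurePreserving (act τ g) vol vol := by
  refine ⟨act_meas τ g, ?_⟩
  have e : act τ g = Prod.map (fun x : ℝ => g.x + Real.exp g.t * x) (Prod.map (fun y : ℝ => g.y + Real.exp (-g.t) * y) (fun k : ℤ => k + hz τ g)) := rfl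
  have hc : Measure.map (fun k : ℤ => k + hz τ g) Measure.count = Measure.count := count_map_add _
  rw [e, vol]
  have s1 : SFinite (Measure.map (fun x : ℝ => g.x + Real.exp g.t * x) volume) := by infer_instance
  rw [← Measure.map_prod_map _ _ (by fun_prop) (by fun_prop), ← Measure.map_prod_map _ _ (by fun_prop) (by fun_prop), hc,
    aff_map _ _ (Real.exp_pos _), aff_map _ _ (Real.exp_pos _)]
  rw [Measure.prod_smul_left, Measure.prod_smul_left, Measure.prod_smul_right, smul_smul, ← ENNReal.ofReal_mul (inv_pos.2 (Real.exp_pos _)).le,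
    ← Real.exp_neg, ← Real.exp_neg, ← Real.exp_add]
  simp

end SolPf
end

section
open MeasureTheory Set Filter Topology
namespace SolPf

noncomputable def key (τ : ℝ) (p : P) (γ : SOL) : ℝ ×ₗ ℝ := toLex ((γ⁻¹ * io τ p).x, (γ⁻¹ * io τ p).y)

def Cnd (Γ : Subgroup SOL) (τ R : ℝ) (p : P) : Set SOL := {γ | γ ∈ Γ ∧ hz τ γ = p.2.2 ∧ γ⁻¹ * io τ p ∈ Box R}

def Mn (Γ : Subgroup SOL) (τ R : ℝ) (p : P) (γ : SOL) : Prop :=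
  γ ∈ Cnd Γ τ R p ∧ ∀ γ' ∈ Cnd Γ τ R p, key τ p γ ≤ key τ p γ'

structure Cell (Γ : Subgroup SOL) (τ R : ℝ) (π : P → SOL) : Prop where
  mem : ∀ p, π p ∈ Γ
  hzp : ∀ p, hz τ (π p) = p.2.2
  box : ∀ p, (π p)⁻¹ * io τ p ∈ Box R
  equiv : ∀ γ ∈ Γ, ∀ p, π (act τ γ p) = γ * π p
  meas : ∀ γ, MeasurableSet {p | π p = γ}

theorem meas_x (τ : ℝ) (γ : SOL) : Measurable fun p : P => (γ⁻¹ * io τ p).x := by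
  simp only [mul_x, io]; fun_prop
theorem meas_y (τ : ℝ) (γ : SOL) : Measurable fun p : P => (γ⁻¹ * io τ p).y := by
  simp only [mul_y, io]; fun_prop
theorem meas_t (τ : ℝ) (γ : SOL) : Measurable fun p : P => (γ⁻¹ * io τ p).t := by
  simp only [mul_t, io]; fun_prop

namespace Lat
variable {Γ : Subgroup SOL} {τ : ℝ} (L : Lat Γ τ)
include L

theorem Cnd_fin (R : ℝ) (p : P) : (Cnd Γ τ R p).Finite := by
  obtain ⟨R1, h1⟩ := Box_inv R
  obtain ⟨R2, h2⟩ := Box_mem (io τ p)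
  obtain ⟨R3, h3⟩ := Box_mul R2 R1
  refine (L.fin R3).subset fun γ hγ => ⟨hγ.1, ?_⟩
  have := h3 _ h2 _ (h1 _ hγ.2.2)
  simpa using this

theorem key_inj {R : ℝ} {p : P} {γ γ' : SOL} (h : γ ∈ Cnd Γ τ R p) (h' : γ' ∈ Cnd Γ τ R p) (hk : key τ p γ = key τ p γ') : γ = γ' := by
  have hk' := toLex_inj.1 hk
  rw [Prod.mk.injEq] at hk'
  have : γ⁻¹ * io τ p = γ'⁻¹ * io τ p := by
    ext
    · exact hk'.1
    · exact hk'.2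
    · rw [mul_t, mul_t, inv_t, inv_t, L.t_eq h.1, L.t_eq h'.1, h.2.1, h'.2.1]
  simpa using this

theorem Cnd_act (R : ℝ) {g : SOL} (hg : g ∈ Γ) (p : P) (γ : SOL) : γ ∈ Cnd Γ τ R p ↔ g * γ ∈ Cnd Γ τ R (act τ g p) := by
  have e : (g * γ)⁻¹ * io τ (act τ g p) = γ⁻¹ * io τ p := by rw [L.io_act hg]; group
  have hm : g * γ ∈ Γ ↔ γ ∈ Γ := Γ.mul_mem_cancel_left hg
  simp only [Cnd, mem_ofPred_eq, e, hm]
  refine and_congr_right fun hγ => and_congr_left fun _ => ?_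
  rw [L.hz_mul hg hγ]
  simp only [act]
  omega

theorem key_act {g : SOL} (hg : g ∈ Γ) (p : P) (γ : SOL) : key τ (act τ g p) (g * γ) = key τ p γ := by
  have e : (g * γ)⁻¹ * io τ (act τ g p) = γ⁻¹ * io τ p := by rw [L.io_act hg]; group
  simp only [key, e]

theorem exists_cell : ∃ R π, Cell Γ τ R π := by
  obtain ⟨R, hR⟩ := L.cover
  have ex : ∀ p, ∃ γ, Mn Γ τ R p γ := by
    intro p
    obtain ⟨γ, hγ⟩ := hR p
    obtain ⟨a, ha, h⟩ := Set.exists_min_image (Cnd Γ τ R p) (key τ p) (L.Cnd_fin R p) ⟨γ, hγ⟩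
    exact ⟨a, ha, h⟩
  have uniq : ∀ p γ γ', Mn Γ τ R p γ → Mn Γ τ R p γ' → γ = γ' := fun p γ γ' h h' =>
    L.key_inj h.1 h'.1 (le_antisymm (h.2 _ h'.1) (h'.2 _ h.1))
  choose π hπ using ex
  refine ⟨R, π, fun p => (hπ p).1.1, fun p => (hπ p).1.2.1, fun p => (hπ p).1.2.2, fun g hg p => ?_, fun γ => ?_⟩
  · refine uniq _ _ _ (hπ _) ⟨(L.Cnd_act R hg _ _).1 (hπ p).1, fun γ' h' => ?_⟩
    rw [show γ' = g * (g⁻¹ * γ') by group] at h' ⊢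
    rw [← L.Cnd_act R hg] at h'
    rw [L.key_act hg, L.key_act hg]
    exact (hπ p).2 _ h'
  · have hC : ∀ γ, MeasurableSet {p | γ ∈ Cnd Γ τ R p} := by
      intro γ
      by_cases hγ : γ ∈ Γ
      · have : {p | γ ∈ Cnd Γ τ R p} = {p : P | p.2.2 ∈ ({hz τ γ} : Set ℤ)} ∩ ({p | |(γ⁻¹ * io τ p).x| ≤ R} ∩ ({p | |(γ⁻¹ * io τ p).y| ≤ R} ∩ {p | |(γ⁻¹ * io τ p).t| ≤ R})) := by
          ext p
          simp only [Cnd, Box, mem_ofPred_eq, mem_inter_iff, hγ, true_and, mem_singleton_iff, eq_comm]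
        rw [this]
        refine (DC_meas _).inter ((measurableSet_le ?_ measurable_const).inter ((measurableSet_le ?_ measurable_const).inter (measurableSet_le ?_ measurable_const)))
        · exact (meas_x τ γ).abs
        · exact (meas_y τ γ).abs
        · exact (meas_t τ γ).abs
      · have : {p | γ ∈ Cnd Γ τ R p} = ∅ := by
          ext p; simp [Cnd, hγ]
        rw [this]; exact MeasurableSet.empty
    have hK : ∀ γ γ', MeasurableSet {p | key τ p γ ≤ key τ p γ'} := by
      intro γ γ'
      have : {p | key τ p γ ≤ key τ p γ'} = {p | (γ⁻¹ * io τ p).x < (γ'⁻¹ * io τ p).x} ∪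
          ({p | (γ⁻¹ * io τ p).x = (γ'⁻¹ * io τ p).x} ∩ {p | (γ⁻¹ * io τ p).y ≤ (γ'⁻¹ * io τ p).y}) := by
        ext p
        simp only [key, mem_ofPred_eq, Prod.Lex.toLex_le_toLex, mem_union, mem_inter_iff]
      rw [this]
      exact (measurableSet_lt (meas_x _ _) (meas_x _ _)).union ((measurableSet_eq_fun (meas_x _ _) (meas_x _ _)).inter (measurableSet_le (meas_y _ _) (meas_y _ _)))
    have : {p | π p = γ} = {p | γ ∈ Cnd Γ τ R p} ∩ ⋂ γ' ∈ (Γ : Set SOL), ({p | γ' ∈ Cnd Γ τ R p}ᶜ ∪ {p | key τ p γ ≤ key τ p γ'}) := by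
      ext p
      simp only [mem_inter_iff, mem_iInter, mem_union, mem_compl_iff, mem_ofPred_eq]
      constructor
      · rintro rfl
        refine ⟨(hπ p).1, fun γ' _ => ?_⟩
        by_cases h : γ' ∈ Cnd Γ τ R p
        · exact Or.inr ((hπ p).2 _ h)
        · exact Or.inl h
      · rintro ⟨h1, h2⟩
        exact uniq _ _ _ (hπ p) ⟨h1, fun γ' h' => (h2 γ' h'.1).resolve_left (not_not.2 h')⟩
    rw [this]
    exact (hC γ).inter (MeasurableSet.biInter L.countable fun γ' _ => (hC γ').compl.union (hK γ γ'))

end Lat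

/-! ### word metric -/

theorem wd_eq (S : Set SOL) (g h : SOL) : wordDist S g h = wordDist S 1 (g⁻¹ * h) := by
  simp [wordDist]

theorem wd_list (S : Set SOL) (Γ : Subgroup SOL) (hS : Subgroup.closure S = Γ) (g : SOL) (hg : g ∈ Γ) :
    ∃ l : List SOL, l.length = wordDist S 1 g ∧ (∀ w ∈ l, w ∈ S ∨ w⁻¹ ∈ S) ∧ g = l.prod := by
  rw [← hS] at hg
  rw [← Subgroup.mem_toSubmonoid, Subgroup.closure_toSubmonoid] at hg
  obtain ⟨l, hl, hp⟩ := Submonoid.exists_list_of_mem_closure hg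
  have hne : {n : ℕ | ∃ l : List SOL, l.length = n ∧ (∀ w ∈ l, w ∈ S ∨ w⁻¹ ∈ S) ∧ (1 : SOL)⁻¹ * g = l.prod}.Nonempty :=
    ⟨_, l, rfl, hl, by simpa using hp.symm⟩
  obtain ⟨l', h1, h2, h3⟩ := Nat.sInf_mem hne
  exact ⟨l', h1, h2, by simpa using h3⟩

theorem wd_le_of_Box {Γ : Subgroup SOL} {τ : ℝ} (L : Lat Γ τ) (S : Set SOL) (R : ℝ) :
    ∃ C : ℕ, ∀ γ ∈ Γ, ∀ γ' ∈ Γ, γ⁻¹ * γ' ∈ Box R → wordDist S γ γ' ≤ C := by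
  obtain ⟨C, hC⟩ := ((L.fin R).image (wordDist S 1)).bddAbove
  refine ⟨C, fun γ h γ' h' hB => ?_⟩
  rw [wd_eq]
  exact hC ⟨_, ⟨Γ.mul_mem (Γ.inv_mem h) h', hB⟩, rfl⟩

theorem Box_of_wd (Γ : Subgroup SOL) (S : Finset SOL) (hS : Subgroup.closure (S : Set SOL) = Γ) (C : ℕ) :
    ∃ R, ∀ γ ∈ Γ, ∀ γ' ∈ Γ, wordDist (S : Set SOL) γ γ' ≤ C → γ⁻¹ * γ' ∈ Box R := by
  obtain ⟨R1, h1⟩ := Box_finite S.finite_toSet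
  obtain ⟨R2, h2⟩ := Box_inv R1
  have key : ∀ n : ℕ, ∃ R, ∀ l : List SOL, l.length ≤ n → (∀ w ∈ l, w ∈ (S : Set SOL) ∨ w⁻¹ ∈ (S : Set SOL)) → l.prod ∈ Box R := by
    intro n
    induction n with
    | zero =>
      refine ⟨0, fun l hl _ => ?_⟩
      rw [List.length_eq_zero_iff.1 (Nat.le_zero.1 hl)]
      simp [Box]
    | succ n ih =>
      obtain ⟨R, hR⟩ := ih
      obtain ⟨R3, h3⟩ := Box_mul (max R1 R2) R
      refine ⟨max 0 R3, fun l hl hw => ?_⟩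
      cases l with
      | nil => exact Box_mono (le_max_left _ _) (by simp [Box])
      | cons a l =>
        rw [List.prod_cons]
        refine Box_mono (le_max_right _ _) (h3 _ ?_ _ (hR l (by simpa using hl) fun w hw' => hw w (List.mem_cons_of_mem _ hw')))
        rcases hw a List.mem_cons_self with ha | ha
        · exact Box_mono (le_max_left _ _) (h1 ha)
        · have := h2 _ (h1 ha)
          rw [inv_inv] at this
          exact Box_mono (le_max_right _ _) this
  obtain ⟨R, hR⟩ := key C
  refine ⟨R, fun γ h γ' h' hd => ?_⟩
  obtain ⟨l, e1, e2, e3⟩ := wd_list S Γ hS _ (Γ.mul_mem (Γ.inv_mem h) h')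
  rw [wd_eq] at hd
  rw [e3]
  exact hR l (e1 ▸ hd) e2

end SolPf
end

section
open MeasureTheory Set Filter Topology
namespace SolPf

theorem near_mono {b ρ ρ' : ℝ} (hb : 0 < b) (h : ρ ≤ ρ') {p q : P} (hn : near b ρ p q) : near b ρ' p q :=
  ⟨hn.1.trans (mul_le_mul_of_nonneg_right h (zpow_pos hb _).le), hn.2.1.trans (mul_le_mul_of_nonneg_right h (zpow_pos hb _).le), hn.2.2.trans h⟩

def DD (Γ : Subgroup SOL) (τ : ℝ) : Set SOL := {γ | γ ∈ Γ ∧ hz τ γ ∈ HH}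

theorem HH_succ {k : ℤ} (h : k ∉ HH) : k + 1 ∈ HH := by
  left
  have : ¬ Even k := fun he => h (Or.inl he)
  exact Int.even_add_one.2 this

namespace Lat
variable {Γ : Subgroup SOL} {τ : ℝ} (L : Lat Γ τ)
include L

theorem sand (R0 ρ : ℝ) : ∃ R1, ∀ p q : P, ∀ a b : SOL, a⁻¹ * io τ p ∈ Box R0 → b⁻¹ * io τ q ∈ Box R0 →
    near (Real.exp τ) ρ p q → a⁻¹ * b ∈ Box R1 := by
  obtain ⟨R1, h1⟩ := L.Box_of_near ρ
  obtain ⟨R2, h2⟩ := Box_mul R0 R1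
  obtain ⟨R3, h3⟩ := Box_inv R0
  obtain ⟨R4, h4⟩ := Box_mul R2 R3
  refine ⟨R4, fun p q a b ha hb hn => ?_⟩
  have := h4 _ (h2 _ ha _ (h1 p q hn)) _ (h3 _ hb)
  rwa [show a⁻¹ * io τ p * ((io τ p)⁻¹ * io τ q) * (b⁻¹ * io τ q)⁻¹ = a⁻¹ * b by group] at this

theorem sand' (R0 R1 : ℝ) : ∃ ρ, ∀ p q : P, ∀ a b : SOL, a⁻¹ * io τ p ∈ Box R0 → b⁻¹ * io τ q ∈ Box R0 →
    a⁻¹ * b ∈ Box R1 → near (Real.exp τ) ρ p q := by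
  obtain ⟨R2, h2⟩ := Box_inv R0
  obtain ⟨R3, h3⟩ := Box_mul R2 R1
  obtain ⟨R4, h4⟩ := Box_mul R3 R0
  obtain ⟨ρ, h5⟩ := L.near_of_Box R4
  refine ⟨ρ, fun p q a b ha hb hn => h5 _ _ ?_⟩
  have := h4 _ (h3 _ (h2 _ ha) _ hn) _ hb
  rwa [show (a⁻¹ * io τ p)⁻¹ * (a⁻¹ * b) * (b⁻¹ * io τ q) = (io τ p)⁻¹ * io τ q by group] at this

theorem no_equiv (E : DD Γ τ ≃ Γ)
    (T1 : ∀ R, ∃ R', ∀ d d' : DD Γ τ, (d : SOL)⁻¹ * d' ∈ Box R → (E d : SOL)⁻¹ * E d' ∈ Box R')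
    (T2 : ∀ R, ∃ R', ∀ d d' : DD Γ τ, (E d : SOL)⁻¹ * E d' ∈ Box R → (d : SOL)⁻¹ * d' ∈ Box R') : False := by
  have hτ := L.pos
  obtain ⟨R0, π, hc⟩ := L.exists_cell
  obtain ⟨g, hg, hgt⟩ := L.gen
  have hzg : hz τ g = 1 := hz_of hτ (by rw [hgt]; simp)
  have : Countable Γ := L.countable.to_subtype
  have : Countable (DD Γ τ) := (L.countable.mono fun γ hγ => hγ.1).to_subtype
  let πΓ : P → Γ := fun p => ⟨π p, hc.mem p⟩
  have hπΓ : ∀ γ : Γ, MeasurableSet {p | πΓ p = γ} := by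
    intro γ
    have : {p | πΓ p = γ} = {p | π p = γ} := by ext p; simp only [mem_ofPred_eq, πΓ, Subtype.ext_iff]
    rw [this]; exact hc.meas _
  -- the cocycle
  let sg : Γ → Γ := fun γ => ⟨(E.symm γ : SOL) * (γ : SOL)⁻¹, Γ.mul_mem (E.symm γ).2.1 (Γ.inv_mem γ.2)⟩
  let Θ : P → P := fun w => act τ (sg (πΓ w)) w
  have hπΘ : ∀ w, π (Θ w) = E.symm (πΓ w) := by
    intro w
    simp only [Θ]
    rw [hc.equiv _ (sg (πΓ w)).2]
    simp [sg, πΓ]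
  have pre : ∀ S : Set P, Θ ⁻¹' S = ⋃ γ : Γ, act τ (sg γ) ⁻¹' ({p | π p = E.symm γ} ∩ S) := by
    intro S
    ext w
    simp only [mem_preimage, mem_iUnion, mem_inter_iff, mem_ofPred_eq]
    constructor
    · intro h
      exact ⟨πΓ w, hπΘ w, h⟩
    · rintro ⟨γ, h1, h2⟩
      have : πΓ w = γ := by
        rw [hc.equiv _ (sg γ).2] at h1
        simp only [sg] at h1
        rw [mul_assoc, mul_eq_left, inv_mul_eq_one] at h1
        exact Subtype.ext h1.symm
      simp only [Θ, this]
      exact h2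
  have cm : ∀ (d : SOL) (S : Set P), MeasurableSet S → MeasurableSet ({p | π p = d} ∩ S) := fun d S hS => (hc.meas d).inter hS
  have Θm : Measurable Θ := by
    intro S hS
    rw [pre]
    exact MeasurableSet.iUnion fun γ => act_meas _ _ (cm _ _ hS)
  have hΘ : MeasurePreserving Θ vol (vol.restrict {p | p.2.2 ∈ HH}) := by
    refine ⟨Θm, ?_⟩
    ext S hS
    rw [Measure.map_apply Θm hS, Measure.restrict_apply hS, pre, measure_iUnion]
    · have e1 : ∀ γ : Γ, vol (act τ (sg γ) ⁻¹' ({p | π p = E.symm γ} ∩ S)) = vol ({p | π p = E.symm γ} ∩ S) := fun γ =>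
        (act_mp τ (sg γ)).measure_preimage (cm _ _ hS).nullMeasurableSet
      simp_rw [e1]
      rw [E.symm.tsum_eq (fun d : DD Γ τ => vol ({p | π p = d} ∩ S)), ← measure_iUnion]
      · congr 1
        ext p
        simp only [mem_iUnion, mem_inter_iff, mem_ofPred_eq]
        constructor
        · rintro ⟨d, h1, h2⟩
          refine ⟨h2, ?_⟩
          rw [← hc.hzp p, h1]
          exact d.2.2
        · rintro ⟨h1, h2⟩
          exact ⟨⟨π p, hc.mem p, by rw [hc.hzp]; exact h2⟩, rfl, h1⟩
      · intro d d' hne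
        refine Set.disjoint_left.2 fun p h1 h2 => hne (Subtype.ext ?_)
        exact h1.1.symm.trans h2.1
      · exact fun d => cm _ _ hS
    · intro γ γ' hne
      refine Set.disjoint_left.2 fun p h1 h2 => hne ?_
      have q1 : π (act τ (sg γ) p) = E.symm γ := h1.1
      have q2 : π (act τ (sg γ') p) = E.symm γ' := h2.1
      rw [hc.equiv _ (sg _).2] at q1 q2
      simp only [sg] at q1 q2
      rw [mul_assoc, mul_eq_left, inv_mul_eq_one] at q1 q2
      exact Subtype.ext (q1.trans q2.symm)
    · exact fun γ => act_meas _ _ (cm _ _ hS)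
  -- rounding to `D`
  have rd : ∀ γ : Γ, ∃ d : DD Γ τ, ((d : SOL) = γ ∨ (d : SOL) = γ * g) ∧ ((γ : SOL) ∈ DD Γ τ → (d : SOL) = γ) := by
    intro γ
    by_cases h : (γ : SOL) ∈ DD Γ τ
    · exact ⟨⟨γ, h⟩, Or.inl rfl, fun _ => rfl⟩
    · refine ⟨⟨γ * g, Γ.mul_mem γ.2 hg, ?_⟩, Or.inr rfl, fun h' => absurd h' h⟩
      rw [L.hz_mul γ.2 hg, hzg]
      exact HH_succ fun h' => h ⟨γ.2, h'⟩
  choose F hF1 hF2 using rd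
  let Φ : P → P := fun p => toP τ (E (F (πΓ p)))
  have Φm : Measurable fun p => (Φ p).2.2 := by
    intro S _
    have : (fun p => (Φ p).2.2) ⁻¹' S = ⋃ γ ∈ {γ : Γ | (toP τ (E (F γ))).2.2 ∈ S}, {p | πΓ p = γ} := by
      ext p
      simp only [mem_preimage, mem_iUnion, mem_ofPred_eq, Φ, exists_prop, exists_eq_right']
    rw [this]
    exact MeasurableSet.biUnion (to_countable _) fun γ _ => hπΓ γ
  have comp : ∀ w, (Φ (Θ w)).2.2 = w.2.2 := by
    intro w
    have e1 : (F (πΓ (Θ w)) : SOL) = E.symm (πΓ w) := by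
      have h1 : ((πΓ (Θ w) : Γ) : SOL) = E.symm (πΓ w) := hπΘ w
      rw [hF2 _ (by rw [h1]; exact (E.symm (πΓ w)).2), h1]
    have e2 : F (πΓ (Θ w)) = E.symm (πΓ w) := Subtype.ext e1
    simp only [Φ, e2, Equiv.apply_symm_apply, toP]
    exact hc.hzp w
  have ioΦ : ∀ p, io τ (Φ p) = E (F (πΓ p)) := fun p => L.io_toP (E (F (πΓ p))).2
  have boxΘ : ∀ w, ((E.symm (πΓ w) : DD Γ τ) : SOL)⁻¹ * io τ (Θ w) ∈ Box R0 := by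
    intro w
    have := hc.box (Θ w)
    rwa [hπΘ] at this
  obtain ⟨RF, boxF⟩ : ∃ RF, ∀ p, (F (πΓ p) : SOL)⁻¹ * io τ p ∈ Box RF := by
    obtain ⟨Rg, hRg⟩ := Box_mem g⁻¹
    obtain ⟨R', hR'⟩ := Box_mul Rg R0
    refine ⟨max R0 R', fun p => ?_⟩
    rcases hF1 (πΓ p) with h | h
    · rw [h]; exact Box_mono (le_max_left _ _) (hc.box p)
    · rw [h, mul_inv_rev, mul_assoc]
      exact Box_mono (le_max_right _ _) (hR' _ hRg _ (hc.box p))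
  have boxΦ : ∀ p, (E (F (πΓ p)) : SOL)⁻¹ * io τ (Φ p) ∈ Box 0 := by
    intro p
    rw [ioΦ, inv_mul_cancel]
    simp [Box]
  obtain ⟨B1, hB1⟩ : ∃ ρ, ∀ p q, near (Real.exp τ) 1 p q → near (Real.exp τ) ρ (Θ p) (Θ q) := by
    obtain ⟨r1, h1⟩ := L.sand R0 1
    obtain ⟨r2, h2⟩ := T2 r1
    obtain ⟨ρ, h3⟩ := L.sand' R0 r2
    refine ⟨ρ, fun p q h => h3 _ _ _ _ (boxΘ p) (boxΘ q) (h2 _ _ ?_)⟩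
    rw [Equiv.apply_symm_apply, Equiv.apply_symm_apply]
    exact h1 _ _ _ _ (hc.box p) (hc.box q) h
  obtain ⟨B2, hB2⟩ : ∃ ρ, ∀ p q, near (Real.exp τ) 1 (Θ p) (Θ q) → near (Real.exp τ) ρ p q := by
    obtain ⟨r1, h1⟩ := L.sand R0 1
    obtain ⟨r2, h2⟩ := T1 r1
    obtain ⟨ρ, h3⟩ := L.sand' R0 r2
    refine ⟨ρ, fun p q h => h3 _ _ _ _ (hc.box p) (hc.box q) ?_⟩
    have := h2 _ _ (h1 _ _ _ _ (boxΘ p) (boxΘ q) h)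
    rwa [Equiv.apply_symm_apply, Equiv.apply_symm_apply] at this
  obtain ⟨B3, hB3⟩ : ∃ ρ, ∀ p q, near (Real.exp τ) 1 p q → near (Real.exp τ) ρ (Φ p) (Φ q) := by
    obtain ⟨r1, h1⟩ := L.sand RF 1
    obtain ⟨r2, h2⟩ := T1 r1
    obtain ⟨ρ, h3⟩ := L.sand' 0 r2
    exact ⟨ρ, fun p q h => h3 _ _ _ _ (boxΦ p) (boxΦ q) (h2 _ _ (h1 _ _ _ _ (boxF p) (boxF q) h))⟩
  obtain ⟨B4, hB4⟩ : ∃ ρ, ∀ p q, near (Real.exp τ) 1 (Φ p) (Φ q) → near (Real.exp τ) ρ p q := by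
    obtain ⟨r1, h1⟩ := L.sand 0 1
    obtain ⟨r2, h2⟩ := T2 r1
    obtain ⟨ρ, h3⟩ := L.sand' RF r2
    exact ⟨ρ, fun p q h => h3 _ _ _ _ (boxF p) (boxF q) (h2 _ _ (h1 _ _ _ _ (boxΦ p) (boxΦ q) h))⟩
  obtain ⟨B, hB⟩ := exists_nat_ge (max 1 (max (max B1 B2) (max B3 B4)))
  simp only [max_le_iff] at hB
  obtain ⟨b0, ⟨b1, b2⟩, b3, b4⟩ := hB
  have he := Real.exp_pos τ
  exact core_false (Real.exp τ) (Real.one_lt_exp_iff.2 hτ) B (by exact_mod_cast b0) Θ Φ hΘ Φm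
    (fun p q h => near_mono he b1 (hB1 p q h)) (fun p q h => near_mono he b2 (hB2 p q h))
    (fun p q h => near_mono he b3 (hB3 p q h)) (fun p q h => near_mono he b4 (hB4 p q h)) comp

end Lat
end SolPf
end

open SolPf in
/-- Any lattice `Γ` in SOL (a discrete cocompact subgroup) contains a Delone subset `D`
(for any word metric on `Γ`) which is not biLipschitz equivalent to `Γ`. -/
theorem sol_lattice_contains_nonrectifiable_delone
    (Γ : Subgroup SOL)
    (hdiscrete : ∀ γ ∈ Γ, ∃ U : Set SOL, IsOpen U ∧ U ∩ (Γ : Set SOL) = {γ})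
    (hcocompact : ∃ C : Set SOL, IsCompact C ∧ ∀ g : SOL, ∃ γ ∈ Γ, ∃ c ∈ C, g = γ * c) :
    ∃ D : Set SOL, D ⊆ (Γ : Set SOL) ∧
      ∀ S : Finset SOL, Subgroup.closure (S : Set SOL) = Γ →
        -- `D` is a Delone subset of `(Γ, d_S)` (uniform discreteness being automatic):
        ((∃ C : ℝ, 0 < C ∧ ∀ γ ∈ Γ, ∃ d ∈ D, (wordDist (S : Set SOL) d γ : ℝ) ≤ C) ∧
        -- `D` is non-rectifiable: no biLipschitz bijection `D → Γ`:
        ¬ ∃ K : ℝ, 1 ≤ K ∧ ∃ f : D → Γ, Function.Bijective f ∧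
          ∀ p q : D,
            K⁻¹ * (wordDist (S : Set SOL) (p : SOL) (q : SOL) : ℝ) ≤
                (wordDist (S : Set SOL) (f p : SOL) (f q : SOL) : ℝ) ∧
              (wordDist (S : Set SOL) (f p : SOL) (f q : SOL) : ℝ) ≤
                K * (wordDist (S : Set SOL) (p : SOL) (q : SOL) : ℝ)) := by
  obtain ⟨τ, L⟩ := exists_lat Γ hdiscrete hcocompact
  refine ⟨DD Γ τ, fun γ h => h.1, fun S hS => ⟨?_, ?_⟩⟩
  · obtain ⟨g, hg, hgt⟩ := L.gen
    have hzg : hz τ g = 1 := hz_of L.pos (by rw [hgt]; simp)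
    refine ⟨max 1 (max (wordDist (S : Set SOL) 1 1) (wordDist (S : Set SOL) 1 g⁻¹)), by positivity, fun γ hγ => ?_⟩
    by_cases h : γ ∈ DD Γ τ
    · refine ⟨γ, h, ?_⟩
      rw [wd_eq, inv_mul_cancel]
      exact (le_max_left _ _).trans (le_max_right _ _)
    · refine ⟨γ * g, ⟨Γ.mul_mem hγ hg, ?_⟩, ?_⟩
      · rw [L.hz_mul hγ hg, hzg]
        exact HH_succ fun h' => h ⟨hγ, h'⟩
      · rw [wd_eq, show (γ * g)⁻¹ * γ = g⁻¹ by group]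
        exact (le_max_right _ _).trans (le_max_right _ _)
  · rintro ⟨K, hK, f, hf, hbl⟩
    have hK0 : 0 < K := by linarith
    refine L.no_equiv (Equiv.ofBijective f hf) (fun R => ?_) (fun R => ?_)
    · obtain ⟨C, hC⟩ := wd_le_of_Box L (S : Set SOL) R
      obtain ⟨N, hN⟩ := exists_nat_ge (K * C)
      obtain ⟨R', hR'⟩ := Box_of_wd Γ S hS N
      refine ⟨R', fun d d' h => hR' _ (f d).2 _ (f d').2 ?_⟩
      have h1 : (wordDist (S : Set SOL) (d : SOL) d' : ℝ) ≤ C := by exact_mod_cast hC _ d.2.1 _ d'.2.1 h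
      have h2 := (hbl d d').2.trans ((mul_le_mul_of_nonneg_left h1 hK0.le).trans hN)
      exact_mod_cast h2
    · obtain ⟨C, hC⟩ := wd_le_of_Box L (S : Set SOL) R
      obtain ⟨N, hN⟩ := exists_nat_ge (K * C)
      obtain ⟨R', hR'⟩ := Box_of_wd Γ S hS N
      refine ⟨R', fun d d' h => hR' _ d.2.1 _ d'.2.1 ?_⟩
      have h1 : (wordDist (S : Set SOL) (f d : SOL) (f d') : ℝ) ≤ C := by exact_mod_cast hC _ (f d).2 _ (f d').2 h
      have h3 := (inv_mul_le_iff₀ hK0).1 (hbl d d').1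
      have h2 := h3.trans ((mul_le_mul_of_nonneg_left h1 hK0.le).trans hN)
      exact_mod_cast h2
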